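/- For each κ₀ ∈ (0,1/2] and each θ ∈ [1/2,1) there exist p = p(n,m,ℓ,κ₀,θ) > 1 and η = η(n,m,ℓ,κ₀,θ) ∈ (0,1/2] such that: if u ∈ 𝒮 and u(0,0) < η, then sup over the set {(x,y) ∈ B_θ : |x| > p·u(0,0) and |x| > κ₀|y|} of the quantity |x|^{−1}(u(x,y) − α₀|x|) + |D(u(x,y) − α₀|x|)| + |x|·|D²(u(x,y) − α₀|x|)| is at most κ₀ (here B_θ is the closed ball of radius θ in ℝ^{n+ℓ} and D denotes the full gradient in (x,y)). -/

import Mathlib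

open Set
noncomputable section

/-- Euclidean space `ℝ^N`. -/
abbrev Euc (N : ℕ) := EuclideanSpace ℝ (Fin N)

/-- `i`-th partial derivative `D_i u`. -/
def pd {N : ℕ} (u : Euc N → ℝ) (i : Fin N) (x : Euc N) : ℝ :=
  fderiv ℝ u x (EuclideanSpace.single i 1)

/-- Second partial derivative `D_i D_j u`. -/
def pd2 {N : ℕ} (u : Euc N → ℝ) (i j : Fin N) (x : Euc N) : ℝ :=
  fderiv ℝ (fun z => pd u j z) x (EuclideanSpace.single i 1)

/-- `|Du|²`. -/
def gradSq {N : ℕ} (u : Euc N → ℝ) (x : Euc N) : ℝ := ∑ i, (pd u i x) ^ 2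

/-- The (non-divergence form) symmetric minimal surface operator
`𝓜(u) = Δu − Σ_{i,j} (D_iu D_ju/(1+|Du|²)) D_iD_ju − (m−1)/u`. -/
def smeM (m : ℕ) {N : ℕ} (u : Euc N → ℝ) (x : Euc N) : ℝ :=
  (∑ i, pd2 u i i x)
    - (∑ i, ∑ j, (pd u i x * pd u j x / (1 + gradSq u x)) * pd2 u i j x)
    - ((m : ℝ) - 1) / u x

/-- `α₀ = √((m−1)/(n−1))`. -/
def alpha0 (n m : ℕ) : ℝ := Real.sqrt (((m : ℝ) - 1) / ((n : ℝ) - 1))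

/-- Euclidean norm `|x|` of the first `n` coordinates of a point of `ℝ^{n+ℓ}`. -/
def xnorm (n ℓ : ℕ) (z : Euc (n + ℓ)) : ℝ :=
  Real.sqrt (∑ i : Fin n, (z (Fin.castAdd ℓ i)) ^ 2)

/-- Euclidean norm `|y|` of the last `ℓ` coordinates of a point of `ℝ^{n+ℓ}`. -/
def ynorm (n ℓ : ℕ) (z : Euc (n + ℓ)) : ℝ :=
  Real.sqrt (∑ j : Fin ℓ, (z (Fin.natAdd n j)) ^ 2)

/-- The class `𝒮` of `C²` solutions of the SME on the open unit ball of `ℝ^{n+ℓ}`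
lying strictly above the cone `α₀|x|`. -/
def memS (n m ℓ : ℕ) (u : Euc (n + ℓ) → ℝ) : Prop :=
  ContDiffOn ℝ 2 u (Metric.ball 0 1) ∧
  (∀ z ∈ Metric.ball (0 : Euc (n + ℓ)) 1, smeM m u z = 0) ∧
  (∀ z ∈ Metric.ball (0 : Euc (n + ℓ)) 1, 0 < u z - alpha0 n m * xnorm n ℓ z)

open Filter Topology

/-- The second Fréchet derivative as a bilinear map. -/
def D2 {E : Type*} [NormedAddCommGroup E] [NormedSpace ℝ E] (f : E → ℝ) (z : E) :
    E →L[ℝ] E →L[ℝ] ℝ :=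
  fderiv ℝ (fderiv ℝ f) z

section calculus

variable {E : Type*} [NormedAddCommGroup E] [NormedSpace ℝ E]

lemma D2_symm {f : E → ℝ} {z : E} (hf : ContDiffAt ℝ 2 f z) (ξ ζ : E) :
    D2 f z ξ ζ = D2 f z ζ ξ :=
  (hf.isSymmSndFDerivAt (by simp)).eq ξ ζ

lemma D2_eq_of_hasFDerivAt {f : E → ℝ} {f' : E → E →L[ℝ] ℝ} {f'' : E →L[ℝ] E →L[ℝ] ℝ} {z : E}
    (h : ∀ᶠ y in 𝓝 z, HasFDerivAt f (f' y) y) (h' : HasFDerivAt f' f'' z) :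
    D2 f z = f'' := by
  have : fderiv ℝ f =ᶠ[𝓝 z] f' := h.mono fun y hy => hy.fderiv
  rw [D2, this.fderiv_eq, h'.fderiv]

lemma eventually_differentiableAt {f : E → ℝ} {z : E} (hf : ContDiffAt ℝ 2 f z) :
    ∀ᶠ y in 𝓝 z, DifferentiableAt ℝ f y := by
  filter_upwards [hf.eventually (by simp)] with y hy using hy.differentiableAt (by simp)

lemma hasFDerivAt_fderiv {f : E → ℝ} {z : E} (hf : ContDiffAt ℝ 2 f z) :
    HasFDerivAt (fderiv ℝ f) (D2 f z) z :=
  ((hf.fderiv_right (m := 1) (by norm_num)).differentiableAt (by simp)).hasFDerivAt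

lemma D2_add {f g : E → ℝ} {z : E} (hf : ContDiffAt ℝ 2 f z) (hg : ContDiffAt ℝ 2 g z) :
    D2 (fun y => f y + g y) z = D2 f z + D2 g z := by
  apply D2_eq_of_hasFDerivAt (f' := fun y => fderiv ℝ f y + fderiv ℝ g y)
  · filter_upwards [eventually_differentiableAt hf, eventually_differentiableAt hg] with y h1 h2
    exact h1.hasFDerivAt.add h2.hasFDerivAt
  · exact (hasFDerivAt_fderiv hf).add (hasFDerivAt_fderiv hg)

lemma D2_sub {f g : E → ℝ} {z : E} (hf : ContDiffAt ℝ 2 f z) (hg : ContDiffAt ℝ 2 g z) :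
    D2 (fun y => f y - g y) z = D2 f z - D2 g z := by
  apply D2_eq_of_hasFDerivAt (f' := fun y => fderiv ℝ f y - fderiv ℝ g y)
  · filter_upwards [eventually_differentiableAt hf, eventually_differentiableAt hg] with y h1 h2
    exact h1.hasFDerivAt.sub h2.hasFDerivAt
  · exact (hasFDerivAt_fderiv hf).sub (hasFDerivAt_fderiv hg)

lemma D2_const_mul {f : E → ℝ} {z : E} (c : ℝ) (hf : ContDiffAt ℝ 2 f z) :
    D2 (fun y => c * f y) z = c • D2 f z := by
  apply D2_eq_of_hasFDerivAt (f' := fun y => c • fderiv ℝ f y)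
  · filter_upwards [eventually_differentiableAt hf] with y h1
    exact h1.hasFDerivAt.const_mul c
  · exact (hasFDerivAt_fderiv hf).const_smul c

lemma D2_mul_self {f g : E → ℝ} {z : E} (hf : ContDiffAt ℝ 2 f z) (hg : ContDiffAt ℝ 2 g z)
    (ξ : E) :
    D2 (fun y => f y * g y) z ξ ξ
      = f z * D2 g z ξ ξ + 2 * fderiv ℝ f z ξ * fderiv ℝ g z ξ + g z * D2 f z ξ ξ := by
  have hfd := hf.differentiableAt (by simp)
  have hgd := hg.differentiableAt (by simp)
  rw [D2_eq_of_hasFDerivAt (f' := fun y => f y • fderiv ℝ g y + g y • fderiv ℝ f y)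
    (f'' := _) _
    ((hfd.hasFDerivAt.smul (hasFDerivAt_fderiv hg)).add
      (hgd.hasFDerivAt.smul (hasFDerivAt_fderiv hf)))]
  · simp [ContinuousLinearMap.smulRight_apply]
    ring
  · filter_upwards [eventually_differentiableAt hf, eventually_differentiableAt hg] with y h1 h2
    exact h1.hasFDerivAt.mul h2.hasFDerivAt

lemma D2_comp_self {f : E → ℝ} {g : ℝ → ℝ} {g' : ℝ → ℝ} {g'' : ℝ} {z : E}
    (hf : ContDiffAt ℝ 2 f z) (hg : ∀ᶠ t in 𝓝 (f z), HasDerivAt g (g' t) t)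
    (hg' : HasDerivAt g' g'' (f z)) (ξ : E) :
    D2 (fun y => g (f y)) z ξ ξ = g'' * fderiv ℝ f z ξ ^ 2 + g' (f z) * D2 f z ξ ξ := by
  have hfd := hf.differentiableAt (by simp)
  rw [D2_eq_of_hasFDerivAt (f' := fun y => g' (f y) • fderiv ℝ f y)
    (f'' := _) _
    ((hg'.comp_hasFDerivAt z hfd.hasFDerivAt).smul (hasFDerivAt_fderiv hf))]
  · simp [ContinuousLinearMap.smulRight_apply]
    ring
  · filter_upwards [eventually_differentiableAt hf, hf.continuousAt.eventually hg] with y h1 h2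
    exact h2.comp_hasFDerivAt y h1.hasFDerivAt

/-- Restricting to a line computes the second derivative. -/
lemma deriv_deriv_line {f : E → ℝ} {z : E} (hf : ContDiffAt ℝ 2 f z) (ξ : E) :
    deriv (deriv fun t : ℝ => f (z + t • ξ)) 0 = D2 f z ξ ξ := by
  have hc : Tendsto (fun t : ℝ => z + t • ξ) (𝓝 0) (𝓝 z) := by
    have : Continuous fun t : ℝ => z + t • ξ := by fun_prop
    simpa using this.tendsto 0
  have hl : ∀ t : ℝ, HasDerivAt (fun t : ℝ => z + t • ξ) ξ t := fun t => by
    simpa using ((hasDerivAt_id t).smul_const ξ).const_add z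
  have h1 : deriv (fun t : ℝ => f (z + t • ξ)) =ᶠ[𝓝 0] fun t => fderiv ℝ f (z + t • ξ) ξ := by
    filter_upwards [hc.eventually (eventually_differentiableAt hf)] with t ht
    exact (ht.hasFDerivAt.comp_hasDerivAt t (hl t)).deriv
  rw [h1.deriv_eq]
  have h2 : HasFDerivAt (fderiv ℝ f) (D2 f z) (z + (0:ℝ) • ξ) := by
    simpa using hasFDerivAt_fderiv hf
  have h3 := h2.comp_hasDerivAt (0:ℝ) (hl 0)
  have h4 := ((ContinuousLinearMap.apply ℝ ℝ ξ).hasFDerivAt.comp_hasDerivAt (0:ℝ) h3).deriv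
  simpa [Function.comp_def] using h4

lemma IsLocalMax.D2_nonpos {f : E → ℝ} {z : E} (h : IsLocalMax f z) (hf : ContDiffAt ℝ 2 f z)
    (ξ : E) : D2 f z ξ ξ ≤ 0 := by
  by_contra! hpos
  have hc : Tendsto (fun t : ℝ => z + t • ξ) (𝓝 0) (𝓝 z) := by
    have : Continuous fun t : ℝ => z + t • ξ := by fun_prop
    simpa using this.tendsto 0
  set g : ℝ → ℝ := fun t => f (z + t • ξ) with hg
  have hmax : IsLocalMax g 0 := by
    have := hc.eventually h
    simpa [IsLocalMax, IsMaxFilter, hg] using this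
  have h2 : 0 < deriv (deriv g) 0 := by rw [deriv_deriv_line hf]; exact hpos
  have hcont : ContinuousAt g 0 := by
    have : ContinuousAt f (z + (0:ℝ) • ξ) := by simpa using hf.continuousAt
    exact ContinuousAt.comp (f := fun t : ℝ => z + t • ξ) this (by fun_prop)
  have hmin := isLocalMin_of_deriv_deriv_pos h2 hmax.deriv_eq_zero hcont
  have hconst : g =ᶠ[𝓝 0] fun _ => g 0 := by
    filter_upwards [hmax, hmin] with t h1 h2 using le_antisymm h1 h2
  have h3 : deriv g =ᶠ[𝓝 0] fun _ => 0 := by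
    have := hconst.deriv
    simpa using this
  rw [h3.deriv_eq] at h2
  simp at h2

lemma IsLocalMin.D2_nonneg {f : E → ℝ} {z : E} (h : IsLocalMin f z) (hf : ContDiffAt ℝ 2 f z)
    (ξ : E) : 0 ≤ D2 f z ξ ξ := by
  have h1 := IsLocalMax.D2_nonpos (f := fun y => (-1) * f y) (z := z)
    (by filter_upwards [h] with y hy; simpa using hy) (contDiffAt_const.mul hf) ξ
  rw [D2_const_mul _ hf] at h1
  simpa using h1

end calculus

/-- The elliptic operator `(1 + |p|²) tr Q - Q(p)` acting on a quadratic form `Q`. -/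
def opE {N : ℕ} (p : Euc N) (Q : Euc N → ℝ) : ℝ :=
  (1 + ‖p‖ ^ 2) * ∑ k, Q (EuclideanSpace.single k 1) - Q p

/-- The symbol of `opE`. -/
def symE {N : ℕ} (p x y : Euc N) : ℝ :=
  (1 + ‖p‖ ^ 2) * inner ℝ x y - inner ℝ p x * inner ℝ p y

section algebra

variable {N : ℕ}

lemma opE_add (p : Euc N) (Q R : Euc N → ℝ) :
    opE p (fun ξ => Q ξ + R ξ) = opE p Q + opE p R := by
  simp only [opE, Finset.sum_add_distrib]; ring

lemma opE_sub (p : Euc N) (Q R : Euc N → ℝ) :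
    opE p (fun ξ => Q ξ - R ξ) = opE p Q - opE p R := by
  simp only [opE, Finset.sum_sub_distrib]; ring

lemma opE_const_mul (p : Euc N) (c : ℝ) (Q : Euc N → ℝ) :
    opE p (fun ξ => c * Q ξ) = c * opE p Q := by
  simp only [opE, ← Finset.mul_sum]; ring

lemma norm_sq_eq_sum (x : Euc N) : ‖x‖ ^ 2 = ∑ k, x k ^ 2 := by
  rw [EuclideanSpace.real_norm_sq_eq]

lemma sum_inner_single_mul (x y : Euc N) :
    ∑ k, inner ℝ x (EuclideanSpace.single k (1:ℝ)) * inner ℝ y (EuclideanSpace.single k (1:ℝ))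
      = inner ℝ x y := by
  simp [PiLp.inner_apply, mul_comm]

lemma opE_inner_mul (p x y : Euc N) :
    opE p (fun ξ => inner ℝ x ξ * inner ℝ y ξ) = symE p x y := by
  rw [opE, sum_inner_single_mul, symE, real_inner_comm p x, real_inner_comm p y]

lemma opE_norm_sq (p : Euc N) : opE p (fun ξ => ‖ξ‖ ^ 2) = N * (1 + ‖p‖ ^ 2) - ‖p‖ ^ 2 := by
  simp [opE]; ring

lemma symE_self_ge (p x : Euc N) : ‖x‖ ^ 2 ≤ symE p x x := by
  have h := abs_real_inner_le_norm p x
  have h2 : inner ℝ p x * inner ℝ p x ≤ ‖p‖ ^ 2 * ‖x‖ ^ 2 := by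
    have := mul_self_le_mul_self (abs_nonneg _) h
    rw [abs_mul_abs_self] at this
    nlinarith
  rw [symE, real_inner_self_eq_norm_sq]
  nlinarith

/-- The elementary bivector field of `p` in the plane of the `i`-th and `j`-th axes. -/
def bivec (p : Euc N) (i j : Fin N) : Euc N :=
  p i • EuclideanSpace.single j 1 - p j • EuclideanSpace.single i 1

lemma bivec_sub (p q : Euc N) (i j : Fin N) : bivec (p - q) i j = bivec p i j - bivec q i j := by
  simp only [bivec, PiLp.sub_apply, sub_smul]; abel

lemma eq_sum_single (p : Euc N) : p = ∑ k, p k • EuclideanSpace.single k (1:ℝ) := by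
  simpa using ((EuclideanSpace.basisFun (Fin N) ℝ).sum_repr p).symm

lemma apply_eq_sum (B : Euc N →L[ℝ] Euc N →L[ℝ] ℝ) (p q : Euc N) :
    B p q = ∑ i, ∑ j, p i * q j * B (EuclideanSpace.single i 1) (EuclideanSpace.single j 1) := by
  conv_lhs => rw [eq_sum_single p, eq_sum_single q]
  simp only [map_sum, sum_apply, map_smul, smul_apply,
    smul_eq_mul, Finset.mul_sum]
  rw [Finset.sum_comm]
  refine Finset.sum_congr rfl fun i _ => Finset.sum_congr rfl fun j _ => ?_
  ring

lemma sum_bivec (B : Euc N →L[ℝ] Euc N →L[ℝ] ℝ) (p : Euc N) :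
    ∑ i, ∑ j, B (bivec p i j) (bivec p i j)
      = 2 * (‖p‖ ^ 2 * ∑ k, B (EuclideanSpace.single k 1) (EuclideanSpace.single k 1) - B p p) := by
  have h1 : ∀ i j, B (bivec p i j) (bivec p i j)
      = p i ^ 2 * B (EuclideanSpace.single j 1) (EuclideanSpace.single j 1)
        + p j ^ 2 * B (EuclideanSpace.single i 1) (EuclideanSpace.single i 1)
        - p j * p i * B (EuclideanSpace.single j 1) (EuclideanSpace.single i 1)
        - p i * p j * B (EuclideanSpace.single i 1) (EuclideanSpace.single j 1) := by
    intro i j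
    simp only [bivec, map_sub, map_smul, sub_apply,
      smul_apply, smul_eq_mul]
    ring
  simp only [h1, Finset.sum_sub_distrib, Finset.sum_add_distrib]
  rw [← apply_eq_sum B p p, Finset.sum_comm (f := fun i j => p j * p i *
    B (EuclideanSpace.single j 1) (EuclideanSpace.single i 1)), ← apply_eq_sum B p p]
  simp only [← Finset.mul_sum, ← Finset.sum_mul]
  rw [norm_sq_eq_sum]
  ring

/-- `opE` as a sum over explicit vectors depending linearly on `p`. -/
lemma opE_eq_sum (B : Euc N →L[ℝ] Euc N →L[ℝ] ℝ) (p : Euc N) :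
    opE p (fun ξ => B ξ ξ) = ∑ k, B (EuclideanSpace.single k 1) (EuclideanSpace.single k 1)
      + (1 / 2) * ∑ i, ∑ j, B (bivec p i j) (bivec p i j) := by
  rw [sum_bivec, opE]; ring

lemma opE_nonneg (B : Euc N →L[ℝ] Euc N →L[ℝ] ℝ) (p : Euc N) (h : ∀ ξ, 0 ≤ B ξ ξ) :
    0 ≤ opE p (fun ξ => B ξ ξ) := by
  rw [opE_eq_sum]
  have h1 := Finset.sum_nonneg fun (k : Fin N) (_ : k ∈ Finset.univ) =>
    h (EuclideanSpace.single k 1)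
  have h2 := Finset.sum_nonneg fun (i : Fin N) (_ : i ∈ Finset.univ) =>
    Finset.sum_nonneg fun (j : Fin N) (_ : j ∈ Finset.univ) => h (bivec p i j)
  linarith

lemma opE_mono (B C : Euc N →L[ℝ] Euc N →L[ℝ] ℝ) (p : Euc N) (h : ∀ ξ, B ξ ξ ≤ C ξ ξ) :
    opE p (fun ξ => B ξ ξ) ≤ opE p (fun ξ => C ξ ξ) := by
  have := opE_nonneg (C - B) p fun ξ => by simpa using h ξ
  simp only [sub_apply] at this
  rw [opE_sub] at this
  linarith

lemma abs_sum_single_le (B : Euc N →L[ℝ] Euc N →L[ℝ] ℝ) :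
    |∑ k, B (EuclideanSpace.single k 1) (EuclideanSpace.single k 1)| ≤ N * ‖B‖ := by
  refine (Finset.abs_sum_le_sum_abs _ _).trans ?_
  refine (Finset.sum_le_card_nsmul _ _ ‖B‖ fun k _ => ?_).trans (by simp)
  have := B.le_opNorm₂ (EuclideanSpace.single k 1) (EuclideanSpace.single k 1)
  simpa using this

lemma abs_opE_le (B : Euc N →L[ℝ] Euc N →L[ℝ] ℝ) (p : Euc N) :
    |opE p (fun ξ => B ξ ξ)| ≤ (N + 1) * (1 + ‖p‖ ^ 2) * ‖B‖ := by
  have h1 := abs_sum_single_le B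
  have h2 : |B p p| ≤ ‖B‖ * ‖p‖ * ‖p‖ := B.le_opNorm₂ p p
  have h0 : 0 ≤ ‖B‖ := norm_nonneg B
  rw [opE]
  refine (abs_sub _ _).trans ?_
  rw [abs_mul, abs_of_pos (by positivity : (0:ℝ) < 1 + ‖p‖ ^ 2)]
  nlinarith [mul_le_mul_of_nonneg_left h1 (by positivity : (0:ℝ) ≤ 1 + ‖p‖ ^ 2)]

/-- Differences of `opE` in the coefficient vector. -/
lemma opE_sub_opE (B : Euc N →L[ℝ] Euc N →L[ℝ] ℝ) (hB : ∀ x y, B x y = B y x) (p q : Euc N) :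
    opE p (fun ξ => B ξ ξ) - opE q (fun ξ => B ξ ξ)
      = inner ℝ (p - q) (p + q)
          * ∑ k, B (EuclideanSpace.single k 1) (EuclideanSpace.single k 1)
        - B (p - q) (p + q) := by
  have h1 : inner ℝ (p - q) (p + q) = ‖p‖ ^ 2 - ‖q‖ ^ 2 := by
    rw [inner_sub_left, inner_add_right, inner_add_right, real_inner_self_eq_norm_sq,
      real_inner_self_eq_norm_sq, real_inner_comm p q]
    ring
  rw [h1, opE, opE]
  simp only [map_sub, map_add, sub_apply]
  rw [hB p q]
  ring

end algebra

section gradient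

variable {N : ℕ}

lemma inner_gradient (u : Euc N → ℝ) (z ξ : Euc N) :
    inner ℝ (gradient u z) ξ = fderiv ℝ u z ξ := by
  rw [← toDual_gradient, InnerProductSpace.toDual_apply_apply]

lemma norm_gradient (u : Euc N → ℝ) (z : Euc N) : ‖gradient u z‖ = ‖fderiv ℝ u z‖ := by
  rw [← toDual_gradient]; exact ((InnerProductSpace.toDual ℝ (Euc N)).norm_map _).symm

lemma norm_gradient_sub (u v : Euc N → ℝ) (z y : Euc N) :
    ‖gradient u z - gradient v y‖ = ‖fderiv ℝ u z - fderiv ℝ v y‖ := by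
  rw [← toDual_gradient, ← toDual_gradient, ← map_sub]
  exact ((InnerProductSpace.toDual ℝ (Euc N)).norm_map _).symm

/-- The vector representing `ξ ↦ B e ξ`. -/
def rep (B : Euc N →L[ℝ] Euc N →L[ℝ] ℝ) (e : Euc N) : Euc N :=
  (InnerProductSpace.toDual ℝ (Euc N)).symm (B e)

lemma inner_rep (B : Euc N →L[ℝ] Euc N →L[ℝ] ℝ) (e ξ : Euc N) :
    inner ℝ (rep B e) ξ = B e ξ := by
  rw [rep, InnerProductSpace.toDual_symm_apply]

lemma continuous_opE : Continuous fun x : Euc N × (Euc N →L[ℝ] Euc N →L[ℝ] ℝ) =>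
    opE x.1 (fun ξ => x.2 ξ ξ) := by
  have hap : ∀ g : Euc N × (Euc N →L[ℝ] Euc N →L[ℝ] ℝ) → Euc N, Continuous g →
      Continuous fun x : Euc N × (Euc N →L[ℝ] Euc N →L[ℝ] ℝ) => x.2 (g x) (g x) :=
    fun g hg => (continuous_snd.clm_apply hg).clm_apply hg
  unfold opE
  exact ((continuous_const.add (continuous_fst.norm.pow 2)).mul
    (continuous_finsetSum _ fun k _ => hap _ continuous_const)).sub (hap _ continuous_fst)

lemma tendsto_opE {ι : Type*} {l : Filter ι} {p : ι → Euc N}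
    {B : ι → Euc N →L[ℝ] Euc N →L[ℝ] ℝ} {p₀ : Euc N} {B₀ : Euc N →L[ℝ] Euc N →L[ℝ] ℝ}
    (hp : Tendsto p l (𝓝 p₀)) (hB : Tendsto B l (𝓝 B₀)) :
    Tendsto (fun i => opE (p i) (fun ξ => B i ξ ξ)) l (𝓝 (opE p₀ (fun ξ => B₀ ξ ξ))) := by
  have h1 := (continuous_opE (N := N)).tendsto (p₀, B₀)
  have h2 : Tendsto (fun i => (p i, B i)) l (𝓝 (p₀, B₀)) := hp.prodMk_nhds hB
  have h3 := h1.comp h2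
  exact h3

lemma tendsto_gradient_quotient {ι : Type*} {l : Filter ι} {u : Euc N → ℝ} {z e : Euc N}
    {y : ι → Euc N} {t : ι → ℝ}
    (h : Tendsto (fun i => (t i)⁻¹ • (fderiv ℝ u (y i + t i • e) - fderiv ℝ u (y i))) l
      (𝓝 (D2 u z e))) :
    Tendsto (fun i => (t i)⁻¹ • (gradient u (y i + t i • e) - gradient u (y i))) l
      (𝓝 (rep (D2 u z) e)) := by
  have := ((InnerProductSpace.toDual ℝ (Euc N)).symm.continuous.tendsto (D2 u z e)).comp h
  refine this.congr fun i => ?_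
  simp [gradient]

end gradient

section calculus

variable {E F : Type*} [NormedAddCommGroup E] [NormedSpace ℝ E] [NormedAddCommGroup F]
  [NormedSpace ℝ F]

lemma tendsto_strict_quotient {ι : Type*} {l : Filter ι} {f : E → F} {f' : E →L[ℝ] F} {z : E}
    (hf : HasStrictFDerivAt f f' z) {y : ι → E} {t : ι → ℝ} (hy : Tendsto y l (𝓝 z))
    (ht : Tendsto t l (𝓝 0)) (ht0 : ∀ i, t i ≠ 0) (e : E) :
    Tendsto (fun i => (t i)⁻¹ • (f (y i + t i • e) - f (y i))) l (𝓝 (f' e)) := by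
  have h1 : Tendsto (fun i => (y i + t i • e, y i)) l (𝓝 (z, z)) := by
    have : Tendsto (fun i => y i + t i • e) l (𝓝 (z + (0:ℝ) • e)) :=
      hy.add (ht.smul_const e)
    exact (by simpa using this : Tendsto (fun i => y i + t i • e) l (𝓝 z)).prodMk_nhds hy
  have h2 := hf.isLittleO.comp_tendsto h1
  have h3 : (fun i => f (y i + t i • e) - f (y i) - t i • f' e) =o[l] t := by
    refine (h2.congr_left fun i => ?_).trans_isBigO ?_
    · simp [map_smul]
    · refine Asymptotics.IsBigO.of_bound ‖e‖ (Eventually.of_forall fun i => ?_)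
      simp [norm_smul, mul_comm]
  have h4 := (Asymptotics.isLittleO_iff_tendsto' (Eventually.of_forall fun i h => ?_)).1
    (h3.norm_norm)
  · rw [tendsto_iff_norm_sub_tendsto_zero]
    refine h4.congr fun i => ?_
    have : (t i)⁻¹ • (f (y i + t i • e) - f (y i)) - f' e
        = (t i)⁻¹ • (f (y i + t i • e) - f (y i) - t i • f' e) := by
      rw [smul_sub _ _ (t i • f' e), inv_smul_smul₀ (ht0 i)]
    rw [this, norm_smul, norm_inv]
    field_simp
  · exact absurd (norm_eq_zero.1 h) (ht0 i)

lemma D2_comp_add (f : E → ℝ) (v z : E) : D2 (fun y => f (y + v)) z = D2 f (z + v) := by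
  have : fderiv ℝ (fun y => f (y + v)) = fun y => fderiv ℝ f (y + v) := by
    ext1 y; exact fderiv_comp_add_right v
  rw [D2, this, fderiv_comp_add_right]; rfl

lemma hasStrictFDerivAt_fderiv {f : E → ℝ} {z : E} (hf : ContDiffAt ℝ 2 f z) :
    HasStrictFDerivAt (fderiv ℝ f) (D2 f z) z :=
  (hf.fderiv_right (m := 1) (by norm_num)).hasStrictFDerivAt (by simp)

lemma continuousAt_D2 {f : E → ℝ} {z : E} (hf : ContDiffAt ℝ 2 f z) :
    ContinuousAt (D2 f) z := by
  have h := (hf.fderiv_right (m := 1) (by norm_num)).fderiv_right (m := 0) (by norm_num)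
  exact h.continuousAt

end calculus

section normsq

variable {N : ℕ}

lemma hasFDerivAt_normsq (c z : Euc N) :
    HasFDerivAt (fun y : Euc N => ‖y - c‖ ^ 2) ((2:ℝ) • innerSL ℝ (z - c)) z := by
  have := ((hasFDerivAt_id z).sub_const c).norm_sq
  rw [ofNat_smul_eq_nsmul]
  simpa using this

lemma contDiff_normsq (c : Euc N) {k : WithTop ℕ∞} :
    ContDiff ℝ k fun y : Euc N => ‖y - c‖ ^ 2 :=
  (contDiff_id.sub contDiff_const).norm_sq ℝ

lemma fderiv_normsq (c z ξ : Euc N) :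
    fderiv ℝ (fun y : Euc N => ‖y - c‖ ^ 2) z ξ = 2 * inner ℝ (z - c) ξ := by
  rw [(hasFDerivAt_normsq c z).fderiv]; rfl

lemma D2_normsq (c z ξ : Euc N) :
    D2 (fun y : Euc N => ‖y - c‖ ^ 2) z ξ ξ = 2 * ‖ξ‖ ^ 2 := by
  have h : HasFDerivAt (fun y : Euc N => (2:ℝ) • (innerSL ℝ : Euc N →L[ℝ] Euc N →L[ℝ] ℝ) (y - c))
      ((2:ℝ) • (innerSL ℝ : Euc N →L[ℝ] Euc N →L[ℝ] ℝ)) z :=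
    ((innerSL ℝ : Euc N →L[ℝ] Euc N →L[ℝ] ℝ).hasFDerivAt.comp z
      ((hasFDerivAt_id z).sub_const c)).const_smul (2:ℝ)
  rw [D2_eq_of_hasFDerivAt (Eventually.of_forall fun y => hasFDerivAt_normsq c y) h]
  change 2 * inner ℝ ξ ξ = _
  rw [real_inner_self_eq_norm_sq]

lemma D2_norm_four (c z ξ : Euc N) :
    D2 (fun y : Euc N => (‖y - c‖ ^ 2) ^ 2) z ξ ξ
      = 8 * inner ℝ (z - c) ξ ^ 2 + 4 * ‖z - c‖ ^ 2 * ‖ξ‖ ^ 2 := by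
  have := D2_comp_self (g := fun t => t ^ 2) (g' := fun t => 2 * t) (g'' := 2)
    (contDiff_normsq c).contDiffAt (z := z)
    (Eventually.of_forall fun t => by simpa using hasDerivAt_pow 2 t)
    (by simpa using (hasDerivAt_id _).const_mul (2:ℝ)) ξ
  rw [this, D2_normsq, fderiv_normsq]; ring

end normsq

section maximum

variable {N : ℕ}

/-- Difference quotient of `u` in direction `e`. -/
def dq (u : Euc N → ℝ) (e : Euc N) (t : ℝ) (y : Euc N) : ℝ := t⁻¹ * (u (y + t • e) - u y)

lemma contDiffAt_dq {u : Euc N → ℝ} {e y : Euc N} {t : ℝ} (h1 : ContDiffAt ℝ 2 u y)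
    (h2 : ContDiffAt ℝ 2 u (y + t • e)) : ContDiffAt ℝ 2 (dq u e t) y :=
  contDiffAt_const.mul ((h2.comp y (f := fun y => y + t • e) (by fun_prop)).sub h1)

lemma fderiv_dq {u : Euc N → ℝ} {e y : Euc N} {t : ℝ} (h1 : ContDiffAt ℝ 2 u y)
    (h2 : ContDiffAt ℝ 2 u (y + t • e)) :
    fderiv ℝ (dq u e t) y = t⁻¹ • (fderiv ℝ u (y + t • e) - fderiv ℝ u y) := by
  have h3 : DifferentiableAt ℝ (fun y => u (y + t • e)) y :=
    (differentiableAt_comp_add_right (t • e)).2 (h2.differentiableAt (by simp))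
  have h4 := h1.differentiableAt (by simp)
  rw [← fderiv_comp_add_right (t • e)]
  exact ((h3.hasFDerivAt.sub h4.hasFDerivAt).const_mul t⁻¹).fderiv

lemma D2_dq {u : Euc N → ℝ} {e y : Euc N} {t : ℝ} (h1 : ContDiffAt ℝ 2 u y)
    (h2 : ContDiffAt ℝ 2 u (y + t • e)) :
    D2 (dq u e t) y = t⁻¹ • (D2 u (y + t • e) - D2 u y) := by
  have h3 : ContDiffAt ℝ 2 (fun y => u (y + t • e)) y :=
    h2.comp y (f := fun y => y + t • e) (by fun_prop)
  rw [← D2_comp_add u (t • e) y, ← D2_sub h3 h1]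
  exact D2_const_mul _ (h3.sub h1)

/-- The equation satisfied by difference quotients of a solution. -/
lemma opE_dq {u : Euc N → ℝ} {e y : Euc N} {t : ℝ} {g : Euc N → ℝ} (h1 : ContDiffAt ℝ 2 u y)
    (h2 : ContDiffAt ℝ 2 u (y + t • e))
    (e1 : opE (gradient u y) (fun ξ => D2 u y ξ ξ) = g y)
    (e2 : opE (gradient u (y + t • e)) (fun ξ => D2 u (y + t • e) ξ ξ) = g (y + t • e)) :
    opE (gradient u y) (fun ξ => D2 (dq u e t) y ξ ξ)
      = t⁻¹ • (g (y + t • e) - g y)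
        - (inner ℝ (t⁻¹ • (gradient u (y + t • e) - gradient u y))
              (gradient u (y + t • e) + gradient u y)
            * ∑ k, D2 u (y + t • e) (EuclideanSpace.single k 1) (EuclideanSpace.single k 1)
          - D2 u (y + t • e) (t⁻¹ • (gradient u (y + t • e) - gradient u y))
              (gradient u (y + t • e) + gradient u y)) := by
  have h3 := opE_sub_opE (D2 u (y + t • e)) (D2_symm h2) (gradient u (y + t • e)) (gradient u y)
  rw [D2_dq h1 h2]
  simp only [smul_apply, sub_apply, smul_eq_mul]
  rw [opE_const_mul, opE_sub, e1, map_smul, inner_smul_left, smul_apply, ← e2]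
  simp only [smul_eq_mul, conj_trivial]
  linear_combination (-t⁻¹) * h3

/-- First and second order conditions at a maximum of `α · D_e u`, where `u` is only `C²` and
solves a quasilinear equation with differentiable right-hand side. -/
lemma linearized_max {u : Euc N → ℝ} {z e : Euc N} {α g : Euc N → ℝ} {g' : Euc N →L[ℝ] ℝ}
    (hu : ContDiffAt ℝ 2 u z) (hα : ContDiffAt ℝ 2 α z)
    (heq : ∀ᶠ y in 𝓝 z, opE (gradient u y) (fun ξ => D2 u y ξ ξ) = g y)
    (hg : HasStrictFDerivAt g g' z)
    (hmax : IsLocalMax (fun y => α y * fderiv ℝ u y e) z) :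
    α z * (g' e - (inner ℝ (rep (D2 u z) e) (gradient u z + gradient u z)
            * ∑ k, D2 u z (EuclideanSpace.single k 1) (EuclideanSpace.single k 1)
          - D2 u z (rep (D2 u z) e) (gradient u z + gradient u z)))
      + 2 * opE (gradient u z) (fun ξ => fderiv ℝ α z ξ * D2 u z e ξ)
      + fderiv ℝ u z e * opE (gradient u z) (fun ξ => D2 α z ξ ξ) ≤ 0 := by
  obtain ⟨δ, hδ, hball⟩ : ∃ δ > 0, ∀ y ∈ Metric.closedBall z δ, ContDiffAt ℝ 2 u y ∧
      ContDiffAt ℝ 2 α y ∧ opE (gradient u y) (fun ξ => D2 u y ξ ξ) = g y ∧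
      α y * fderiv ℝ u y e ≤ α z * fderiv ℝ u z e := by
    have := (hu.eventually (by simp)).and ((hα.eventually (by simp)).and (heq.and hmax))
    obtain ⟨δ, hδ, h⟩ := Metric.nhds_basis_closedBall.eventually_iff.1 this
    exact ⟨δ, hδ, fun y hy => h hy⟩
  set r := δ / 2 with hr
  have hr0 : 0 < r := by positivity
  have hsub : Metric.closedBall z r ⊆ Metric.closedBall z δ :=
    Metric.closedBall_subset_closedBall (by linarith)
  -- step sizes
  set c := r / (‖e‖ + 1) with hc
  have hc0 : 0 < c := by positivity
  let t : ℕ → ℝ := fun n => c / (n + 1)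
  have ht0 : ∀ n, 0 < t n := fun n => by positivity
  have htend : Tendsto t atTop (𝓝 0) := by
    have := tendsto_one_div_add_atTop_nhds_zero_nat (𝕜 := ℝ) |>.const_mul c
    simpa [t, div_eq_mul_inv] using this
  have hte : ∀ n, ‖t n • e‖ ≤ r := by
    intro n
    rw [norm_smul, Real.norm_of_nonneg (ht0 n).le]
    have : t n ≤ c := div_le_self hc0.le (by linarith [n.cast_nonneg (α := ℝ)])
    calc t n * ‖e‖ ≤ c * (‖e‖ + 1) := by gcongr; linarith
      _ = r := by rw [hc]; field_simp
  have hshift : ∀ n, ∀ y ∈ Metric.closedBall z r, y + t n • e ∈ Metric.closedBall z δ := by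
    intro n y hy
    rw [mem_closedBall_iff_norm] at hy ⊢
    calc ‖y + t n • e - z‖ = ‖(y - z) + t n • e‖ := by congr 1; abel
      _ ≤ ‖y - z‖ + ‖t n • e‖ := norm_add_le _ _
      _ ≤ δ := by linarith [hte n]
  -- approximate maximizers
  let Φ : ℕ → Euc N → ℝ := fun n y => α y * dq u e (t n) y - (‖y - z‖ ^ 2) ^ 2
  have hex : ∀ n, ∃ y ∈ Metric.closedBall z r, ∀ x ∈ Metric.closedBall z r, Φ n x ≤ Φ n y := by
    intro n
    suffices hcont : ContinuousOn (Φ n) (Metric.closedBall z r) by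
      obtain ⟨y, hy, hmx⟩ :=
        (isCompact_closedBall z r).exists_isMaxOn ⟨z, by simp [hr0.le]⟩ hcont
      exact ⟨y, hy, fun x hx => hmx hx⟩
    intro y hy
    have h1 := (hball y (hsub hy)).1
    have h2 := (hball _ (hshift n y hy)).1
    have h3 := (hball y (hsub hy)).2.1
    exact (((h3.continuousAt).mul (contDiffAt_dq h1 h2).continuousAt).sub
      (by fun_prop)).continuousWithinAt
  choose y hy hymax using hex
  obtain ⟨a, ha, φ, hφ, hlim⟩ := (isCompact_closedBall z r).tendsto_subseq hy
  have htφ : Tendsto (fun n => t (φ n)) atTop (𝓝 0) := htend.comp hφ.tendsto_atTop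
  have hquot : ∀ b ∈ Metric.closedBall z r, ∀ x : ℕ → Euc N, Tendsto x atTop (𝓝 b) →
      Tendsto (fun n => dq u e (t (φ n)) (x n)) atTop (𝓝 (fderiv ℝ u b e)) := by
    intro b hb x hx
    exact tendsto_strict_quotient ((hball b (hsub hb)).1.hasStrictFDerivAt (by simp)) hx htφ
      (fun i => (ht0 _).ne') e
  have haz : a = z := by
    have l1 := (((hball a (hsub ha)).2.1.continuousAt.tendsto.comp hlim).mul
      (hquot a ha _ hlim)).sub
      ((((hlim.sub_const z).norm).pow 2).pow 2)
    have hz : z ∈ Metric.closedBall z r := by simp [hr0.le]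
    have l2 := (hquot z hz (fun _ => z) tendsto_const_nhds).const_mul (α z)
    have l3 := le_of_tendsto_of_tendsto' l2 l1 fun n => by
      simpa [Φ] using hymax (φ n) z hz
    have l4 := (hball a (hsub ha)).2.2.2
    have l5 : (‖a - z‖ ^ 2) ^ 2 ≤ 0 := by linarith
    have : ‖a - z‖ = 0 := by
      by_contra hne
      have : 0 < ‖a - z‖ := lt_of_le_of_ne (norm_nonneg _) (Ne.symm hne)
      have : 0 < (‖a - z‖ ^ 2) ^ 2 := by positivity
      linarith
    exact sub_eq_zero.1 (norm_eq_zero.1 this)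
  subst haz
  set x : ℕ → Euc N := fun n => y (φ n) with hx
  set s : ℕ → ℝ := fun n => t (φ n) with hs
  have hxlim : Tendsto x atTop (𝓝 a) := hlim
  have hs0 : ∀ n, s n ≠ 0 := fun n => (ht0 _).ne'
  have hxs : Tendsto (fun n => x n + s n • e) atTop (𝓝 a) := by
    have := hxlim.add (htφ.smul_const e)
    simpa using this
  -- second order condition along the sequence
  have hineq : ∀ᶠ n in atTop,
      α (x n) * opE (gradient u (x n)) (fun ξ => D2 (dq u e (s n)) (x n) ξ ξ)
      + 2 * opE (gradient u (x n)) (fun ξ => (ContinuousLinearMap.smulRight (fderiv ℝ α (x n))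
          ((s n)⁻¹ • (fderiv ℝ u (x n + s n • e) - fderiv ℝ u (x n)))) ξ ξ)
      + dq u e (s n) (x n) * opE (gradient u (x n)) (fun ξ => D2 α (x n) ξ ξ)
      - (8 * symE (gradient u (x n)) (x n - a) (x n - a) + 4 * ‖x n - a‖ ^ 2 *
          opE (gradient u (x n)) (fun ξ => ‖ξ‖ ^ 2)) ≤ 0 := by
    filter_upwards [hxlim.eventually (Metric.ball_mem_nhds a hr0)] with n hn
    have hn' := Metric.ball_subset_closedBall hn
    have c1 := (hball _ (hsub hn')).1
    have c2 := (hball _ (hshift (φ n) _ hn')).1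
    have c3 := (hball _ (hsub hn')).2.1
    have c4 : ContDiffAt ℝ 2 (dq u e (s n)) (x n) := contDiffAt_dq c1 c2
    have c5 : ContDiffAt ℝ 2 (fun y : Euc N => (‖y - a‖ ^ 2) ^ 2) (x n) :=
      ((contDiff_normsq a).pow 2).contDiffAt
    have hloc : IsLocalMax (Φ (φ n)) (x n) := by
      filter_upwards [Metric.isOpen_ball.mem_nhds hn] with w hw
      exact hymax (φ n) w (Metric.ball_subset_closedBall hw)
    have h2 : ∀ ξ, D2 (Φ (φ n)) (x n) ξ ξ ≤ 0 := hloc.D2_nonpos ((c3.mul c4).sub c5)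
    have h3 := opE_nonneg (-(D2 (Φ (φ n)) (x n))) (gradient u (x n)) fun ξ => by
      simpa using h2 ξ
    have h4 : ∀ ξ, (-(D2 (Φ (φ n)) (x n))) ξ ξ = (8 * (inner ℝ (x n - a) ξ * inner ℝ (x n - a) ξ)
        + 4 * ‖x n - a‖ ^ 2 * ‖ξ‖ ^ 2) - ((α (x n) * D2 (dq u e (s n)) (x n) ξ ξ
        + 2 * (ContinuousLinearMap.smulRight (fderiv ℝ α (x n))
          ((s n)⁻¹ • (fderiv ℝ u (x n + s n • e) - fderiv ℝ u (x n)))) ξ ξ)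
        + dq u e (s n) (x n) * D2 α (x n) ξ ξ) := by
      intro ξ
      have : D2 (Φ (φ n)) (x n) = D2 (fun y => α y * dq u e (s n) y) (x n)
          - D2 (fun y => (‖y - a‖ ^ 2) ^ 2) (x n) := D2_sub (c3.mul c4) c5
      rw [this, neg_apply, neg_apply, sub_apply, sub_apply, D2_norm_four, D2_mul_self c3 c4,
        ← fderiv_dq c1 c2]
      simp only [ContinuousLinearMap.smulRight_apply, smul_apply, smul_eq_mul]
      ring
    simp only [h4] at h3
    rw [opE_sub, opE_add, opE_add, opE_add, opE_const_mul, opE_const_mul, opE_const_mul,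
      opE_const_mul, opE_const_mul, opE_inner_mul] at h3
    linarith
  -- passage to the limit
  have gC : Tendsto (fun n => gradient u (x n)) atTop (𝓝 (gradient u a)) := by
    have h1 := (hasFDerivAt_fderiv hu).continuousAt.tendsto.comp hxlim
    have h2 := ((InnerProductSpace.toDual ℝ (Euc N)).symm.continuous.tendsto _).comp h1
    exact h2
  have gC' : Tendsto (fun n => gradient u (x n + s n • e)) atTop (𝓝 (gradient u a)) := by
    have h1 := (hasFDerivAt_fderiv hu).continuousAt.tendsto.comp hxs
    have h2 := ((InnerProductSpace.toDual ℝ (Euc N)).symm.continuous.tendsto _).comp h1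
    exact h2
  have dC : Tendsto (fun n => (s n)⁻¹ • (fderiv ℝ u (x n + s n • e) - fderiv ℝ u (x n))) atTop
      (𝓝 (D2 u a e)) :=
    tendsto_strict_quotient (hasStrictFDerivAt_fderiv hu) hxlim htφ hs0 e
  have kC := tendsto_gradient_quotient dC
  have BC : Tendsto (fun n => D2 u (x n + s n • e)) atTop (𝓝 (D2 u a)) :=
    (continuousAt_D2 hu).tendsto.comp hxs
  have qC : Tendsto (fun n => (s n)⁻¹ • (g (x n + s n • e) - g (x n))) atTop (𝓝 (g' e)) :=
    tendsto_strict_quotient hg hxlim htφ hs0 e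
  have happ : ∀ (v w : ℕ → Euc N) (v₀ w₀ : Euc N), Tendsto v atTop (𝓝 v₀) →
      Tendsto w atTop (𝓝 w₀) → Tendsto (fun n => D2 u (x n + s n • e) (v n) (w n)) atTop
        (𝓝 (D2 u a v₀ w₀)) := by
    intro v w v₀ w₀ hv hw
    have hc : Continuous fun w : (Euc N →L[ℝ] Euc N →L[ℝ] ℝ) × Euc N × Euc N =>
        w.1 w.2.1 w.2.2 :=
      (continuous_fst.clm_apply continuous_snd.fst).clm_apply continuous_snd.snd
    have h1 := (hc.tendsto (D2 u a, v₀, w₀)).comp (BC.prodMk_nhds (hv.prodMk_nhds hw))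
    exact h1
  have t1 : Tendsto (fun n => opE (gradient u (x n)) (fun ξ => D2 (dq u e (s n)) (x n) ξ ξ)) atTop
      (𝓝 (g' e - (inner ℝ (rep (D2 u a) e) (gradient u a + gradient u a)
            * ∑ k, D2 u a (EuclideanSpace.single k 1) (EuclideanSpace.single k 1)
          - D2 u a (rep (D2 u a) e) (gradient u a + gradient u a)))) := by
    have h1 := qC.sub (((kC.inner (gC'.add gC)).mul (tendsto_finsetSum Finset.univ fun k _ =>
      happ _ _ _ _ (tendsto_const_nhds (x := EuclideanSpace.single k (1:ℝ)))
        (tendsto_const_nhds (x := EuclideanSpace.single k (1:ℝ))))).sub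
      (happ _ _ _ _ kC (gC'.add gC)))
    refine h1.congr fun n => ?_
    exact (opE_dq (hball _ (hsub (hy (φ n)))).1 (hball _ (hshift (φ n) _ (hy (φ n)))).1
      (hball _ (hsub (hy (φ n)))).2.2.1 (hball _ (hshift (φ n) _ (hy (φ n)))).2.2.1).symm
  have αC : Tendsto (fun n => α (x n)) atTop (𝓝 (α a)) := hα.continuousAt.tendsto.comp hxlim
  have dαC : Tendsto (fun n => fderiv ℝ α (x n)) atTop (𝓝 (fderiv ℝ α a)) :=
    (hasFDerivAt_fderiv hα).continuousAt.tendsto.comp hxlim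
  have t2 : Tendsto (fun n => opE (gradient u (x n)) (fun ξ =>
      (ContinuousLinearMap.smulRight (fderiv ℝ α (x n))
        ((s n)⁻¹ • (fderiv ℝ u (x n + s n • e) - fderiv ℝ u (x n)))) ξ ξ)) atTop
      (𝓝 (opE (gradient u a) (fun ξ => fderiv ℝ α a ξ * D2 u a e ξ))) := by
    have h1 : Tendsto (fun n => ContinuousLinearMap.smulRight (fderiv ℝ α (x n))
        ((s n)⁻¹ • (fderiv ℝ u (x n + s n • e) - fderiv ℝ u (x n)))) atTop
        (𝓝 (ContinuousLinearMap.smulRight (fderiv ℝ α a) (D2 u a e))) := by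
      have hcont : Continuous fun w : (Euc N →L[ℝ] ℝ) × (Euc N →L[ℝ] ℝ) =>
          ContinuousLinearMap.smulRight w.1 w.2 := by
        exact (ContinuousLinearMap.smulRightL ℝ (Euc N) (Euc N →L[ℝ] ℝ)).continuous₂
      have h3 := (hcont.tendsto (fderiv ℝ α a, D2 u a e)).comp (dαC.prodMk_nhds dC)
      exact h3
    have h2 := tendsto_opE gC h1
    exact h2
  have t3 : Tendsto (fun n => opE (gradient u (x n)) (fun ξ => D2 α (x n) ξ ξ)) atTop
      (𝓝 (opE (gradient u a) (fun ξ => D2 α a ξ ξ))) := by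
    have h2 := tendsto_opE gC ((continuousAt_D2 hα).tendsto.comp hxlim)
    exact h2
  have xC : Tendsto (fun n => x n - a) atTop (𝓝 0) := by simpa using hxlim.sub_const a
  have t4 : Tendsto (fun n => 8 * symE (gradient u (x n)) (x n - a) (x n - a) + 4 * ‖x n - a‖ ^ 2 *
          opE (gradient u (x n)) (fun ξ => ‖ξ‖ ^ 2)) atTop (𝓝 0) := by
    have h1 : Tendsto (fun n => symE (gradient u (x n)) (x n - a) (x n - a)) atTop
        (𝓝 (symE (gradient u a) 0 0)) :=
      (((gC.norm.pow 2).const_add 1).mul (xC.inner xC)).sub ((gC.inner xC).mul (gC.inner xC))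
    have h2 : Tendsto (fun n => opE (gradient u (x n)) (fun ξ => ‖ξ‖ ^ 2)) atTop
        (𝓝 (N * (1 + ‖gradient u a‖ ^ 2) - ‖gradient u a‖ ^ 2)) := by
      simp only [opE_norm_sq]
      exact (((gC.norm.pow 2).const_add 1).const_mul _).sub (gC.norm.pow 2)
    have h3 := (h1.const_mul 8).add ((((xC.norm).pow 2).const_mul 4).mul h2)
    simpa [symE] using h3
  have hfin := le_of_tendsto ((((αC.mul t1).add (t2.const_mul 2)).add
    ((hquot a ha x hxlim).mul t3)).sub t4) hineq
  linarith

end maximum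

section korevaar

variable {N : ℕ}

/-- `u` solves `opE (∇u) (D²u) = (1 + |∇u|²) κ / u` at `z`. -/
def SolE (κ : ℝ) (u : Euc N → ℝ) (z : Euc N) : Prop :=
  opE (gradient u z) (fun ξ => D2 u z ξ ξ) = (1 + ‖gradient u z‖ ^ 2) * (κ / u z)

/-- The Riesz representation as a linear map. -/
def rieszVec : (Euc N →L[ℝ] ℝ) →L[ℝ] Euc N :=
  LinearMap.mkContinuous
    { toFun := fun f => (InnerProductSpace.toDual ℝ (Euc N)).symm f
      map_add' := fun f g => by simp
      map_smul' := fun c f => by simp } 1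
    fun f => by simp

lemma hasStrictFDerivAt_gradient {u : Euc N → ℝ} {z : Euc N} (hu : ContDiffAt ℝ 2 u z) :
    HasStrictFDerivAt (gradient u) (rieszVec.comp (D2 u z)) z :=
  ((rieszVec (N := N)).hasStrictFDerivAt (x := fderiv ℝ u z)).comp z
    (hasStrictFDerivAt_fderiv hu)

lemma exists_hasStrictFDerivAt_rhs {u : Euc N → ℝ} {z : Euc N} (κ : ℝ) (hu : ContDiffAt ℝ 2 u z)
    (hpos : 0 < u z) :
    ∃ g' : Euc N →L[ℝ] ℝ,
      HasStrictFDerivAt (fun y => (1 + ‖gradient u y‖ ^ 2) * (κ / u y)) g' z ∧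
      ∀ e, g' e = 2 * inner ℝ (gradient u z) (rep (D2 u z) e) * (κ / u z)
        - (1 + ‖gradient u z‖ ^ 2) * (κ * fderiv ℝ u z e / u z ^ 2) := by
  have h1 := (((hasStrictFDerivAt_norm_sq (gradient u z)).comp z (hasStrictFDerivAt_gradient hu))).const_add 1
  have h2 := (hu.hasStrictFDerivAt (by simp))
  have h3 := (hasStrictDerivAt_inv hpos.ne').comp_hasStrictFDerivAt z h2 |>.const_mul κ
  refine ⟨_, h1.mul h3, fun e => ?_⟩
  have h4 : (rieszVec.comp (D2 u z)) e = rep (D2 u z) e := rfl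
  simp only [add_apply, smul_apply, smul_eq_mul, ContinuousLinearMap.comp_apply,
    innerSL_apply_apply] at h4 ⊢
  rw [h4]
  have := hpos.ne'
  simp only [nsmul_eq_mul]
  field_simp
  push_cast
  ring

lemma korevaar_step {u : Euc N → ℝ} {κ H r w : ℝ} {z z0 e : Euc N} {K : ℕ} (hK : 2 ≤ K)
    (hu : ContDiffAt ℝ 2 u z) (hpos : 0 < u z) (heq : ∀ᶠ y in 𝓝 z, SolE κ u y)
    (he : ‖e‖ = 1) (hw : 0 < w) (hp : gradient u z = w • e)
    (hζ : 0 < 1 - ‖z - z0‖ ^ 2 * (1 / r ^ 2) - u z * (1 / (2 * H)))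
    (hmax : IsLocalMax (fun y =>
      (1 - ‖y - z0‖ ^ 2 * (1 / r ^ 2) - u y * (1 / (2 * H))) ^ K * fderiv ℝ u y e) z) :
    ∃ ν : Euc N, ν = (-(2 / r ^ 2)) • (z - z0) - (1 / (2 * H)) • gradient u z ∧
    (1 - ‖z - z0‖ ^ 2 * (1 / r ^ 2) - u z * (1 / (2 * H))) ^ 2 * (-((1 + w ^ 2) * κ / u z ^ 2))
      + 2 * w ^ 2 * K ^ 2 * symE (gradient u z) ν ν / (1 + w ^ 2)
      - 2 * K ^ 2 * symE (gradient u z) ν ν + K * (K - 1) * symE (gradient u z) ν ν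
      - K * (1 - ‖z - z0‖ ^ 2 * (1 / r ^ 2) - u z * (1 / (2 * H)))
        * (2 / r ^ 2 * (N * (1 + w ^ 2) - w ^ 2) + (1 + w ^ 2) * κ / (2 * H * u z)) ≤ 0 := by
  set ζ : Euc N → ℝ := fun y => 1 - ‖y - z0‖ ^ 2 * (1 / r ^ 2) - u y * (1 / (2 * H)) with hζdef
  set ν : Euc N := (-(2 / r ^ 2)) • (z - z0) - (1 / (2 * H)) • gradient u z with hν
  refine ⟨ν, rfl, ?_⟩
  have hn : ContDiffAt ℝ 2 (fun y : Euc N => ‖y - z0‖ ^ 2) z := (contDiff_normsq z0).contDiffAt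
  have hn' : ContDiffAt ℝ 2 (fun y : Euc N => (1 / r ^ 2) * ‖y - z0‖ ^ 2) z :=
    contDiffAt_const.mul hn
  have hu' : ContDiffAt ℝ 2 (fun y : Euc N => (1 / (2 * H)) * u y) z := contDiffAt_const.mul hu
  have hζeq : ζ = fun y => (1 - (1 / r ^ 2) * ‖y - z0‖ ^ 2) - (1 / (2 * H)) * u y := by
    ext y; simp only [hζdef]; ring
  have hζeq' : ζ = (fun y => 1 - (1 / r ^ 2) * ‖y - z0‖ ^ 2) - (fun y => (1 / (2 * H)) * u y) :=
    hζeq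
  have hζC : ContDiffAt ℝ 2 ζ z := by
    rw [hζeq]; exact (contDiffAt_const.sub hn').sub hu'
  have hdζ : ∀ ξ, fderiv ℝ ζ z ξ = inner ℝ ν ξ := by
    intro ξ
    have h1 := ((((hasFDerivAt_normsq z0 z).const_mul (1 / r ^ 2)).const_sub 1).sub
      (((hu.differentiableAt (by simp)).hasFDerivAt).const_mul (1 / (2 * H)))).fderiv
    rw [← hζeq'] at h1
    rw [h1, hν, inner_sub_left, inner_smul_left, inner_smul_left, inner_gradient]
    simp only [sub_apply, neg_apply, smul_apply, smul_eq_mul, innerSL_apply_apply, conj_trivial]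
    ring
  have hD2ζ : ∀ ξ, D2 ζ z ξ ξ = -(2 / r ^ 2) * ‖ξ‖ ^ 2 - (1 / (2 * H)) * D2 u z ξ ξ := by
    intro ξ
    have h0 : D2 (fun _ : Euc N => (1:ℝ)) z = 0 := by
      apply D2_eq_of_hasFDerivAt (f' := fun _ => 0)
      · exact Eventually.of_forall fun y => hasFDerivAt_const 1 y
      · exact hasFDerivAt_const _ _
    rw [hζeq, D2_sub (contDiffAt_const.sub hn') hu', D2_sub contDiffAt_const hn',
      D2_const_mul _ hn, D2_const_mul _ hu, h0]
    simp only [sub_apply, smul_apply, smul_eq_mul, zero_apply, D2_normsq]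
    ring
  set α : Euc N → ℝ := fun y => ζ y ^ K with hα
  have hαC : ContDiffAt ℝ 2 α z := hζC.pow K
  have hdα : ∀ ξ, fderiv ℝ α z ξ = K * ζ z ^ (K - 1) * inner ℝ ν ξ := by
    intro ξ
    have h1 := ((hζC.differentiableAt (by simp)).hasFDerivAt.pow K).fderiv
    rw [show fderiv ℝ α z = fderiv ℝ (fun x => ζ x ^ K) z from rfl, h1]
    simp only [smul_apply, smul_eq_mul, nsmul_eq_mul, hdζ]
  have hD2α : ∀ ξ, D2 α z ξ ξ = (K * (K - 1) * ζ z ^ (K - 2)) * (inner ℝ ν ξ * inner ℝ ν ξ)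
      + (K * ζ z ^ (K - 1)) * D2 ζ z ξ ξ := by
    intro ξ
    have h1 := D2_comp_self (g := fun t => t ^ K) (g' := fun t => K * t ^ (K - 1))
      (g'' := K * (((K - 1 : ℕ) : ℝ) * ζ z ^ (K - 1 - 1))) hζC
      (Eventually.of_forall fun t => hasDerivAt_pow K t)
      ((hasDerivAt_pow (K - 1) (ζ z)).const_mul (K:ℝ)) ξ
    rw [show D2 α z ξ ξ = D2 (fun y => (fun t => t ^ K) (ζ y)) z ξ ξ from rfl, h1, hdζ, Nat.cast_sub (by omega : 1 ≤ K), show K - 1 - 1 = K - 2 by omega]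
    push_cast; ring
  have hwe : fderiv ℝ u z e = w := by
    rw [← inner_gradient, hp, inner_smul_left, real_inner_self_eq_norm_sq, he]; simp
  have hnp : ‖gradient u z‖ ^ 2 = w ^ 2 := by
    rw [hp, norm_smul, he, mul_one, Real.norm_of_nonneg hw.le]
  set B := D2 u z with hB
  set s := ζ z with hs
  have hs0 : 0 < s := hζ
  -- first order condition
  have hfirst : ∀ ξ, B e ξ = -(w * K / s) * inner ℝ ν ξ := by
    intro ξ
    have h1 : HasFDerivAt (fun y => fderiv ℝ u y e)
        ((ContinuousLinearMap.apply ℝ ℝ e).comp B) z :=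
      (ContinuousLinearMap.apply ℝ ℝ e).hasFDerivAt.comp z (hasFDerivAt_fderiv hu)
    have h2 := (hαC.differentiableAt (by simp)).hasFDerivAt.mul h1
    have h3 := congrArg (fun L : Euc N →L[ℝ] ℝ => L ξ) (hmax.hasFDerivAt_eq_zero h2)
    have h4 : α z * B ξ e + fderiv ℝ u z e * fderiv ℝ α z ξ = 0 := by simpa using h3
    rw [hwe, hdα, D2_symm hu ξ e] at h4
    have h5 : α z = s * s ^ (K - 1) := by
      rw [← pow_succ', show K - 1 + 1 = K by omega]
    rw [h5] at h4
    have h6 : s ^ (K - 1) ≠ 0 := (pow_pos hs0 _).ne'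
    have h7 : s ^ (K - 1) * (s * B e ξ + w * K * inner ℝ ν ξ) = 0 := by linear_combination h4
    have h8 := (mul_eq_zero.1 h7).resolve_left h6
    field_simp
    linarith
  have hrep : rep B e = (-(w * K / s)) • ν := by
    refine ext_inner_right ℝ fun ξ => ?_
    rw [inner_rep, hfirst, inner_smul_left]; simp
  obtain ⟨g', hg, hg'⟩ := exists_hasStrictFDerivAt_rhs κ hu hpos
  have hkey := linearized_max hu hαC heq hg hmax
  set q := symE (gradient u z) ν ν with hq
  set b := inner ℝ ν e with hbdef
  have hqe : q = (1 + w ^ 2) * ‖ν‖ ^ 2 - w ^ 2 * b ^ 2 := by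
    rw [hq, symE, hnp, real_inner_self_eq_norm_sq, hp, inner_smul_left, real_inner_comm]
    simp only [conj_trivial, hbdef]
    ring
  have e1 : inner ℝ (gradient u z) (rep B e) = -(w * K / s) * w * b := by
    rw [hp, hrep, inner_smul_left, inner_smul_right, real_inner_comm]; simp [hbdef]; ring
  have e2 : inner ℝ (rep B e) (gradient u z + gradient u z) = 2 * (-(w * K / s) * w * b) := by
    rw [real_inner_comm, inner_add_left, e1]; ring
  have e3 : B (rep B e) (gradient u z + gradient u z) = 2 * w * (w * K / s) ^ 2 * ‖ν‖ ^ 2 := by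
    rw [hp, D2_symm hu, ← two_smul ℝ, map_smul, map_smul, smul_apply, smul_apply, hfirst, hrep,
      inner_smul_right, real_inner_self_eq_norm_sq]
    simp only [smul_eq_mul]; ring
  have e4 : (1 + w ^ 2) * ∑ k, B (EuclideanSpace.single k 1) (EuclideanSpace.single k 1)
      = w ^ 2 * (-(w * K / s) * b) + (1 + w ^ 2) * (κ / u z) := by
    have h1 := heq.self_of_nhds
    rw [SolE, opE, hnp] at h1
    have h2 : B (gradient u z) (gradient u z) = w ^ 2 * (-(w * K / s) * b) := by
      rw [hp, map_smul, map_smul, smul_apply, hfirst]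
      simp only [smul_eq_mul, hbdef]; ring
    rw [h2] at h1
    linarith
  have e5 : opE (gradient u z) (fun ξ => fderiv ℝ α z ξ * B e ξ)
      = -(w * K / s) * (K * s ^ (K - 1)) * q := by
    have : (fun ξ => fderiv ℝ α z ξ * B e ξ) = fun ξ => (-(w * K / s) * (K * s ^ (K - 1)))
        * (inner ℝ ν ξ * inner ℝ ν ξ) := by
      ext ξ; rw [hdα, hfirst]; ring
    rw [this, opE_const_mul, opE_inner_mul]
  have e6 : opE (gradient u z) (fun ξ => D2 α z ξ ξ)
      = (K * (K - 1) * s ^ (K - 2)) * q + (K * s ^ (K - 1)) *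
        (-(2 / r ^ 2) * (N * (1 + w ^ 2) - w ^ 2)
          - (1 / (2 * H)) * ((1 + w ^ 2) * (κ / u z))) := by
    have h1 := heq.self_of_nhds
    rw [SolE, hnp] at h1
    simp only [hD2α, hD2ζ]
    rw [opE_add, opE_const_mul, opE_inner_mul, opE_const_mul, opE_sub, opE_const_mul,
      opE_const_mul, h1, opE_norm_sq, hnp]
  rw [hg' e, e1, e2, e3, e5, e6, hwe, hnp] at hkey
  have hαz : α z = s ^ 2 * s ^ (K - 2) := by rw [← pow_add, show 2 + (K - 2) = K by omega]
  have hs1 : s ^ (K - 1) = s * s ^ (K - 2) := by rw [← pow_succ', show K - 2 + 1 = K - 1 by omega]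
  set T := ∑ k, B (EuclideanSpace.single k 1) (EuclideanSpace.single k 1) with hT
  have hTv : T = (w ^ 2 * (-(w * K / s) * b) + (1 + w ^ 2) * (κ / u z)) / (1 + w ^ 2) := by
    field_simp
    field_simp at e4
    linarith
  rw [hαz, hs1, hTv] at hkey
  have hfac : 0 < w * s ^ (K - 2) := by positivity
  have hV : (0:ℝ) < 1 + w ^ 2 := by positivity
  have hid : w * s ^ (K - 2) * (s ^ 2 * (-((1 + w ^ 2) * κ / u z ^ 2))
      + 2 * w ^ 2 * K ^ 2 * q / (1 + w ^ 2) - 2 * K ^ 2 * q + K * (K - 1) * q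
      - K * s * (2 / r ^ 2 * (N * (1 + w ^ 2) - w ^ 2) + (1 + w ^ 2) * κ / (2 * H * u z))) ≤ 0 := by
    refine le_of_eq_of_le ?_ hkey
    have hne := hpos.ne'
    have hne' := hs0.ne'
    have hV' := hV.ne'
    have hH : (1 + w ^ 2) * κ / (2 * H * u z) = 1 / (2 * H) * ((1 + w ^ 2) * (κ / u z)) := by
      rw [one_div, mul_inv_rev, div_eq_mul_inv, mul_inv, mul_inv]; ring
    rw [hH]
    generalize 1 / (2 * H) = hh
    generalize 2 / r ^ 2 = rr
    generalize s ^ (K - 2) = sk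
    rw [hqe]
    field_simp
    ring
  by_contra! hcon
  exact absurd hid (not_le.2 (mul_pos hfac hcon))

end korevaar

section gradient_bound

variable {N : ℕ}

lemma continuousAt_gradient {u : Euc N → ℝ} {z : Euc N} (hu : ContDiffAt ℝ 2 u z) :
    ContinuousAt (gradient u) z :=
  (hasStrictFDerivAt_gradient hu).continuousAt

lemma korevaar_contradiction {n0 H r C κ w s q t K : ℝ} (hH : 0 < H) (hr : 0 < r) (hC : 0 ≤ C)
    (hn0 : 0 ≤ n0) (hs : 0 < s) (hs1 : s ≤ 1) (hw : 2 ≤ w) (ht : 0 < t) (h1 : κ / t ≤ C)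
    (h2 : κ / t ^ 2 ≤ C) (hκ : 0 ≤ κ) (hq : (1 + w ^ 2) / (32 * H ^ 2) ≤ q)
    (hK : 2 + 64 * H ^ 2 * (C + (2 * n0 / r ^ 2 + C / (2 * H))) < K)
    (hmain : s ^ 2 * (-((1 + w ^ 2) * κ / t ^ 2)) + 2 * w ^ 2 * K ^ 2 * q / (1 + w ^ 2)
      - 2 * K ^ 2 * q + K * (K - 1) * q
      - K * s * (2 / r ^ 2 * (n0 * (1 + w ^ 2) - w ^ 2) + (1 + w ^ 2) * κ / (2 * H * t)) ≤ 0) :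
    False := by
  set V := 1 + w ^ 2 with hV
  have hV5 : 5 ≤ V := by nlinarith
  set A := 2 * n0 / r ^ 2 + C / (2 * H) with hA
  have hA0 : 0 ≤ A := by positivity
  have hCA : 0 ≤ 64 * H ^ 2 * (C + A) := by positivity
  have hK2 : 2 < K := by linarith
  have hq0 : 0 < q := lt_of_lt_of_le (by positivity) hq
  have b1 : s ^ 2 * (V * κ / t ^ 2) ≤ V * C := by
    have : V * κ / t ^ 2 = V * (κ / t ^ 2) := by ring
    rw [this]
    have h3 : V * (κ / t ^ 2) ≤ V * C := by gcongr
    have h4 : 0 ≤ V * (κ / t ^ 2) := by positivity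
    have h5 : s ^ 2 ≤ 1 := pow_le_one₀ hs.le hs1
    exact (mul_le_of_le_one_left h4 h5).trans h3
  have b2 : 2 / r ^ 2 * (n0 * V - w ^ 2) + V * κ / (2 * H * t) ≤ V * A := by
    have h3 : V * κ / (2 * H * t) = V * (κ / t / (2 * H)) := by field_simp
    have h4 : V * (κ / t / (2 * H)) ≤ V * (C / (2 * H)) := by gcongr
    have h5 : 2 / r ^ 2 * (n0 * V - w ^ 2) ≤ 2 / r ^ 2 * (n0 * V) := by gcongr; linarith [sq_nonneg w]
    have h6 : V * A = 2 / r ^ 2 * (n0 * V) + V * (C / (2 * H)) := by rw [hA]; ring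
    linarith
  have b3 : K * s * (2 / r ^ 2 * (n0 * V - w ^ 2) + V * κ / (2 * H * t)) ≤ K * (V * A) := by
    have h3 : K * s * (2 / r ^ 2 * (n0 * V - w ^ 2) + V * κ / (2 * H * t)) ≤ K * s * (V * A) := by
      gcongr
    have h4 : K * s * (V * A) ≤ K * 1 * (V * A) := by gcongr
    linarith
  have b4 : 3 / 2 * (K ^ 2 * q) ≤ 2 * w ^ 2 * K ^ 2 * q / V := by
    rw [le_div_iff₀ (by linarith)]
    have h3 : 0 < K ^ 2 * q := by positivity
    have h4 : 4 ≤ w ^ 2 := by nlinarith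
    have h5 := mul_le_mul_of_nonneg_left h4 h3.le
    rw [hV]
    linarith
  have b5 : q * (K ^ 2 / 2 - K) ≤ V * (C + K * A) := by
    have e1 : s ^ 2 * (-(V * κ / t ^ 2)) = -(s ^ 2 * (V * κ / t ^ 2)) := by ring
    rw [e1] at hmain
    linarith
  have b6 : V / (32 * H ^ 2) * (K ^ 2 / 2 - K) ≤ V * (C + K * A) :=
    (mul_le_mul_of_nonneg_right hq (by
      have := mul_pos (by linarith : 0 < K) (by linarith : 0 < K - 2); linarith)).trans b5
  have b7 : K ^ 2 / 2 - K ≤ 32 * H ^ 2 * (C + K * A) := by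
    have h3 : V / (32 * H ^ 2) * (K ^ 2 / 2 - K) = V * ((K ^ 2 / 2 - K) / (32 * H ^ 2)) := by ring
    rw [h3] at b6
    have h4 := le_of_mul_le_mul_left b6 (by linarith)
    rw [div_le_iff₀ (by positivity)] at h4
    linarith
  have b8 : 32 * H ^ 2 * (C + K * A) ≤ 32 * H ^ 2 * (K * (C + A)) := by
    have h3 : C ≤ K * C := le_mul_of_one_le_left hC (by linarith)
    have h4 : C + K * A ≤ K * (C + A) := by linarith
    gcongr
  have b9 := mul_lt_mul_of_pos_left hK (by linarith : 0 < K)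
  linarith

theorem gradient_bound (N : ℕ) {κ H r C : ℝ} (hκ : 0 ≤ κ) (hH : 0 < H) (hr : 0 < r)
    (hC : 0 ≤ C) :
    ∃ M : ℝ, 0 < M ∧ ∀ (u : Euc N → ℝ) (z0 : Euc N),
      (∀ z ∈ Metric.closedBall z0 r, ContDiffAt ℝ 2 u z) →
      (∀ z ∈ Metric.closedBall z0 r, 0 < u z) →
      (∀ z ∈ Metric.closedBall z0 r, SolE κ u z) →
      (∀ z ∈ Metric.closedBall z0 r, κ / u z ≤ C) →
      (∀ z ∈ Metric.closedBall z0 r, κ / u z ^ 2 ≤ C) →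
      u z0 ≤ H → ‖gradient u z0‖ ≤ M := by
  obtain ⟨K, hK⟩ := exists_nat_gt (2 + 64 * H ^ 2 * (C + (2 * N / r ^ 2 + C / (2 * H))))
  have hK2 : 2 ≤ K := by
    have : (2:ℝ) < K := lt_of_le_of_lt (le_add_of_nonneg_right (by positivity)) hK
    exact_mod_cast this.le
  refine ⟨2 ^ K * max 2 (8 * H / r), by positivity, fun u z0 hu hpos heq hC1 hC2 hH0 => ?_⟩
  set ζ : Euc N → ℝ := fun y => 1 - ‖y - z0‖ ^ 2 * (1 / r ^ 2) - u y * (1 / (2 * H)) with hζ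
  set f : Euc N → ℝ := fun y => max (ζ y) 0 ^ K * ‖gradient u y‖ with hf
  have hζc : ∀ z ∈ Metric.closedBall z0 r, ContinuousAt ζ z := by
    intro z hz
    have := (hu z hz).continuousAt
    fun_prop
  have hfc : ContinuousOn f (Metric.closedBall z0 r) := fun z hz => by
    have h1 := hζc z hz
    have h2 := continuousAt_gradient (hu z hz)
    have h3 : ContinuousAt f z := by fun_prop
    exact h3.continuousWithinAt
  have hz0 : z0 ∈ Metric.closedBall z0 r := Metric.mem_closedBall_self hr.le
  obtain ⟨z, hz, hzmax⟩ := (isCompact_closedBall z0 r).exists_isMaxOn ⟨z0, hz0⟩ hfc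
  have hζ0 : 1 / 2 ≤ ζ z0 := by
    have h1 : u z0 * (1 / (2 * H)) ≤ H * (1 / (2 * H)) := by gcongr
    have h2 : H * (1 / (2 * H)) = 1 / 2 := by field_simp
    simp only [hζ, sub_self, norm_zero]
    linarith
  have hf0 : (1 / 2) ^ K * ‖gradient u z0‖ ≤ f z0 := by
    simp only [hf]
    gcongr
    exact hζ0.trans (le_max_left _ _)
  have hf1 : f z0 ≤ f z := hzmax hz0
  by_cases hg0 : gradient u z0 = 0
  · rw [hg0, norm_zero]; positivity
  have hfpos : 0 < f z := by
    have : 0 < ‖gradient u z0‖ := norm_pos_iff.2 hg0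
    have : 0 < (1 / 2 : ℝ) ^ K * ‖gradient u z0‖ := by positivity
    linarith
  have hζz : 0 < ζ z := by
    by_contra! h
    have : f z = 0 := by
      simp only [hf, max_eq_right h]; rw [zero_pow (by omega), zero_mul]
    linarith
  have hζ1 : ζ z ≤ 1 := by
    have h1 : 0 ≤ u z * (1 / (2 * H)) := mul_nonneg (hpos z hz).le (by positivity)
    have h2 : 0 ≤ ‖z - z0‖ ^ 2 * (1 / r ^ 2) := by positivity
    simp only [hζ]; linarith
  have hfz : f z = ζ z ^ K * ‖gradient u z‖ := by simp only [hf, max_eq_left hζz.le]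
  have hw0 : 0 < ‖gradient u z‖ := by
    rw [hfz] at hfpos
    exact (pos_iff_pos_of_mul_pos hfpos).1 (by positivity)
  set w := ‖gradient u z‖ with hw
  by_contra! hcon
  have hwbig : max 2 (8 * H / r) ≤ w := by
    have h1 : f z ≤ w := by
      rw [hfz]
      exact mul_le_of_le_one_left hw0.le (pow_le_one₀ hζz.le hζ1)
    have h2 : max 2 (8 * H / r) < (1 / 2) ^ K * ‖gradient u z0‖ := by
      rw [one_div, inv_pow, inv_mul_eq_div, lt_div_iff₀ (by positivity)]
      linarith
    linarith
  have hw2 : 2 ≤ w := (le_max_left _ _).trans hwbig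
  have hw8 : 8 * H / r ≤ w := (le_max_right _ _).trans hwbig
  have hzr : ‖z - z0‖ < r := by
    by_contra! h
    have h1 : 0 ≤ u z * (1 / (2 * H)) := mul_nonneg (hpos z hz).le (by positivity)
    have h2 : 1 ≤ ‖z - z0‖ ^ 2 * (1 / r ^ 2) := by
      rw [mul_one_div, le_div_iff₀ (by positivity), one_mul]; gcongr
    have : ζ z ≤ 0 := by simp only [hζ]; linarith
    linarith
  have hnb : Metric.closedBall z0 r ∈ 𝓝 z :=
    mem_of_superset (Metric.isOpen_ball.mem_nhds (by rwa [Metric.mem_ball, dist_eq_norm]))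
      Metric.ball_subset_closedBall
  have hp : gradient u z = w • (w⁻¹ • gradient u z) := by
    rw [smul_smul, mul_inv_cancel₀ hw0.ne', one_smul]
  set e := w⁻¹ • gradient u z with he
  have he1 : ‖e‖ = 1 := by
    rw [he, norm_smul, norm_inv, Real.norm_of_nonneg hw0.le, ← hw, inv_mul_cancel₀ hw0.ne']
  have hfe : fderiv ℝ u z e = w := by
    rw [← inner_gradient, he, inner_smul_right, real_inner_self_eq_norm_sq, ← hw]
    field_simp
  have hmax : IsLocalMax (fun y => ζ y ^ K * fderiv ℝ u y e) z := by
    filter_upwards [hnb, (hζc z hz).eventually (lt_mem_nhds hζz)] with y hy hy2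
    have h1 : f y ≤ f z := hzmax hy
    rw [hfz] at h1
    have h2 : f y = ζ y ^ K * ‖gradient u y‖ := by
      simp only [hf, max_eq_left (le_of_lt hy2)]
    have h3 : fderiv ℝ u y e ≤ ‖gradient u y‖ := by
      rw [← inner_gradient]
      exact (real_inner_le_norm _ _).trans (by rw [he1, mul_one])
    have h4 : ζ y ^ K * fderiv ℝ u y e ≤ ζ y ^ K * ‖gradient u y‖ :=
      mul_le_mul_of_nonneg_left h3 (pow_nonneg (le_of_lt hy2) _)
    show ζ y ^ K * fderiv ℝ u y e ≤ ζ z ^ K * fderiv ℝ u z e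
    rw [hfe]; linarith
  obtain ⟨ν, hν, hineq⟩ := korevaar_step (κ := κ) (H := H) (r := r) (z0 := z0) hK2 (hu z hz)
    (hpos z hz) (by filter_upwards [hnb] with y hy using heq y hy) he1 hw0 hp hζz hmax
  refine korevaar_contradiction hH hr hC (Nat.cast_nonneg N) hζz hζ1 hw2 (hpos z hz)
    (hC1 z hz) (hC2 z hz) hκ (?_ : _ ≤ symE (gradient u z) ν ν) hK hineq
  have hν1 : w / (4 * H) ≤ ‖ν‖ := by
    have h1 : (1 / (2 * H)) • gradient u z = (-(2 / r ^ 2)) • (z - z0) - ν := by rw [hν]; abel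
    have h2 := congrArg norm h1
    rw [norm_smul, Real.norm_of_nonneg (by positivity), ← hw] at h2
    have h3 := norm_sub_le ((-(2 / r ^ 2)) • (z - z0)) ν
    rw [norm_smul, norm_neg, Real.norm_of_nonneg (by positivity)] at h3
    have h4 : 2 / r ^ 2 * ‖z - z0‖ ≤ 2 / r ^ 2 * r := by gcongr
    have h5 : 2 / r ^ 2 * r = 2 / r := by field_simp
    have h6 : 2 / r ≤ w / (4 * H) := by
      rw [le_div_iff₀ (by positivity)]
      calc 2 / r * (4 * H) = 8 * H / r := by ring
        _ ≤ w := hw8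
    have h7 : 1 / (2 * H) * w = w / (4 * H) + w / (4 * H) := by field_simp; norm_num
    linarith
  refine le_trans ?_ (symE_self_ge _ _)
  calc (1 + w ^ 2) / (32 * H ^ 2) ≤ (w / (4 * H)) ^ 2 := by
        rw [div_pow, div_le_div_iff₀ (by positivity) (by positivity)]
        have h1 : 0 < H ^ 2 := by positivity
        have h2 : 1 ≤ w ^ 2 := one_le_pow₀ (by linarith)
        have h3 := mul_le_mul_of_nonneg_left h2 h1.le
        rw [mul_pow]
        linarith
    _ ≤ ‖ν‖ ^ 2 := by gcongr

end gradient_bound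

section two_point

lemma contDiffAt_comp_affine {E F : Type*} [NormedAddCommGroup E] [NormedSpace ℝ E]
    [NormedAddCommGroup F] [NormedSpace ℝ F] {f : E → ℝ} {z : E} (hf : ContDiffAt ℝ 2 f z)
    (L : F →L[ℝ] E) : ContDiffAt ℝ 2 (fun y => f (z + L y)) 0 := by
  have h2 : ContDiffAt ℝ 2 f (z + L 0) := by simpa using hf
  exact h2.comp (0 : F) (f := fun y => z + L y) (by fun_prop)

lemma D2_comp_affine {E F : Type*} [NormedAddCommGroup E] [NormedSpace ℝ E]
    [NormedAddCommGroup F] [NormedSpace ℝ F] {f : E → ℝ} {z : E} (hf : ContDiffAt ℝ 2 f z)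
    (L : F →L[ℝ] E) (η : F) :
    D2 (fun y => f (z + L y)) 0 η η = D2 f z (L η) (L η) := by
  have hc : Tendsto (fun y : F => z + L y) (𝓝 0) (𝓝 z) := by
    have : Continuous fun y : F => z + L y := by fun_prop
    simpa using this.tendsto 0
  have hl : ∀ y : F, HasFDerivAt (fun y : F => z + L y) L y := fun y =>
    L.hasFDerivAt.const_add z
  have h1 : ∀ᶠ y in 𝓝 (0 : F), HasFDerivAt (fun y => f (z + L y))
      ((fderiv ℝ f (z + L y)).comp L) y := by
    filter_upwards [hc.eventually (eventually_differentiableAt hf)] with y hy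
    exact hy.hasFDerivAt.comp y (hl y)
  have h2 : HasFDerivAt (fun y => (fderiv ℝ f (z + L y)).comp L)
      ((((ContinuousLinearMap.compL ℝ F E ℝ).flip L).comp (D2 f z)).comp L) 0 := by
    have h3 : HasFDerivAt (fderiv ℝ f) (D2 f z) (z + L 0) := by
      simpa using hasFDerivAt_fderiv hf
    exact ((ContinuousLinearMap.compL ℝ F E ℝ).flip L).hasFDerivAt.comp (0 : F)
      (h3.comp (0 : F) (hl 0))
  rw [D2_eq_of_hasFDerivAt h1 h2]
  rfl

variable {N : ℕ}

/-- The radial modulus `M (|y| - |y|² / (4R))`. -/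
def radMod (M R : ℝ) (y : Euc N) : ℝ := M * (√(‖y - 0‖ ^ 2) - ‖y - 0‖ ^ 2 / (4 * R))

lemma radMod_eq (M R : ℝ) (y : Euc N) : radMod M R y = M * (‖y‖ - ‖y‖ ^ 2 / (4 * R)) := by
  rw [radMod, sub_zero, Real.sqrt_sq (norm_nonneg y)]

lemma hasDerivAt_radMod_profile (M R : ℝ) {t : ℝ} (ht : 0 < t) :
    HasDerivAt (fun t => M * (√t - t / (4 * R))) (M * (1 / (2 * √t) - 1 / (4 * R))) t :=
  ((Real.hasDerivAt_sqrt ht.ne').sub ((hasDerivAt_id t).div_const (4 * R))).const_mul M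

lemma hasDerivAt_radMod_profile' (M R : ℝ) {t : ℝ} (ht : 0 < t) :
    HasDerivAt (fun t => M * (1 / (2 * √t) - 1 / (4 * R))) (M * (-(1 / (4 * t * √t)))) t := by
  have h1 := (((Real.hasDerivAt_sqrt ht.ne').const_mul 2).inv (by positivity)).sub_const
    (1 / (4 * R)) |>.const_mul M
  refine (h1.congr_deriv ?_).congr_of_eventuallyEq (Eventually.of_forall fun s => by simp)
  have h2 := Real.sq_sqrt ht.le
  have h3 : 0 < √t := Real.sqrt_pos.2 ht
  congr 1
  rw [mul_pow, h2]
  field_simp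
  norm_num

lemma contDiffAt_radMod (M R : ℝ) {x : Euc N} (hx : x ≠ 0) : ContDiffAt ℝ 2 (radMod M R) x := by
  have h1 : ContDiffAt ℝ 2 (fun y : Euc N => ‖y - 0‖ ^ 2) x := (contDiff_normsq 0).contDiffAt
  have h2 : ‖x - 0‖ ^ 2 ≠ 0 := by simpa using hx
  exact contDiffAt_const.mul ((h1.sqrt h2).sub (h1.div_const _))

lemma fderiv_radMod (M R : ℝ) {x : Euc N} (hx : x ≠ 0) (ξ : Euc N) :
    fderiv ℝ (radMod M R) x ξ = M * (1 / ‖x‖ - 1 / (2 * R)) * inner ℝ x ξ := by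
  have h2 : 0 < ‖x - 0‖ ^ 2 := by rw [sub_zero]; exact pow_pos (norm_pos_iff.2 hx) 2
  have h1 := ((hasDerivAt_radMod_profile M R h2).comp_hasFDerivAt x
    (hasFDerivAt_normsq 0 x)).fderiv
  have h3 : fderiv ℝ (radMod M R) x ξ
    = M * (1 / (2 * √(‖x - 0‖ ^ 2)) - 1 / (4 * R)) * (2 * inner ℝ (x - 0) ξ) :=
    congrArg (fun L : Euc N →L[ℝ] ℝ => L ξ) h1
  rw [h3, sub_zero, Real.sqrt_sq (norm_nonneg x)]
  ring

lemma D2_radMod (M R : ℝ) {x : Euc N} (hx : x ≠ 0) (ξ : Euc N) :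
    D2 (radMod M R) x ξ ξ
      = -(M * inner ℝ x ξ ^ 2 / ‖x‖ ^ 3) + M * (1 / ‖x‖ - 1 / (2 * R)) * ‖ξ‖ ^ 2 := by
  have h2 : 0 < ‖x - 0‖ ^ 2 := by rw [sub_zero]; exact pow_pos (norm_pos_iff.2 hx) 2
  have h1 := D2_comp_self (contDiff_normsq (0 : Euc N)).contDiffAt
    (by filter_upwards [lt_mem_nhds h2] with t ht using hasDerivAt_radMod_profile M R ht)
    (hasDerivAt_radMod_profile' M R h2) ξ
  have h3 : D2 (radMod M R) x ξ ξ = _ := h1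
  rw [h3, D2_normsq, fderiv_normsq, sub_zero, Real.sqrt_sq (norm_nonneg x)]
  have : 0 < ‖x‖ := norm_pos_iff.2 hx
  field_simp
  ring

/-- The doubled functional. -/
def twoPt (U : Euc N → ℝ) (M R k : ℝ) (z0 : Euc N) (x : Euc N × Euc N) : ℝ :=
  U x.1 - U x.2 - radMod M R (x.1 - x.2) - k * ‖x.1 - z0‖ ^ 2

lemma twoPt_fst {U : Euc N → ℝ} {M R k : ℝ} {z0 z z' : Euc N} (hU : ContDiffAt ℝ 2 U z)
    (hne : z - z' ≠ 0) (h : IsLocalMax (twoPt U M R k z0) (z, z')) :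
    gradient U z = (M * (1 / ‖z - z'‖ - 1 / (2 * R))) • (z - z') + (2 * k) • (z - z0) := by
  have h1 : IsLocalMax (fun y => U y - U z' - radMod M R (y - z') - k * ‖y - z0‖ ^ 2) z := by
    have hc : Tendsto (fun y => (y, z')) (𝓝 z) (𝓝 (z, z')) :=
      (Continuous.prodMk_left z').tendsto z
    exact hc.eventually h
  have hr : HasFDerivAt (fun y => radMod M R (y - z')) (fderiv ℝ (radMod M R) (z - z')) z := by
    have := ((contDiffAt_radMod M R hne).differentiableAt (by simp)).hasFDerivAt.comp z
      ((hasFDerivAt_id z).sub_const z')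
    exact this
  have h2 := (((((hU.differentiableAt (by simp)).hasFDerivAt).sub_const (U z')).sub hr).sub
    ((hasFDerivAt_normsq z0 z).const_mul k))
  have h3 := h1.hasFDerivAt_eq_zero h2
  refine ext_inner_right ℝ fun ξ => ?_
  have h4 := congrArg (fun L : Euc N →L[ℝ] ℝ => L ξ) h3
  simp only [sub_apply, smul_apply, smul_eq_mul, innerSL_apply_apply, zero_apply,
    fderiv_radMod M R hne] at h4
  rw [inner_gradient, inner_add_left, inner_smul_left, inner_smul_left]
  simp only [conj_trivial]
  linarith

lemma twoPt_snd {U : Euc N → ℝ} {M R k : ℝ} {z0 z z' : Euc N} (hU : ContDiffAt ℝ 2 U z')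
    (hne : z - z' ≠ 0) (h : IsLocalMax (twoPt U M R k z0) (z, z')) :
    gradient U z' = (M * (1 / ‖z - z'‖ - 1 / (2 * R))) • (z - z') := by
  have h1 : IsLocalMax (fun y => U z - U y - radMod M R (z - y) - k * ‖z - z0‖ ^ 2) z' := by
    have hc : Tendsto (fun y => (z, y)) (𝓝 z') (𝓝 (z, z')) :=
      (Continuous.prodMk_right z).tendsto z'
    exact hc.eventually h
  have hr : HasFDerivAt (fun y => radMod M R (z - y))
      ((fderiv ℝ (radMod M R) (z - z')).comp (-ContinuousLinearMap.id ℝ (Euc N))) z' :=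
    ((contDiffAt_radMod M R hne).differentiableAt (by simp)).hasFDerivAt.comp z'
      ((hasFDerivAt_id z').const_sub z)
  have h2 := ((((hU.differentiableAt (by simp)).hasFDerivAt).const_sub (U z)).sub hr).sub_const
    (k * ‖z - z0‖ ^ 2)
  have h3 := h1.hasFDerivAt_eq_zero h2
  refine ext_inner_right ℝ fun ξ => ?_
  have h4 := congrArg (fun L : Euc N →L[ℝ] ℝ => L ξ) h3
  simp only [sub_apply, neg_apply, ContinuousLinearMap.comp_apply, zero_apply,
    ContinuousLinearMap.id_apply, fderiv_radMod M R hne, inner_neg_right] at h4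
  rw [inner_gradient, inner_smul_left]
  simp only [conj_trivial]
  linarith

lemma twoPt_second {U : Euc N → ℝ} {M R k : ℝ} {z0 z z' : Euc N} (hU : ContDiffAt ℝ 2 U z)
    (hU' : ContDiffAt ℝ 2 U z') (hne : z - z' ≠ 0)
    (h : IsLocalMax (twoPt U M R k z0) (z, z')) (α β : Euc N) :
    D2 U z α α - D2 U z' β β ≤ -(M * inner ℝ (z - z') (α - β) ^ 2 / ‖z - z'‖ ^ 3)
      + M * (1 / ‖z - z'‖ - 1 / (2 * R)) * ‖α - β‖ ^ 2 + 2 * k * ‖α‖ ^ 2 := by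
  set P : ℝ →L[ℝ] Euc N := ContinuousLinearMap.toSpanSingleton ℝ α with hP
  set P' : ℝ →L[ℝ] Euc N := ContinuousLinearMap.toSpanSingleton ℝ β with hP'
  set D : ℝ →L[ℝ] Euc N := ContinuousLinearMap.toSpanSingleton ℝ (α - β) with hD
  have hDe : ∀ t, z + P t - (z' + P' t) = (z - z') + D t := by
    intro t
    simp only [hP, hP', hD, ContinuousLinearMap.toSpanSingleton_apply, smul_sub]; abel
  have h1 : IsLocalMax (fun t : ℝ => ((U (z + P t) - U (z' + P' t)) - radMod M R ((z - z') + D t))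
      - k * ‖(z + P t) - z0‖ ^ 2) 0 := by
    have hc : Tendsto (fun t : ℝ => (z + P t, z' + P' t)) (𝓝 0) (𝓝 (z, z')) := by
      have : Continuous fun t : ℝ => (z + P t, z' + P' t) := by fun_prop
      simpa using this.tendsto 0
    filter_upwards [hc.eventually h] with t ht
    rw [twoPt, hDe] at ht
    simpa [twoPt] using ht
  have hn : ContDiffAt ℝ 2 (fun y : Euc N => ‖y - z0‖ ^ 2) z := (contDiff_normsq z0).contDiffAt
  have hr := contDiffAt_radMod M R hne
  have c1 := contDiffAt_comp_affine hU P
  have c2 := contDiffAt_comp_affine hU' P'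
  have c3 := contDiffAt_comp_affine hr D
  have c4 := contDiffAt_comp_affine hn P
  have c5 : ContDiffAt ℝ 2 (fun t : ℝ => k * ‖(z + P t) - z0‖ ^ 2) 0 := contDiffAt_const.mul c4
  have h2 := h1.D2_nonpos (((c1.sub c2).sub c3).sub c5) 1
  rw [D2_sub ((c1.sub c2).sub c3) c5, D2_sub (c1.sub c2) c3, D2_sub c1 c2,
    D2_const_mul k c4] at h2
  simp only [sub_apply, smul_apply, smul_eq_mul] at h2
  rw [D2_comp_affine hU P, D2_comp_affine hU' P', D2_comp_affine hr D,
    D2_comp_affine hn P, D2_normsq, D2_radMod M R hne] at h2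
  simp only [hP, hP', hD, ContinuousLinearMap.toSpanSingleton_apply, one_smul] at h2
  linarith

lemma sum_inner_single_smul (e : Euc N) (he : ‖e‖ = 1) (B : Euc N →L[ℝ] Euc N →L[ℝ] ℝ)
    (hB : ∀ x y, B x y = B y x) :
    ∑ k, B (EuclideanSpace.single k 1 - (2 * e k) • e) (EuclideanSpace.single k 1 - (2 * e k) • e)
      = ∑ k, B (EuclideanSpace.single k 1) (EuclideanSpace.single k 1) := by
  have h1 : ∀ k, B (EuclideanSpace.single k 1 - (2 * e k) • e)
      (EuclideanSpace.single k 1 - (2 * e k) • e)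
      = B (EuclideanSpace.single k 1) (EuclideanSpace.single k 1)
        - 4 * (e k * B (EuclideanSpace.single k 1) e) + 4 * B e e * e k ^ 2 := by
    intro k
    simp only [map_sub, map_smul, sub_apply, smul_apply, smul_eq_mul]
    rw [hB e]; ring
  have h2 : ∑ k, e k * B (EuclideanSpace.single k 1) e = B e e := by
    have h3 : B e e = B (∑ k, e k • EuclideanSpace.single k (1:ℝ)) e :=
      congrArg (fun v => B v e) (eq_sum_single e)
    rw [h3]
    simp only [map_sum, sum_apply, map_smul, smul_apply, smul_eq_mul]
  have h3 : ∑ k, e k ^ 2 = 1 := by rw [← norm_sq_eq_sum, he]; norm_num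
  simp only [h1, Finset.sum_add_distrib, Finset.sum_sub_distrib, ← Finset.mul_sum, h2, h3]
  ring

lemma sum_norm_bivec (p : Euc N) : ∑ i, ∑ j, ‖bivec p i j‖ ^ 2 = 2 * ((N - 1) * ‖p‖ ^ 2) := by
  have h : ∑ i, ∑ j, inner ℝ (bivec p i j) (bivec p i j)
      = 2 * (‖p‖ ^ 2 * ∑ k : Fin N, inner ℝ (EuclideanSpace.single k (1:ℝ))
          (EuclideanSpace.single k (1:ℝ)) - inner ℝ p p) :=
    sum_bivec (innerSL ℝ : Euc N →L[ℝ] Euc N →L[ℝ] ℝ) p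
  simp only [real_inner_self_eq_norm_sq] at h
  rw [h]; simp; ring

lemma twoPt_opE {U : Euc N → ℝ} {M R k : ℝ} {z0 z z' : Euc N} (hM : 0 ≤ M) (hR : 0 < R)
    (hU : ContDiffAt ℝ 2 U z)
    (hU' : ContDiffAt ℝ 2 U z') (hne : z - z' ≠ 0)
    (h : IsLocalMax (twoPt U M R k z0) (z, z')) (p p' : Euc N) :
    opE p (fun ξ => D2 U z ξ ξ) - opE p' (fun ξ => D2 U z' ξ ξ)
      ≤ -(2 * M / R) + 2 * k * N + (N - 1) * (M / ‖z - z'‖) * ‖p - p'‖ ^ 2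
        + 2 * k * ((N - 1) * ‖p‖ ^ 2) := by
  have hs : 0 < ‖z - z'‖ := norm_pos_iff.2 hne
  set s := ‖z - z'‖ with hsdef
  set e := s⁻¹ • (z - z') with hedef
  have he : ‖e‖ = 1 := by
    rw [hedef, norm_smul, norm_inv, Real.norm_of_nonneg hs.le, ← hsdef, inv_mul_cancel₀ hs.ne']
  have hxe : z - z' = s • e := by rw [hedef, smul_smul, mul_inv_cancel₀ hs.ne', one_smul]
  rw [opE_eq_sum, opE_eq_sum, ← sum_inner_single_smul e he (D2 U z') (D2_symm hU')]
  have h3 : ∑ k, e k ^ 2 = 1 := by rw [← norm_sq_eq_sum, he]; norm_num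
  have a1 : ∑ i, D2 U z (EuclideanSpace.single i 1) (EuclideanSpace.single i 1)
      - ∑ i, D2 U z' (EuclideanSpace.single i 1 - (2 * e i) • e)
        (EuclideanSpace.single i 1 - (2 * e i) • e) ≤ -(2 * M / R) + 2 * k * N := by
    rw [← Finset.sum_sub_distrib]
    have h4 : ∀ i ∈ Finset.univ, D2 U z (EuclideanSpace.single i 1) (EuclideanSpace.single i 1)
        - D2 U z' (EuclideanSpace.single i 1 - (2 * e i) • e)
        (EuclideanSpace.single i 1 - (2 * e i) • e) ≤ -(2 * M / R) * e i ^ 2 + 2 * k := by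
      intro i _
      have h5 := twoPt_second hU hU' hne h (EuclideanSpace.single i 1)
        (EuclideanSpace.single i 1 - (2 * e i) • e)
      rw [sub_sub_cancel, ← hsdef, hxe, inner_smul_left, inner_smul_right,
        real_inner_self_eq_norm_sq, he, norm_smul, he] at h5
      simp only [conj_trivial, PiLp.norm_single, Real.norm_eq_abs, one_pow, mul_one,
        sq_abs, abs_one] at h5
      refine h5.trans_eq ?_
      field_simp
      ring
    refine (Finset.sum_le_sum h4).trans_eq ?_
    rw [Finset.sum_add_distrib, ← Finset.mul_sum, h3]
    simp; ring
  have a2 : (1 / 2) * ∑ i, ∑ j, D2 U z (bivec p i j) (bivec p i j)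
      - (1 / 2) * ∑ i, ∑ j, D2 U z' (bivec p' i j) (bivec p' i j)
      ≤ (N - 1) * (M / s) * ‖p - p'‖ ^ 2 + 2 * k * ((N - 1) * ‖p‖ ^ 2) := by
    have h4 : ∀ i j, D2 U z (bivec p i j) (bivec p i j) - D2 U z' (bivec p' i j) (bivec p' i j)
        ≤ (M / s) * ‖bivec (p - p') i j‖ ^ 2 + 2 * k * ‖bivec p i j‖ ^ 2 := by
      intro i j
      refine (twoPt_second hU hU' hne h _ _).trans ?_
      rw [← bivec_sub, ← hsdef]
      have h5 : 0 ≤ M * inner ℝ (z - z') (bivec (p - p') i j) ^ 2 / s ^ 3 := by positivity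
      have h6 : 0 ≤ M * (1 / (2 * R)) * ‖bivec (p - p') i j‖ ^ 2 := by positivity
      have h7 : M * (1 / s - 1 / (2 * R)) * ‖bivec (p - p') i j‖ ^ 2
        = (M / s) * ‖bivec (p - p') i j‖ ^ 2 - M * (1 / (2 * R)) * ‖bivec (p - p') i j‖ ^ 2 := by
        ring
      linarith
    have h5 := Finset.sum_le_sum fun i (_ : i ∈ Finset.univ) =>
      Finset.sum_le_sum fun j (_ : j ∈ Finset.univ) => h4 i j
    simp only [Finset.sum_sub_distrib, Finset.sum_add_distrib, ← Finset.mul_sum,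
      sum_norm_bivec] at h5
    linarith
  linarith

end two_point

section two_point_bound

variable {N : ℕ}

lemma eventually_lt_of_fderiv {U : Euc N → ℝ} {z0 e : Euc N} {M : ℝ}
    (hU : DifferentiableAt ℝ U z0) (hM : M < fderiv ℝ U z0 e) :
    ∀ᶠ t in 𝓝[>] (0:ℝ), U (z0 - t • e) + M * t < U z0 := by
  have hd : HasDerivAt (fun t : ℝ => U (z0 - t • e) + M * t) (-fderiv ℝ U z0 e + M) 0 := by
    have h1 : HasDerivAt (fun t : ℝ => z0 - t • e) (-e) 0 := by
      have := ((hasDerivAt_id (0:ℝ)).smul_const e).const_sub z0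
      rwa [one_smul] at this
    have h2 : HasFDerivAt U (fderiv ℝ U z0) (z0 - (0:ℝ) • e) := by
      simpa using hU.hasFDerivAt
    have h3 := h2.comp_hasDerivAt (0:ℝ) h1
    rw [map_neg] at h3
    have h4 : HasDerivAt (fun t : ℝ => M * t) M 0 := by
      simpa using (hasDerivAt_id (0:ℝ)).const_mul M
    exact h3.add h4
  have h1 := hd.hasDerivWithinAt (s := Ioi 0)
  have h2 := (hasDerivWithinAt_iff_tendsto_slope' (self_notMem_Ioi)).1 h1
  filter_upwards [h2.eventually (gt_mem_nhds (show -fderiv ℝ U z0 e + M < 0 by linarith)),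
    self_mem_nhdsWithin] with t ht ht0
  rw [slope_def_field, div_lt_iff₀ (by simpa using ht0)] at ht
  simp at ht
  linarith

theorem two_point_bound (hN : 1 ≤ N) {U : Euc N → ℝ} {p : Euc N → Euc N} {z0 : Euc N}
    {R ε Q F0 σ : ℝ} (hR : 0 < R)
    (hU : ∀ z ∈ Metric.closedBall z0 (2 * R), ContDiffAt ℝ 2 U z)
    (hUε : ∀ z ∈ Metric.closedBall z0 (2 * R), |U z| ≤ ε)
    (hQ : ∀ z ∈ Metric.closedBall z0 (2 * R), 1 + ‖p z‖ ^ 2 ≤ Q)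
    (hF : ∀ z ∈ Metric.closedBall z0 (2 * R), |opE (p z) (fun ξ => D2 U z ξ ξ)| ≤ F0)
    (hσ : N * σ * R ≤ 1)
    (hpp : ∀ z ∈ Metric.closedBall z0 R, ∀ z', ‖z - z'‖ ≤ R → z - z' ≠ 0 →
      gradient U z - gradient U z' = (4 * ε / R ^ 2) • (z - z0) →
      2 * ε / R ^ 2 * ‖z - z0‖ ^ 2 ≤ U z - U z' → ‖p z - p z'‖ ^ 2 ≤ σ * ‖z - z'‖) :
    ‖gradient U z0‖ ≤ 2 * F0 * R + 4 * N * Q * ε / R := by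
  have hN' : (1:ℝ) ≤ N := by exact_mod_cast hN
  have hz0 : z0 ∈ Metric.closedBall z0 (2 * R) := Metric.mem_closedBall_self (by linarith)
  have hε : 0 ≤ ε := (abs_nonneg _).trans (hUε z0 hz0)
  have hF0 : 0 ≤ F0 := (abs_nonneg _).trans (hF z0 hz0)
  have hQ1 : 1 ≤ Q := le_trans (le_add_of_nonneg_right (by positivity)) (hQ z0 hz0)
  by_contra! hcon
  obtain ⟨M, hM1, hM2⟩ := exists_between hcon
  have hM0 : 0 < M := lt_of_le_of_lt (by positivity) hM1
  set k := 2 * ε / R ^ 2 with hk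
  have hk0 : 0 ≤ k := by positivity
  set K : Set (Euc N × Euc N) := {x | ‖x.1 - z0‖ ≤ R ∧ ‖x.1 - x.2‖ ≤ R} with hKdef
  have hKball : ∀ x ∈ K, x.1 ∈ Metric.closedBall z0 R ∧ x.1 ∈ Metric.closedBall z0 (2 * R)
      ∧ x.2 ∈ Metric.closedBall z0 (2 * R) := by
    rintro x ⟨h1, h2⟩
    simp only [Metric.mem_closedBall, dist_eq_norm]
    refine ⟨h1, by linarith, ?_⟩
    have h3 : x.2 - z0 = (x.1 - z0) - (x.1 - x.2) := by abel
    rw [h3]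
    exact (norm_sub_le _ _).trans (by linarith)
  have hKc : IsCompact K := by
    refine ((isCompact_closedBall z0 (2 * R)).prod
      (isCompact_closedBall z0 (2 * R))).of_isClosed_subset ?_
      fun x hx => ⟨(hKball x hx).2.1, (hKball x hx).2.2⟩
    exact (isClosed_le (show Continuous fun x : Euc N × Euc N => ‖x.1 - z0‖ by fun_prop)
      continuous_const).inter
      (isClosed_le (show Continuous fun x : Euc N × Euc N => ‖x.1 - x.2‖ by fun_prop)
        continuous_const)
  have hΦc : ContinuousOn (twoPt U M R k z0) K := by
    intro x hx
    have h1 : ContinuousAt (fun y : Euc N × Euc N => U y.1) x :=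
      ContinuousAt.comp (f := Prod.fst) (hU x.1 (hKball x hx).2.1).continuousAt continuousAt_fst
    have h2 : ContinuousAt (fun y : Euc N × Euc N => U y.2) x :=
      ContinuousAt.comp (f := Prod.snd) (hU x.2 (hKball x hx).2.2).continuousAt continuousAt_snd
    have h3 : ContinuousAt (fun y : Euc N × Euc N => radMod M R (y.1 - y.2)) x := by
      simp only [radMod]; fun_prop
    have h5 : ContinuousAt (fun y : Euc N × Euc N => k * ‖y.1 - z0‖ ^ 2) x := by fun_prop
    have h4 : ContinuousAt (twoPt U M R k z0) x := ((h1.sub h2).sub h3).sub h5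
    exact h4.continuousWithinAt
  have hz0K : (z0, z0) ∈ K := by simp [hKdef, hR.le]
  obtain ⟨x, hxK, hxmax⟩ := hKc.exists_isMaxOn ⟨_, hz0K⟩ hΦc
  obtain ⟨z, z'⟩ := x
  -- the maximum is positive
  have hpos : 0 < twoPt U M R k z0 (z, z') := by
    have hg0 : 0 < ‖gradient U z0‖ := hM0.trans hM2
    set e := (‖gradient U z0‖)⁻¹ • gradient U z0 with he
    have he1 : ‖e‖ = 1 := by
      rw [he, norm_smul, norm_inv, norm_norm, inv_mul_cancel₀ hg0.ne']
    have hfe : fderiv ℝ U z0 e = ‖gradient U z0‖ := by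
      rw [← inner_gradient, he, inner_smul_right, real_inner_self_eq_norm_sq]
      field_simp
    have hlt := eventually_lt_of_fderiv ((hU z0 hz0).differentiableAt (by simp))
      (hM2.trans_eq hfe.symm)
    obtain ⟨t, ht, ht0, htR⟩ := (hlt.and (Ioo_mem_nhdsGT hR)).exists
    have hmem : (z0, z0 - t • e) ∈ K := by
      simp only [hKdef, mem_ofPred_eq, sub_self, norm_zero, sub_sub_cancel, norm_smul, he1,
        Real.norm_of_nonneg ht0.le, mul_one]
      exact ⟨hR.le, htR.le⟩
    refine lt_of_lt_of_le ?_ (hxmax hmem)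
    simp only [twoPt, radMod_eq, sub_self, norm_zero, sub_sub_cancel, norm_smul, he1,
      Real.norm_of_nonneg ht0.le, mul_one]
    have : 0 ≤ M * (t ^ 2 / (4 * R)) := by positivity
    linarith
  have hzb := hKball _ hxK
  have hUz := abs_le.1 (hUε z hzb.2.1)
  have hUz' := abs_le.1 (hUε z' hzb.2.2)
  obtain ⟨hzR, hzz'⟩ := hxK
  simp only at hzR hzz' hzb
  set s := ‖z - z'‖ with hs
  have hs0' : 0 ≤ s := norm_nonneg _
  have hval : twoPt U M R k z0 (z, z')
      = U z - U z' - M * (s - s ^ 2 / (4 * R)) - k * ‖z - z0‖ ^ 2 := by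
    simp only [twoPt, radMod_eq, ← hs]
  rw [hval] at hpos
  have hφ : 0 ≤ M * (s - s ^ 2 / (4 * R)) := by
    refine mul_nonneg hM0.le ?_
    have : s ^ 2 / (4 * R) ≤ s := by 
      rw [div_le_iff₀ (by positivity)]; nlinarith
    linarith
  have hpen : 0 ≤ k * ‖z - z0‖ ^ 2 := by positivity
  have hne : z - z' ≠ 0 := by
    intro h0
    rw [sub_eq_zero] at h0
    subst h0
    linarith
  have hs0 : 0 < s := norm_pos_iff.2 hne
  have hεM : 4 * ε ≤ M * R := by
    have h1 : 4 * ε / R ≤ 4 * N * Q * ε / R := by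
      have h2 : 1 ≤ N * Q := one_le_mul_of_one_le_of_one_le hN' hQ1
      have h3 : 4 * ε ≤ 4 * N * Q * ε := by
        have := mul_le_mul_of_nonneg_right h2 hε
        linarith
      exact div_le_div_of_nonneg_right h3 hR.le
    have h2 : 4 * ε / R ≤ M := by
      have : 0 ≤ 2 * F0 * R := by positivity
      linarith
    rwa [div_le_iff₀ hR] at h2
  have hzR' : ‖z - z0‖ < R := by
    refine lt_of_le_of_ne hzR fun h0 => ?_
    have h1 : k * ‖z - z0‖ ^ 2 = 2 * ε := by rw [h0, hk]; field_simp
    linarith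
  have hsR : s < R := by
    refine lt_of_le_of_ne hzz' fun h0 => ?_
    have h1 : M * (s - s ^ 2 / (4 * R)) = 3 / 4 * (M * R) := by rw [h0]; field_simp; ring
    linarith
  have hloc : IsLocalMax (twoPt U M R k z0) (z, z') := by
    have hnb : K ∈ 𝓝 (z, z') := by
      have c1 : Continuous fun x : Euc N × Euc N => ‖x.1 - z0‖ := by fun_prop
      have c2 : Continuous fun x : Euc N × Euc N => ‖x.1 - x.2‖ := by fun_prop
      have h1 := (c1.tendsto (z, z')).eventually (gt_mem_nhds hzR')
      have h2 := (c2.tendsto (z, z')).eventually (gt_mem_nhds hsR)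
      filter_upwards [h1, h2] with x h3 h4 using ⟨h3.le, h4.le⟩
    exact hxmax.isLocalMax hnb
  have hUc := hU z hzb.2.1
  have hUc' := hU z' hzb.2.2
  have g1 := twoPt_fst hUc hne hloc
  have g2 := twoPt_snd hUc' hne hloc
  have hp := hpp z hzb.1 z' hzz' hne
    (by rw [g1, g2, add_sub_cancel_left, hk]; congr 1; ring) (by linarith)
  have hkey := twoPt_opE hM0.le hR hUc hUc' hne hloc (p z) (p z')
  have f1 := (abs_le.1 (hF z hzb.2.1)).1
  have f2 := (abs_le.1 (hF z' hzb.2.2)).2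
  rw [← hs] at hkey hp
  have t1 : (N - 1) * (M / s) * ‖p z - p z'‖ ^ 2 ≤ M / R := by
    calc (N - 1) * (M / s) * ‖p z - p z'‖ ^ 2 ≤ N * (M / s) * (σ * s) := by
          gcongr; linarith
      _ = N * σ * M := by field_simp
      _ ≤ M / R := by rw [le_div_iff₀ hR]; linarith [mul_le_mul_of_nonneg_right hσ hM0.le]
  have t2 : 2 * k * N + 2 * k * ((N - 1) * ‖p z‖ ^ 2) ≤ 2 * k * (N * Q) := by
    have h1 := hQ z hzb.2.1
    have h2 : N + (N - 1) * ‖p z‖ ^ 2 ≤ N * Q := by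
      have : N * (1 + ‖p z‖ ^ 2) ≤ N * Q := by gcongr
      linarith [sq_nonneg ‖p z‖]
    have h3 := mul_le_mul_of_nonneg_left h2 (show 0 ≤ 2 * k by positivity)
    linarith
  have t3 : M / R ≤ 2 * F0 + 2 * k * (N * Q) := by
    have : 2 * M / R = 2 * (M / R) := by ring
    linarith
  rw [div_le_iff₀ hR] at t3
  have t4 : (2 * F0 + 2 * k * (N * Q)) * R = 2 * F0 * R + 4 * N * Q * ε / R := by
    rw [hk]; field_simp; ring
  linarith

end two_point_bound

section smallness

variable {N : ℕ}

lemma lip_of_fderiv {f : Euc N → ℝ} {z0 : Euc N} {r A : ℝ}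
    (hf : ∀ z ∈ Metric.closedBall z0 r, ContDiffAt ℝ 2 f z)
    (hA : ∀ z ∈ Metric.closedBall z0 r, ‖fderiv ℝ f z‖ ≤ A) {x y : Euc N}
    (hx : x ∈ Metric.closedBall z0 r) (hy : y ∈ Metric.closedBall z0 r) :
    |f y - f x| ≤ A * ‖y - x‖ :=
  (convex_closedBall z0 r).norm_image_sub_le_of_norm_fderiv_le
    (fun z hz => (hf z hz).differentiableAt (by simp)) hA hx hy

lemma lip_fderiv_of_D2 {f : Euc N → ℝ} {z0 : Euc N} {r A : ℝ}
    (hf : ∀ z ∈ Metric.closedBall z0 r, ContDiffAt ℝ 2 f z)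
    (hA : ∀ z ∈ Metric.closedBall z0 r, ‖D2 f z‖ ≤ A) {x y : Euc N}
    (hx : x ∈ Metric.closedBall z0 r) (hy : y ∈ Metric.closedBall z0 r) :
    ‖fderiv ℝ f y - fderiv ℝ f x‖ ≤ A * ‖y - x‖ :=
  (convex_closedBall z0 r).norm_image_sub_le_of_norm_hasFDerivWithin_le
    (fun z hz => (hasFDerivAt_fderiv (hf z hz)).hasFDerivWithinAt) hA hx hy

/-- First order Taylor polynomial of `f` at `z0`. -/
def taylorOne (f : Euc N → ℝ) (z0 z : Euc N) : ℝ := f z0 + fderiv ℝ f z0 (z - z0)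

lemma hasFDerivAt_taylorOne (f : Euc N → ℝ) (z0 z : Euc N) :
    HasFDerivAt (taylorOne f z0) (fderiv ℝ f z0) z := by
  have h1 : HasFDerivAt (fun z : Euc N => z - z0) (ContinuousLinearMap.id ℝ (Euc N)) z :=
    (hasFDerivAt_id z).sub_const z0
  have h2 := ((fderiv ℝ f z0).hasFDerivAt.comp z h1).const_add (f z0)
  exact h2

lemma contDiff_taylorOne (f : Euc N → ℝ) (z0 : Euc N) : ContDiff ℝ 2 (taylorOne f z0) := by
  unfold taylorOne; fun_prop

lemma D2_taylorOne (f : Euc N → ℝ) (z0 z : Euc N) : D2 (taylorOne f z0) z = 0 :=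
  D2_eq_of_hasFDerivAt (Eventually.of_forall fun y => hasFDerivAt_taylorOne f z0 y)
    (hasFDerivAt_const _ _)

lemma abs_sub_taylorOne_le {f : Euc N → ℝ} {z0 : Euc N} {r A : ℝ} (hA0 : 0 ≤ A)
    (hf : ∀ z ∈ Metric.closedBall z0 r, ContDiffAt ℝ 2 f z)
    (hA : ∀ z ∈ Metric.closedBall z0 r, ‖D2 f z‖ ≤ A) {z : Euc N}
    (hz : z ∈ Metric.closedBall z0 r) : |f z - taylorOne f z0 z| ≤ A * r ^ 2 := by
  have hr : 0 ≤ r := dist_nonneg.trans hz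
  have hz0 : z0 ∈ Metric.closedBall z0 r := Metric.mem_closedBall_self hr
  have h1 : ∀ y ∈ Metric.closedBall z0 r,
      HasFDerivWithinAt (fun y => f y - taylorOne f z0 y) (fderiv ℝ f y - fderiv ℝ f z0)
        (Metric.closedBall z0 r) y := fun y hy =>
    (((hf y hy).differentiableAt (by simp)).hasFDerivAt.sub
      (hasFDerivAt_taylorOne f z0 y)).hasFDerivWithinAt
  have h2 : ∀ y ∈ Metric.closedBall z0 r, ‖fderiv ℝ f y - fderiv ℝ f z0‖ ≤ A * r := by
    intro y hy
    refine (lip_fderiv_of_D2 hf hA hz0 hy).trans ?_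
    have : ‖y - z0‖ ≤ r := by rw [← dist_eq_norm]; exact hy
    gcongr
  have h3 := (convex_closedBall z0 r).norm_image_sub_le_of_norm_hasFDerivWithin_le h1 h2 hz0 hz
  have h4 : taylorOne f z0 z0 = f z0 := by simp [taylorOne]
  rw [h4, sub_self, sub_zero] at h3
  have h5 : ‖z - z0‖ ≤ r := by rw [← dist_eq_norm]; exact hz
  calc |f z - taylorOne f z0 z| ≤ A * r * ‖z - z0‖ := h3
    _ ≤ A * r * r := by gcongr
    _ = A * r ^ 2 := by ring

theorem gradient_small (hN : 1 ≤ N) {κ' Λ C Cψ ρ : ℝ} (hκ' : 0 < κ') (hΛ : 0 ≤ Λ) (hC : 0 ≤ C)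
    (hCψ : 0 ≤ Cψ) (hρ : 0 < ρ) :
    ∃ ε : ℝ, 0 < ε ∧ ∀ (u ψ : Euc N → ℝ) (z0 : Euc N),
      (∀ z ∈ Metric.closedBall z0 ρ, ContDiffAt ℝ 2 u z) →
      (∀ z ∈ Metric.closedBall z0 ρ, ContDiffAt ℝ 2 ψ z) →
      (∀ z ∈ Metric.closedBall z0 ρ, ‖gradient u z‖ ≤ Λ) →
      ‖gradient ψ z0‖ ≤ Λ →
      (∀ z ∈ Metric.closedBall z0 ρ, ‖D2 ψ z‖ ≤ Cψ) →
      (∀ z ∈ Metric.closedBall z0 ρ, |opE (gradient u z) (fun ξ => D2 u z ξ ξ)| ≤ C) →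
      (∀ z ∈ Metric.closedBall z0 ρ, |u z - ψ z| ≤ ε) →
      ‖gradient u z0 - gradient ψ z0‖ ≤ κ' := by
  set Q := 1 + Λ ^ 2 with hQ
  set A := 2 * C + 4 * N * Q * (1 + 4 * Cψ) + 1 with hA
  set σ := 8 * (1 + 4 * Cψ) * (2 * Λ) with hσ
  have hA0 : 0 < A := by positivity
  have hσ0 : 0 ≤ σ := by positivity
  set R := min (ρ / 2) (min (κ' / A) (1 / (N * σ + 1))) with hR
  have hR0 : 0 < R := by positivity
  have hR1 : 2 * R ≤ ρ := by have : R ≤ ρ / 2 := min_le_left _ _; linarith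
  have hR2 : A * R ≤ κ' := by
    have : R ≤ κ' / A := (min_le_right _ _).trans (min_le_left _ _)
    rw [le_div_iff₀ hA0] at this; linarith
  have hR3 : N * σ * R ≤ 1 := by
    have : R ≤ 1 / (N * σ + 1) := (min_le_right _ _).trans (min_le_right _ _)
    rw [le_div_iff₀ (by positivity)] at this; linarith
  refine ⟨R ^ 2, by positivity, fun u ψ z0 hu hψ hgu hgψ hDψ hop huψ => ?_⟩
  have hsub : Metric.closedBall z0 (2 * R) ⊆ Metric.closedBall z0 ρ :=
    Metric.closedBall_subset_closedBall hR1
  set δ := (1 + 4 * Cψ) * R ^ 2 with hδ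
  have hδ0 : 0 < δ := by positivity
  set U : Euc N → ℝ := fun z => u z - taylorOne ψ z0 z with hU
  have hz0 : z0 ∈ Metric.closedBall z0 ρ := Metric.mem_closedBall_self hρ.le
  have hUC : ∀ z ∈ Metric.closedBall z0 (2 * R), ContDiffAt ℝ 2 U z := fun z hz =>
    (hu z (hsub hz)).sub (contDiff_taylorOne ψ z0).contDiffAt
  have hUd : ∀ z ∈ Metric.closedBall z0 (2 * R), fderiv ℝ U z = fderiv ℝ u z - fderiv ℝ ψ z0 :=
    fun z hz => (((hu z (hsub hz)).differentiableAt (by simp)).hasFDerivAt.sub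
      (hasFDerivAt_taylorOne ψ z0 z)).fderiv
  have hUg : ∀ z ∈ Metric.closedBall z0 (2 * R),
      gradient U z = gradient u z - gradient ψ z0 := by
    intro z hz
    refine ext_inner_right ℝ fun ξ => ?_
    rw [inner_sub_left, inner_gradient, inner_gradient, inner_gradient, hUd z hz, sub_apply]
  have hUD : ∀ z ∈ Metric.closedBall z0 (2 * R), D2 U z = D2 u z := by
    intro z hz
    rw [hU, D2_sub (hu z (hsub hz)) (contDiff_taylorOne ψ z0).contDiffAt, D2_taylorOne]
    exact sub_zero (D2 u z)
  have hUδ : ∀ z ∈ Metric.closedBall z0 (2 * R), |U z| ≤ δ := by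
    intro z hz
    have h1 := huψ z (hsub hz)
    have h2 := abs_sub_taylorOne_le hCψ (fun y hy => hψ y (hsub hy)) (fun y hy => hDψ y (hsub hy))
      hz
    have h3 : U z = (u z - ψ z) + (ψ z - taylorOne ψ z0 z) := by simp only [hU]; ring
    rw [h3]
    refine (abs_add_le _ _).trans ?_
    rw [hδ]; linarith
  have hUL : ∀ z ∈ Metric.closedBall z0 (2 * R), ‖fderiv ℝ U z‖ ≤ 2 * Λ := by
    intro z hz
    rw [hUd z hz]
    refine (norm_sub_le _ _).trans ?_
    rw [← norm_gradient, ← norm_gradient]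
    linarith [hgu z (hsub hz)]
  have hkey := two_point_bound hN (U := U) (p := gradient u) (z0 := z0) (R := R) (ε := δ) (Q := Q)
    (F0 := C) (σ := σ) hR0 hUC hUδ
    (fun z hz => by rw [hQ]; have := hgu z (hsub hz); gcongr)
    (fun z hz => by rw [hUD z hz]; exact hop z (hsub hz)) hR3 ?_
  · rw [hUg z0 (Metric.mem_closedBall_self (by linarith))] at hkey
    have e1 : 2 * C * R + 4 * N * Q * δ / R = (2 * C + 4 * N * Q * (1 + 4 * Cψ)) * R := by
      rw [hδ]; field_simp
    rw [e1] at hkey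
    refine (hkey.trans ?_).trans hR2
    rw [hA]; linarith
  · intro z hz z' hzz' hne hg hk
    have hzb : z ∈ Metric.closedBall z0 (2 * R) :=
      Metric.closedBall_subset_closedBall (by linarith) hz
    have hzb' : z' ∈ Metric.closedBall z0 (2 * R) := by
      rw [Metric.mem_closedBall] at hz ⊢
      have := dist_triangle z' z z0
      rw [dist_comm z' z, dist_eq_norm z z'] at this
      linarith
    have h1 : gradient u z - gradient u z' = (4 * δ / R ^ 2) • (z - z0) := by
      rw [← hg, hUg z hzb, hUg z' hzb']; abel
    have h2 := (le_abs_self _).trans (lip_of_fderiv hUC hUL hzb' hzb)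
    rw [h1, norm_smul, mul_pow, Real.norm_of_nonneg (by positivity)]
    have h3 : (4 * δ / R ^ 2) ^ 2 * ‖z - z0‖ ^ 2
        = 8 * (1 + 4 * Cψ) * (2 * δ / R ^ 2 * ‖z - z0‖ ^ 2) := by
      rw [hδ]; field_simp; ring
    rw [h3, hσ, mul_assoc (8 * (1 + 4 * Cψ))]
    exact mul_le_mul_of_nonneg_left (hk.trans h2) (by positivity)

end smallness

section hessian_tools

variable {N : ℕ}

lemma rhs_lip {u : Euc N → ℝ} {z1 : Euc N} {r Λ Λ2 C κ : ℝ} (hκ : 0 ≤ κ) (hC0 : 0 ≤ C)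
    (hu : ∀ z ∈ Metric.closedBall z1 r, ContDiffAt ℝ 2 u z)
    (hpos : ∀ z ∈ Metric.closedBall z1 r, 0 < u z)
    (hΛ : ∀ z ∈ Metric.closedBall z1 r, ‖gradient u z‖ ≤ Λ)
    (hΛ2 : ∀ z ∈ Metric.closedBall z1 r, ‖D2 u z‖ ≤ Λ2)
    (hC : ∀ z ∈ Metric.closedBall z1 r, κ / u z ≤ C)
    (hC' : ∀ z ∈ Metric.closedBall z1 r, κ / u z ^ 2 ≤ C)
    {x y : Euc N} (hx : x ∈ Metric.closedBall z1 r) (hy : y ∈ Metric.closedBall z1 r) :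
    |(1 + ‖gradient u y‖ ^ 2) * (κ / u y) - (1 + ‖gradient u x‖ ^ 2) * (κ / u x)|
      ≤ (2 * Λ * Λ2 * C + (1 + Λ ^ 2) * C * Λ) * ‖y - x‖ := by
  choose! g' hg hg' using fun z (hz : z ∈ Metric.closedBall z1 r) =>
    exists_hasStrictFDerivAt_rhs κ (hu z hz) (hpos z hz)
  refine (convex_closedBall z1 r).norm_image_sub_le_of_norm_hasFDerivWithin_le
    (f := fun y => (1 + ‖gradient u y‖ ^ 2) * (κ / u y)) (f' := g')
    (fun z hz => (hg z hz).hasFDerivAt.hasFDerivWithinAt) (fun z hz => ?_) hx hy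
  have hΛ0 : 0 ≤ Λ := (norm_nonneg _).trans (hΛ z hz)
  have hΛ20 : 0 ≤ Λ2 := (norm_nonneg (D2 u z)).trans (hΛ2 z hz)
  refine ContinuousLinearMap.opNorm_le_bound _ (by positivity) fun e => ?_
  rw [hg' z hz e, Real.norm_eq_abs]
  have h1 : |inner ℝ (gradient u z) (rep (D2 u z) e)| ≤ Λ * Λ2 * ‖e‖ := by
    rw [real_inner_comm, inner_rep]
    calc |D2 u z e (gradient u z)| ≤ ‖D2 u z‖ * ‖e‖ * ‖gradient u z‖ := (D2 u z).le_opNorm₂ _ _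
      _ ≤ Λ2 * ‖e‖ * Λ := by gcongr; exacts [hΛ2 z hz, hΛ z hz]
      _ = _ := by ring
  have h2 : |fderiv ℝ u z e| ≤ Λ * ‖e‖ := by
    refine ((fderiv ℝ u z).le_opNorm e).trans ?_
    rw [← norm_gradient]; gcongr; exact hΛ z hz
  have hp := hpos z hz
  have h3 : |2 * inner ℝ (gradient u z) (rep (D2 u z) e) * (κ / u z)|
      ≤ 2 * Λ * Λ2 * C * ‖e‖ := by
    rw [abs_mul, abs_mul, abs_two, abs_of_nonneg (by positivity : 0 ≤ κ / u z)]
    calc _ ≤ 2 * (Λ * Λ2 * ‖e‖) * C := by gcongr; exact hC z hz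
      _ = _ := by ring
  have h4 : |(1 + ‖gradient u z‖ ^ 2) * (κ * fderiv ℝ u z e / u z ^ 2)|
      ≤ (1 + Λ ^ 2) * C * Λ * ‖e‖ := by
    have h5 : κ * fderiv ℝ u z e / u z ^ 2 = κ / u z ^ 2 * fderiv ℝ u z e := by ring
    rw [h5, abs_mul, abs_mul, abs_of_nonneg (by positivity : 0 ≤ κ / u z ^ 2),
      abs_of_pos (by positivity : 0 < 1 + ‖gradient u z‖ ^ 2)]
    calc _ ≤ (1 + Λ ^ 2) * (C * (Λ * ‖e‖)) := by
          gcongr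
          exacts [hΛ z hz, hC' z hz]
      _ = _ := by ring
  refine (abs_sub _ _).trans ?_
  linarith

lemma abs_opE_dq_le {u : Euc N → ℝ} {z1 : Euc N} {r Λ Λ2 C κ : ℝ} (hκ : 0 ≤ κ) (hC0 : 0 ≤ C)
    (hu : ∀ z ∈ Metric.closedBall z1 r, ContDiffAt ℝ 2 u z)
    (hpos : ∀ z ∈ Metric.closedBall z1 r, 0 < u z)
    (hsol : ∀ z ∈ Metric.closedBall z1 r, SolE κ u z)
    (hΛ : ∀ z ∈ Metric.closedBall z1 r, ‖gradient u z‖ ≤ Λ)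
    (hΛ2 : ∀ z ∈ Metric.closedBall z1 r, ‖D2 u z‖ ≤ Λ2)
    (hC : ∀ z ∈ Metric.closedBall z1 r, κ / u z ≤ C)
    (hC' : ∀ z ∈ Metric.closedBall z1 r, κ / u z ^ 2 ≤ C)
    {e y : Euc N} {t : ℝ} (ht : 0 < t) (he : ‖e‖ = 1)
    (hy : y ∈ Metric.closedBall z1 r) (hy' : y + t • e ∈ Metric.closedBall z1 r) :
    |opE (gradient u y) (fun ξ => D2 (dq u e t) y ξ ξ)|
      ≤ (2 * Λ * Λ2 * C + (1 + Λ ^ 2) * C * Λ) + 2 * Λ * (N + 1) * Λ2 ^ 2 := by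
  have hte : ‖y + t • e - y‖ = t := by
    rw [add_sub_cancel_left, norm_smul, he, mul_one, Real.norm_of_nonneg ht.le]
  have h1 := rhs_lip hκ hC0 hu hpos hΛ hΛ2 hC hC' hy hy'
  rw [hte] at h1
  have hδ : ‖t⁻¹ • (gradient u (y + t • e) - gradient u y)‖ ≤ Λ2 := by
    rw [norm_smul, norm_gradient_sub, norm_inv, Real.norm_of_nonneg ht.le, inv_mul_le_iff₀ ht]
    have := lip_fderiv_of_D2 hu hΛ2 hy hy'
    rw [hte] at this
    linarith
  rw [opE_dq (g := fun z => (1 + ‖gradient u z‖ ^ 2) * (κ / u z)) (hu y hy) (hu _ hy')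
    (hsol y hy) (hsol _ hy')]
  set δ := t⁻¹ • (gradient u (y + t • e) - gradient u y) with hδd
  have hΛ0 : 0 ≤ Λ := (norm_nonneg _).trans (hΛ y hy)
  have hΛ20 : 0 ≤ Λ2 := (norm_nonneg (D2 u y)).trans (hΛ2 y hy)
  have hs : ‖gradient u (y + t • e) + gradient u y‖ ≤ 2 * Λ := by
    refine (norm_add_le _ _).trans ?_
    have := hΛ y hy
    have := hΛ _ hy'
    linarith
  have a1 : |t⁻¹ • ((1 + ‖gradient u (y + t • e)‖ ^ 2) * (κ / u (y + t • e))
      - (1 + ‖gradient u y‖ ^ 2) * (κ / u y))| ≤ 2 * Λ * Λ2 * C + (1 + Λ ^ 2) * C * Λ := by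
    rw [smul_eq_mul, abs_mul, abs_inv, abs_of_pos ht, inv_mul_le_iff₀ ht]
    linarith
  have a2 : |inner ℝ δ (gradient u (y + t • e) + gradient u y)
      * ∑ k, D2 u (y + t • e) (EuclideanSpace.single k 1) (EuclideanSpace.single k 1)|
      ≤ Λ2 * (2 * Λ) * (N * Λ2) := by
    rw [abs_mul]
    have b1 := abs_real_inner_le_norm δ (gradient u (y + t • e) + gradient u y)
    have b2 := abs_sum_single_le (D2 u (y + t • e))
    have b3 := hΛ2 _ hy'
    calc _ ≤ (‖δ‖ * ‖gradient u (y + t • e) + gradient u y‖) * (N * ‖D2 u (y + t • e)‖) := by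
          gcongr
      _ ≤ _ := by gcongr
  have a3 : |D2 u (y + t • e) δ (gradient u (y + t • e) + gradient u y)|
      ≤ Λ2 * Λ2 * (2 * Λ) := by
    have b3 := hΛ2 _ hy'
    calc _ ≤ ‖D2 u (y + t • e)‖ * ‖δ‖ * ‖gradient u (y + t • e) + gradient u y‖ :=
          (D2 u (y + t • e)).le_opNorm₂ _ _
      _ ≤ _ := by gcongr
  refine (abs_sub _ _).trans ?_
  have a4 := abs_sub (inner ℝ δ (gradient u (y + t • e) + gradient u y)
      * ∑ k, D2 u (y + t • e) (EuclideanSpace.single k 1) (EuclideanSpace.single k 1))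
      (D2 u (y + t • e) δ (gradient u (y + t • e) + gradient u y))
  have e1 : 2 * Λ * (N + 1) * Λ2 ^ 2 = Λ2 * (2 * Λ) * (N * Λ2) + Λ2 * Λ2 * (2 * Λ) := by ring
  rw [e1]
  exact add_le_add a1 (a4.trans (add_le_add a2 a3))

end hessian_tools

section hessian_small

variable {N : ℕ}

lemma norm_inv_smul_le {F : Type*} [NormedAddCommGroup F] [NormedSpace ℝ F] {a : F}
    {t C : ℝ} (ht : 0 < t) (h : ‖a‖ ≤ C * t) : ‖t⁻¹ • a‖ ≤ C := by
  rw [norm_smul, norm_inv, Real.norm_of_nonneg ht.le, inv_mul_le_iff₀ ht]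
  linarith

lemma continuousAt_norm_sub {X F : Type*} [TopologicalSpace X] [NormedAddCommGroup F]
    {f g : X → F} {x : X} (hf : ContinuousAt f x) (hg : ContinuousAt g x) :
    ContinuousAt (fun z => ‖f z - g z‖) x :=
  (hf.sub hg).norm

lemma norm_D2_apply_le_of_dq {w : Euc N → ℝ} {z e : Euc N} {B r : ℝ} (hr : 0 < r)
    (hw : ContDiffAt ℝ 2 w z)
    (h : ∀ t, 0 < t → t < r → ‖t⁻¹ • (fderiv ℝ w (z + t • e) - fderiv ℝ w z)‖ ≤ B) :
    ‖D2 w z e‖ ≤ B := by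
  have h1 : HasDerivAt (fun t : ℝ => fderiv ℝ w (z + t • e)) (D2 w z e) 0 :=
    (hasFDerivAt_fderiv hw).hasLineDerivAt e
  have h2 := h1.tendsto_slope_zero_right
  refine le_of_tendsto h2.norm ?_
  filter_upwards [Ioo_mem_nhdsGT hr] with t ht
  simpa using h t ht.1 ht.2

theorem hessian_bound_of_small (hN : 1 ≤ N) {u ψ : Euc N → ℝ} {z1 : Euc N} {r R Λ Λ2 C C3 ε κ : ℝ}
    (hκ : 0 ≤ κ) (hC0 : 0 ≤ C) (hR : 0 < R) (hRr : 2 * R < r)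
    (hu : ∀ z ∈ Metric.closedBall z1 r, ContDiffAt ℝ 2 u z)
    (hψ : ∀ z ∈ Metric.closedBall z1 r, ContDiffAt ℝ 2 ψ z)
    (hpos : ∀ z ∈ Metric.closedBall z1 r, 0 < u z)
    (hsol : ∀ z ∈ Metric.closedBall z1 r, SolE κ u z)
    (hΛ : ∀ z ∈ Metric.closedBall z1 r, ‖gradient u z‖ ≤ Λ)
    (hΛ2 : ∀ z ∈ Metric.closedBall z1 r, ‖D2 u z‖ ≤ Λ2)
    (hC : ∀ z ∈ Metric.closedBall z1 r, κ / u z ≤ C)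
    (hC' : ∀ z ∈ Metric.closedBall z1 r, κ / u z ^ 2 ≤ C)
    (hC3 : ∀ x ∈ Metric.closedBall z1 r, ∀ y ∈ Metric.closedBall z1 r,
      ‖D2 ψ y - D2 ψ x‖ ≤ C3 * ‖y - x‖)
    (hε : ∀ z ∈ Metric.closedBall z1 r, ‖gradient u z - gradient ψ z‖ ≤ ε)
    (hσ : N * (2 * Λ * Λ2) * R ≤ 1) :
    ‖D2 u z1 - D2 ψ z1‖ ≤ 2 * ((2 * Λ * Λ2 * C + (1 + Λ ^ 2) * C * Λ)
      + 2 * Λ * (N + 1) * Λ2 ^ 2 + (N + 1) * (1 + Λ ^ 2) * C3) * R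
      + 4 * N * (1 + Λ ^ 2) * ε / R := by
  have hz1 : z1 ∈ Metric.closedBall z1 r := Metric.mem_closedBall_self (by linarith)
  have hΛ0 : 0 ≤ Λ := (norm_nonneg _).trans (hΛ z1 hz1)
  have hΛ20 : 0 ≤ Λ2 := (norm_nonneg (D2 u z1)).trans (hΛ2 z1 hz1)
  have hε0 : 0 ≤ ε := (norm_nonneg _).trans (hε z1 hz1)
  have hsub : Metric.closedBall z1 (2 * R) ⊆ Metric.closedBall z1 r :=
    Metric.closedBall_subset_closedBall hRr.le
  set w : Euc N → ℝ := fun z => u z - ψ z with hw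
  have hwC : ∀ z ∈ Metric.closedBall z1 r, ContDiffAt ℝ 2 w z := fun z hz => (hu z hz).sub (hψ z hz)
  have hwd : ∀ z ∈ Metric.closedBall z1 r, fderiv ℝ w z = fderiv ℝ u z - fderiv ℝ ψ z :=
    fun z hz => fderiv_sub ((hu z hz).differentiableAt (by simp))
      ((hψ z hz).differentiableAt (by simp))
  have hwL : ∀ z ∈ Metric.closedBall z1 r, ‖fderiv ℝ w z‖ ≤ ε := fun z hz => by
    rw [hwd z hz, ← norm_gradient_sub]; exact hε z hz
  set B := 2 * ((2 * Λ * Λ2 * C + (1 + Λ ^ 2) * C * Λ)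
      + 2 * Λ * (N + 1) * Λ2 ^ 2 + (N + 1) * (1 + Λ ^ 2) * C3) * R
      + 4 * N * (1 + Λ ^ 2) * ε / R with hB
  have key : ∀ e : Euc N, ‖e‖ = 1 → ‖D2 w z1 e‖ ≤ B := by
    intro e he
    refine norm_D2_apply_le_of_dq (r := r - 2 * R) (by linarith) (hwC z1 hz1) fun t ht htr => ?_
    have hshift : ∀ z ∈ Metric.closedBall z1 (2 * R), z + t • e ∈ Metric.closedBall z1 r := by
      intro z hz
      rw [mem_closedBall_iff_norm] at hz ⊢
      have h1 : z + t • e - z1 = (z - z1) + t • e := by abel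
      have h2 : ‖t • e‖ = t := by rw [norm_smul, he, mul_one, Real.norm_of_nonneg ht.le]
      rw [h1]
      refine (norm_add_le _ _).trans ?_
      rw [h2]; linarith
    have hte : ∀ z : Euc N, ‖z + t • e - z‖ = t := fun z => by
      rw [add_sub_cancel_left, norm_smul, he, mul_one, Real.norm_of_nonneg ht.le]
    have hz1' : z1 ∈ Metric.closedBall z1 (2 * R) := Metric.mem_closedBall_self (by linarith)
    rw [← fderiv_dq (hwC z1 hz1) (hwC _ (hshift z1 hz1')), ← norm_gradient]
    refine two_point_bound hN (U := dq w e t) (p := gradient u) (σ := 2 * Λ * Λ2) hR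
      (fun z hz => contDiffAt_dq (hwC z (hsub hz)) (hwC _ (hshift z hz))) ?_ ?_ ?_ hσ ?_
    · intro z hz
      have h1 := lip_of_fderiv hwC hwL (hsub hz) (hshift z hz)
      rw [hte] at h1
      rw [dq, abs_mul, abs_inv, abs_of_pos ht, inv_mul_le_iff₀ ht]
      linarith
    · intro z hz
      have := hΛ z (hsub hz)
      gcongr
    · intro z hz
      have h1 := abs_opE_dq_le hκ hC0 hu hpos hsol hΛ hΛ2 hC hC' ht he (hsub hz) (hshift z hz)
      have h2 := abs_opE_le (D2 (dq ψ e t) z) (gradient u z)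
      have h3 : ‖D2 (dq ψ e t) z‖ ≤ C3 := by
        rw [D2_dq (hψ z (hsub hz)) (hψ _ (hshift z hz))]
        have h := hC3 z (hsub hz) _ (hshift z hz)
        rw [hte] at h
        exact norm_inv_smul_le (F := Euc N →L[ℝ] Euc N →L[ℝ] ℝ) ht h
      have h4 : dq w e t = fun z => dq u e t z - dq ψ e t z := by
        funext z; simp only [dq, hw]; ring
      have h5 : D2 (dq w e t) z = D2 (dq u e t) z - D2 (dq ψ e t) z := by
        rw [h4]
        exact D2_sub (contDiffAt_dq (hu z (hsub hz)) (hu _ (hshift z hz)))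
          (contDiffAt_dq (hψ z (hsub hz)) (hψ _ (hshift z hz)))
      have h6 : opE (gradient u z) (fun ξ => D2 (dq w e t) z ξ ξ)
          = opE (gradient u z) (fun ξ => D2 (dq u e t) z ξ ξ)
            - opE (gradient u z) (fun ξ => D2 (dq ψ e t) z ξ ξ) := by
        rw [h5, ← opE_sub]; rfl
      rw [h6]
      refine (abs_sub _ _).trans (add_le_add h1 (h2.trans ?_))
      have := hΛ z (hsub hz)
      gcongr
    · intro z hz z' hzz' hne _ _
      have hzb : z ∈ Metric.closedBall z1 r :=
        Metric.closedBall_subset_closedBall (by linarith) hz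
      have hzb' : z' ∈ Metric.closedBall z1 r := by
        rw [Metric.mem_closedBall] at hz ⊢
        have := dist_triangle z' z z1
        rw [dist_comm z' z, dist_eq_norm z z'] at this
        linarith
      have h1 := lip_fderiv_of_D2 hu hΛ2 hzb' hzb
      rw [← norm_gradient_sub] at h1
      have h2 : ‖gradient u z - gradient u z'‖ ≤ 2 * Λ := by
        refine (norm_sub_le _ _).trans ?_
        linarith [hΛ z hzb, hΛ z' hzb']
      rw [sq, mul_assoc (2 * Λ)]
      exact mul_le_mul h2 h1 (norm_nonneg _) (by linarith)
  have hDw : D2 u z1 - D2 ψ z1 = D2 w z1 := (D2_sub (hu z1 hz1) (hψ z1 hz1)).symm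
  have hB0 : 0 ≤ B := by
    have : Nonempty (Fin N) := ⟨⟨0, hN⟩⟩
    exact (norm_nonneg _).trans (key (EuclideanSpace.single (Classical.arbitrary _) 1) (by simp))
  rw [hDw]
  exact ContinuousLinearMap.opNorm_le_of_unit_norm hB0 key

set_option maxHeartbeats 1000000 in
theorem hess_small (hN : 1 ≤ N) {κ' Λ C Cψ C3 ρ κ : ℝ} (hκ : 0 ≤ κ) (hκ' : 0 < κ') (hΛ0 : 0 ≤ Λ)
    (hC0 : 0 ≤ C) (hCψ : 0 ≤ Cψ) (hC30 : 0 ≤ C3) (hρ : 0 < ρ) :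
    ∃ ε : ℝ, 0 < ε ∧ ∀ (u ψ : Euc N → ℝ) (z0 : Euc N),
      (∀ z ∈ Metric.closedBall z0 ρ, ContDiffAt ℝ 2 u z) →
      (∀ z ∈ Metric.closedBall z0 ρ, ContDiffAt ℝ 2 ψ z) →
      (∀ z ∈ Metric.closedBall z0 ρ, 0 < u z) →
      (∀ z ∈ Metric.closedBall z0 ρ, SolE κ u z) →
      (∀ z ∈ Metric.closedBall z0 ρ, ‖gradient u z‖ ≤ Λ) →
      (∀ z ∈ Metric.closedBall z0 ρ, κ / u z ≤ C) →
      (∀ z ∈ Metric.closedBall z0 ρ, κ / u z ^ 2 ≤ C) →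
      (∀ z ∈ Metric.closedBall z0 ρ, ‖D2 ψ z‖ ≤ Cψ) →
      (∀ x ∈ Metric.closedBall z0 ρ, ∀ y ∈ Metric.closedBall z0 ρ,
        ‖D2 ψ y - D2 ψ x‖ ≤ C3 * ‖y - x‖) →
      (∀ z ∈ Metric.closedBall z0 ρ, ‖gradient u z - gradient ψ z‖ ≤ ε) →
      ‖D2 u z0 - D2 ψ z0‖ ≤ κ' := by
  set Q := 1 + Λ ^ 2 with hQ
  set C' := (2 * Λ * (2 + Cψ) * C + Q * C * Λ) + 2 * Λ * (N + 1) * (2 + Cψ) ^ 2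
    + (N + 1) * Q * C3 with hC'
  have hC'0 : 0 ≤ C' := by positivity
  set b := κ' / (κ' + 1) with hb
  have hb0 : 0 < b := by positivity
  set μ := min (ρ * κ' / 8) (min (1 / (2 * N * Λ * (2 + Cψ) + 1)) (b / (6 * C' + 1))) with hμ
  have hμ0 : 0 < μ := by rw [hμ]; refine lt_min ?_ (lt_min ?_ ?_) <;> positivity
  have hμ1 : μ ≤ ρ * κ' / 8 := min_le_left _ _
  have hμ2 : N * (2 * Λ * (2 + Cψ)) * μ ≤ 1 := by
    have h1 : μ ≤ 1 / (2 * N * Λ * (2 + Cψ) + 1) := (min_le_right _ _).trans (min_le_left _ _)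
    rw [le_div_iff₀ (by positivity)] at h1
    linarith
  have hμ3 : 6 * C' * μ ≤ b := by
    have h1 : μ ≤ b / (6 * C' + 1) := (min_le_right _ _).trans (min_le_right _ _)
    rw [le_div_iff₀ (by positivity)] at h1
    linarith
  set ε := b * μ / (12 * N * Q) with hε
  have hN0 : (0:ℝ) < N := by exact_mod_cast hN
  have hQ0 : 0 < Q := by positivity
  refine ⟨ε, by positivity, ?_⟩
  intro u ψ z0 hu hψ hpos hsol hgu h1u h2u hDψ hLψ hw
  by_contra! hcon
  have hcont : ContinuousOn (fun z => (ρ - ‖z - z0‖) * ‖D2 u z - D2 ψ z‖)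
      (Metric.closedBall z0 ρ) := fun z hz =>
    (ContinuousAt.mul (by fun_prop)
      (continuousAt_norm_sub (F := Euc N →L[ℝ] Euc N →L[ℝ] ℝ) (continuousAt_D2 (hu z hz)) (continuousAt_D2 (hψ z hz)))).continuousWithinAt
  have hz0 : z0 ∈ Metric.closedBall z0 ρ := Metric.mem_closedBall_self hρ.le
  obtain ⟨z1, hz1, hmax⟩ := (isCompact_closedBall z0 ρ).exists_isMaxOn ⟨z0, hz0⟩ hcont
  have hm : ∀ z ∈ Metric.closedBall z0 ρ, (ρ - ‖z - z0‖) * ‖D2 u z - D2 ψ z‖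
      ≤ (ρ - ‖z1 - z0‖) * ‖D2 u z1 - D2 ψ z1‖ := hmax
  set l := ‖D2 u z1 - D2 ψ z1‖ with hl
  set d := ρ - ‖z1 - z0‖ with hd
  have hl0 : 0 ≤ l := norm_nonneg (D2 u z1 - D2 ψ z1)
  have hdl : ρ * κ' < d * l := by
    have h1 := hm z0 hz0
    rw [sub_self, norm_zero, sub_zero] at h1
    exact (mul_lt_mul_of_pos_left hcon hρ).trans_le h1
  have hdρ : d ≤ ρ := by rw [hd]; linarith [norm_nonneg (z1 - z0)]
  have hd0 : 0 < d := by
    by_contra! h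
    have := mul_nonpos_of_nonpos_of_nonneg h hl0
    linarith [mul_pos hρ hκ']
  have hlκ : κ' ≤ l := by
    by_contra! h
    have h1 : d * l ≤ ρ * κ' := mul_le_mul hdρ h.le hl0 hρ.le
    linarith
  have hsub : Metric.closedBall z1 (d / 2) ⊆ Metric.closedBall z0 ρ := by
    refine Metric.closedBall_subset_closedBall' ?_
    rw [dist_eq_norm]; linarith
  have hw2 : ∀ z ∈ Metric.closedBall z1 (d / 2), ‖D2 u z‖ ≤ 2 * l + Cψ := by
    intro z hz
    have h1 := hm z (hsub hz)
    have h2 : d / 2 ≤ ρ - ‖z - z0‖ := by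
      have h3 := norm_sub_le_norm_sub_add_norm_sub z z1 z0
      rw [mem_closedBall_iff_norm] at hz
      linarith
    have h4 : ‖D2 u z - D2 ψ z‖ ≤ 2 * l := by
      have h5 := mul_le_mul_of_nonneg_right h2 (norm_nonneg (D2 u z - D2 ψ z))
      have h6 : d * ‖D2 u z - D2 ψ z‖ ≤ d * (2 * l) := by linarith
      exact le_of_mul_le_mul_left h6 hd0
    have h7 := norm_le_norm_add_norm_sub' (D2 u z) (D2 ψ z)
    linarith [hDψ z (hsub hz)]
  set a := 1 + l with ha
  have ha1 : 1 ≤ a := by linarith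
  have ha0 : 0 < a := by linarith
  have haa : a ≤ a ^ 2 := by rw [sq]; exact le_mul_of_one_le_left ha0.le ha1
  have hΛ2 : 2 * l + Cψ ≤ (2 + Cψ) * a := by
    have : 0 ≤ Cψ * l := mul_nonneg hCψ hl0
    rw [ha]; linarith
  have hΛ20 : 0 ≤ 2 * l + Cψ := by linarith
  have hR : 0 < μ / a := by positivity
  have hstep := hessian_bound_of_small hN (r := d / 2) (R := μ / a) (Λ2 := 2 * l + Cψ) hκ hC0 hR
    (by
      rw [← mul_div_assoc, div_lt_iff₀ ha0]
      have h1 : d / 2 * a = d / 2 + d * l / 2 := by rw [ha]; ring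
      rw [h1]; linarith)
    (fun z hz => hu z (hsub hz)) (fun z hz => hψ z (hsub hz)) (fun z hz => hpos z (hsub hz))
    (fun z hz => hsol z (hsub hz)) (fun z hz => hgu z (hsub hz)) hw2
    (fun z hz => h1u z (hsub hz)) (fun z hz => h2u z (hsub hz))
    (fun x hx y hy => hLψ x (hsub hx) y (hsub hy)) (fun z hz => hw z (hsub hz))
    (by
      have h1 : N * (2 * Λ * (2 * l + Cψ)) * (μ / a)
          ≤ N * (2 * Λ * ((2 + Cψ) * a)) * (μ / a) := by gcongr
      have h2 : N * (2 * Λ * ((2 + Cψ) * a)) * (μ / a) = N * (2 * Λ * (2 + Cψ)) * μ := by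
        field_simp
      linarith)
  have hF : (2 * Λ * (2 * l + Cψ) * C + (1 + Λ ^ 2) * C * Λ)
      + 2 * Λ * (N + 1) * (2 * l + Cψ) ^ 2 + (N + 1) * (1 + Λ ^ 2) * C3 ≤ C' * a ^ 2 := by
    have e1 : 2 * Λ * (2 * l + Cψ) * C ≤ 2 * Λ * (2 + Cψ) * C * a ^ 2 := by
      calc _ ≤ 2 * Λ * ((2 + Cψ) * a ^ 2) * C := by
            gcongr; exact hΛ2.trans (by gcongr)
        _ = _ := by ring
    have h1a : 1 ≤ a ^ 2 := ha1.trans haa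
    have e2 : (1 + Λ ^ 2) * C * Λ ≤ Q * C * Λ * a ^ 2 :=
      le_mul_of_one_le_right (by positivity) h1a
    have e3 : 2 * Λ * (N + 1) * (2 * l + Cψ) ^ 2
        ≤ 2 * Λ * (N + 1) * (2 + Cψ) ^ 2 * a ^ 2 := by
      calc _ ≤ 2 * Λ * (N + 1) * ((2 + Cψ) * a) ^ 2 := by gcongr
        _ = _ := by ring
    have e4 : (N + 1) * (1 + Λ ^ 2) * C3 ≤ (N + 1) * Q * C3 * a ^ 2 :=
      le_mul_of_one_le_right (by positivity) h1a
    rw [hC']; linarith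
  have e5 : 2 * (C' * a ^ 2) * (μ / a) = 2 * C' * μ * a := by field_simp
  have e6 : 4 * N * (1 + Λ ^ 2) * ε / (μ / a) = b / 3 * a := by
    rw [hε, ← hQ]; field_simp; ring
  have e7 : b * a ≤ l := by
    rw [hb, div_mul_eq_mul_div, div_le_iff₀ (by positivity), ha]; linarith
  have e8 : l ≤ 2 * C' * μ * a + b / 3 * a := by
    rw [← e5, ← e6]
    refine hstep.trans ?_
    gcongr
  have e9 : 6 * C' * μ * a ≤ b * a := mul_le_mul_of_nonneg_right hμ3 ha0.le
  have e10 : 0 < b * a := by positivity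
  linarith

end hessian_small

section cone

variable {n ℓ : ℕ}

/-- The projection `(x, y) ↦ x`. -/
def xproj (n ℓ : ℕ) : Euc (n + ℓ) →L[ℝ] Euc n :=
  LinearMap.toContinuousLinearMap
    { toFun := fun z => WithLp.toLp 2 fun i => z (Fin.castAdd ℓ i)
      map_add' := fun _ _ => rfl
      map_smul' := fun _ _ => rfl }

lemma xproj_apply (z : Euc (n + ℓ)) (i : Fin n) : xproj n ℓ z i = z (Fin.castAdd ℓ i) := rfl

lemma norm_xproj (z : Euc (n + ℓ)) : ‖xproj n ℓ z‖ = xnorm n ℓ z := by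
  rw [EuclideanSpace.norm_eq, xnorm]
  simp [xproj_apply]

lemma norm_sq_eq_xnorm_add_ynorm (z : Euc (n + ℓ)) :
    ‖z‖ ^ 2 = xnorm n ℓ z ^ 2 + ynorm n ℓ z ^ 2 := by
  rw [norm_sq_eq_sum, Fin.sum_univ_add, xnorm, ynorm, Real.sq_sqrt, Real.sq_sqrt] <;>
    exact Finset.sum_nonneg fun _ _ => sq_nonneg _

lemma xnorm_nonneg (z : Euc (n + ℓ)) : 0 ≤ xnorm n ℓ z := Real.sqrt_nonneg _

lemma norm_xproj_le (z : Euc (n + ℓ)) : ‖xproj n ℓ z‖ ≤ ‖z‖ := by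
  rw [norm_xproj]
  refine (sq_le_sq₀ (xnorm_nonneg z) (norm_nonneg z)).1 ?_
  rw [norm_sq_eq_xnorm_add_ynorm]
  linarith [sq_nonneg (ynorm n ℓ z)]

lemma xproj_single_castAdd (i : Fin n) :
    xproj n ℓ (EuclideanSpace.single (Fin.castAdd ℓ i) 1) = EuclideanSpace.single i 1 := by
  ext j
  rw [xproj_apply]
  simp [Fin.ext_iff]

lemma xproj_single_natAdd (j : Fin ℓ) :
    xproj n ℓ (EuclideanSpace.single (Fin.natAdd n j) 1) = 0 := by
  ext i
  rw [xproj_apply]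
  have : Fin.castAdd ℓ i ≠ Fin.natAdd n j := by
    intro h
    have := congrArg Fin.val h
    simp at this
    omega
  simp [this]

lemma sum_norm_xproj_sq :
    ∑ k, ‖xproj n ℓ (EuclideanSpace.single k 1)‖ ^ 2 = n := by
  rw [Fin.sum_univ_add]
  simp [xproj_single_castAdd, xproj_single_natAdd]

lemma sum_inner_xproj_sq (a : Euc n) :
    ∑ k, inner ℝ a (xproj n ℓ (EuclideanSpace.single k 1)) ^ 2 = ‖a‖ ^ 2 := by
  rw [Fin.sum_univ_add, norm_sq_eq_sum]
  simp [xproj_single_castAdd, xproj_single_natAdd, EuclideanSpace.inner_single_right]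

lemma xproj_adjoint (a : Euc n) : xproj n ℓ (ContinuousLinearMap.adjoint (xproj n ℓ) a) = a := by
  ext i
  rw [xproj_apply]
  have h := ContinuousLinearMap.adjoint_inner_left (xproj n ℓ)
    (EuclideanSpace.single (Fin.castAdd ℓ i) 1) a
  rw [xproj_single_castAdd, EuclideanSpace.inner_single_right,
    EuclideanSpace.inner_single_right] at h
  simpa using h

/-- The cone `α|x|`. -/
def coneFn (n ℓ : ℕ) (α : ℝ) (z : Euc (n + ℓ)) : ℝ := α * xnorm n ℓ z

lemma coneFn_eq (α : ℝ) : coneFn n ℓ α = fun z => α * √(‖xproj n ℓ z‖ ^ 2) := by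
  funext z; rw [Real.sqrt_sq (norm_nonneg _), norm_xproj]; rfl

lemma contDiffAt_coneFn (α : ℝ) {z : Euc (n + ℓ)} {k : WithTop ℕ∞} (hz : 0 < xnorm n ℓ z) :
    ContDiffAt ℝ k (coneFn n ℓ α) z := by
  have h : coneFn n ℓ α = fun z => α * ‖xproj n ℓ z‖ := by
    funext z; rw [norm_xproj]; rfl
  rw [h]
  rw [← norm_xproj] at hz
  exact contDiffAt_const.mul ((xproj n ℓ).contDiff.contDiffAt.norm ℝ (norm_pos_iff.1 hz))

lemma hasFDerivAt_norm_xproj_sq (z : Euc (n + ℓ)) :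
    HasFDerivAt (fun y => ‖xproj n ℓ y‖ ^ 2)
      ((2:ℝ) • (innerSL ℝ (xproj n ℓ z)).comp (xproj n ℓ)) z := by
  have := (xproj n ℓ).hasFDerivAt (x := z) |>.norm_sq
  rw [ofNat_smul_eq_nsmul]
  simpa using this

lemma fderiv_norm_xproj_sq (z ξ : Euc (n + ℓ)) :
    fderiv ℝ (fun y => ‖xproj n ℓ y‖ ^ 2) z ξ = 2 * inner ℝ (xproj n ℓ z) (xproj n ℓ ξ) := by
  rw [(hasFDerivAt_norm_xproj_sq z).fderiv]; rfl

lemma D2_norm_xproj_sq (z ξ : Euc (n + ℓ)) :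
    D2 (fun y => ‖xproj n ℓ y‖ ^ 2) z ξ ξ = 2 * ‖xproj n ℓ ξ‖ ^ 2 := by
  set L : Euc (n + ℓ) →L[ℝ] Euc (n + ℓ) →L[ℝ] ℝ := (2:ℝ) •
    ((ContinuousLinearMap.compL ℝ (Euc (n + ℓ)) (Euc n) ℝ).flip (xproj n ℓ)).comp
      ((innerSL ℝ : Euc n →L[ℝ] Euc n →L[ℝ] ℝ).comp (xproj n ℓ)) with hL
  have h : HasFDerivAt (fun y : Euc (n + ℓ) => L y) L z := L.hasFDerivAt
  rw [D2_eq_of_hasFDerivAt (f' := fun y => L y)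
    (Eventually.of_forall fun y => hasFDerivAt_norm_xproj_sq y) h]
  change 2 * inner ℝ (xproj n ℓ ξ) (xproj n ℓ ξ) = _
  rw [real_inner_self_eq_norm_sq]

lemma fderiv_coneFn (α : ℝ) {z : Euc (n + ℓ)} (hz : 0 < xnorm n ℓ z) (ξ : Euc (n + ℓ)) :
    fderiv ℝ (coneFn n ℓ α) z ξ = α / xnorm n ℓ z * inner ℝ (xproj n ℓ z) (xproj n ℓ ξ) := by
  rw [← norm_xproj] at hz ⊢
  have h1 := (Real.hasDerivAt_sqrt (pow_pos hz 2).ne').comp_hasFDerivAt z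
    (hasFDerivAt_norm_xproj_sq z) |>.const_mul α
  rw [Real.sqrt_sq hz.le] at h1
  have h2 : HasFDerivAt (coneFn n ℓ α) _ z := (coneFn_eq (n := n) (ℓ := ℓ) α) ▸ h1
  rw [h2.fderiv]
  change α * (1 / (2 * ‖xproj n ℓ z‖) * (2 * inner ℝ (xproj n ℓ z) (xproj n ℓ ξ))) = _
  field_simp

lemma D2_coneFn (α : ℝ) {z : Euc (n + ℓ)} (hz : 0 < xnorm n ℓ z) (ξ : Euc (n + ℓ)) :
    D2 (coneFn n ℓ α) z ξ ξ = α / xnorm n ℓ z * (‖xproj n ℓ ξ‖ ^ 2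
      - inner ℝ (xproj n ℓ z) (xproj n ℓ ξ) ^ 2 / xnorm n ℓ z ^ 2) := by
  rw [← norm_xproj] at hz ⊢
  have hs : 0 < ‖xproj n ℓ z‖ ^ 2 := pow_pos hz 2
  have hg : ∀ᶠ t in 𝓝 (‖xproj n ℓ z‖ ^ 2),
      HasDerivAt (fun t => α * √t) ((fun t => α * (1 / (2 * √t))) t) t := by
    filter_upwards [lt_mem_nhds hs] with t ht
    exact (Real.hasDerivAt_sqrt ht.ne').const_mul α
  have hg' : HasDerivAt (fun t => α * (1 / (2 * √t)))
      (-(α / (4 * ‖xproj n ℓ z‖ ^ 3))) (‖xproj n ℓ z‖ ^ 2) := by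
    have h1 := ((Real.hasDerivAt_sqrt hs.ne').const_mul 2)
    have h2 := (h1.fun_inv (by rw [Real.sqrt_sq hz.le]; positivity)).const_mul α
    simp only [one_div]
    refine h2.congr_deriv ?_
    rw [Real.sqrt_sq hz.le]
    field_simp
    ring
  have hf : ContDiffAt ℝ 2 (fun y => ‖xproj n ℓ y‖ ^ 2) z :=
    ((xproj n ℓ).contDiff.norm_sq ℝ).contDiffAt
  rw [coneFn_eq, D2_comp_self hf hg hg' ξ, D2_norm_xproj_sq, fderiv_norm_xproj_sq,
    Real.sqrt_sq hz.le]
  field_simp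
  ring

lemma D2_coneFn_self (α : ℝ) {z : Euc (n + ℓ)} (hz : 0 < xnorm n ℓ z) :
    D2 (coneFn n ℓ α) z z z = 0 := by
  rw [D2_coneFn α hz, real_inner_self_eq_norm_sq, norm_xproj]
  field_simp
  ring

lemma D2_coneFn_le {α : ℝ} (hα : 0 ≤ α) {z : Euc (n + ℓ)} (hz : 0 < xnorm n ℓ z)
    (ξ : Euc (n + ℓ)) : D2 (coneFn n ℓ α) z ξ ξ ≤ α / xnorm n ℓ z * ‖ξ‖ ^ 2 := by
  rw [D2_coneFn α hz]
  have h1 : 0 ≤ inner ℝ (xproj n ℓ z) (xproj n ℓ ξ) ^ 2 / xnorm n ℓ z ^ 2 := by positivity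
  have h2 : ‖xproj n ℓ ξ‖ ^ 2 ≤ ‖ξ‖ ^ 2 := by gcongr; exact norm_xproj_le ξ
  gcongr
  linarith

lemma norm_fderiv_coneFn_le {α : ℝ} (hα : 0 ≤ α) {z : Euc (n + ℓ)} (hz : 0 < xnorm n ℓ z) :
    ‖fderiv ℝ (coneFn n ℓ α) z‖ ≤ α := by
  refine ContinuousLinearMap.opNorm_le_bound _ hα fun ξ => ?_
  rw [fderiv_coneFn α hz, Real.norm_eq_abs, abs_mul, abs_of_nonneg (by positivity)]
  have h1 := abs_real_inner_le_norm (xproj n ℓ z) (xproj n ℓ ξ)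
  have h2 := norm_xproj_le ξ
  rw [norm_xproj z] at h1
  calc _ ≤ α / xnorm n ℓ z * (xnorm n ℓ z * ‖ξ‖) := by
        gcongr; exact h1.trans (by gcongr)
    _ = _ := by field_simp

lemma gradient_coneFn (α : ℝ) {z : Euc (n + ℓ)} (hz : 0 < xnorm n ℓ z) :
    gradient (coneFn n ℓ α) z
      = (α / xnorm n ℓ z) • ContinuousLinearMap.adjoint (xproj n ℓ) (xproj n ℓ z) := by
  refine ext_inner_right ℝ fun ξ => ?_
  rw [inner_gradient, fderiv_coneFn α hz, real_inner_smul_left,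
    ContinuousLinearMap.adjoint_inner_left]

lemma D2_coneFn_gradient_add (α : ℝ) {z : Euc (n + ℓ)} (hz : 0 < xnorm n ℓ z)
    (η : Euc (n + ℓ)) :
    D2 (coneFn n ℓ α) z (gradient (coneFn n ℓ α) z + η) (gradient (coneFn n ℓ α) z + η)
      = D2 (coneFn n ℓ α) z η η := by
  rw [D2_coneFn α hz, D2_coneFn α hz, map_add, gradient_coneFn α hz, map_smul, xproj_adjoint,
    norm_add_sq_real, inner_add_right, real_inner_smul_left, real_inner_smul_right,
    real_inner_self_eq_norm_sq, norm_smul, mul_pow, norm_xproj z, Real.norm_eq_abs, sq_abs]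
  field_simp
  ring

lemma opE_coneFn (α : ℝ) {z : Euc (n + ℓ)} (hz : 0 < xnorm n ℓ z) (η : Euc (n + ℓ)) :
    opE (gradient (coneFn n ℓ α) z + η) (fun ξ => D2 (coneFn n ℓ α) z ξ ξ)
      = (1 + ‖gradient (coneFn n ℓ α) z + η‖ ^ 2) * (α * (n - 1) / xnorm n ℓ z)
        - D2 (coneFn n ℓ α) z η η := by
  rw [opE, D2_coneFn_gradient_add α hz]
  congr 2
  simp only [D2_coneFn α hz]
  rw [← Finset.mul_sum, Finset.sum_sub_distrib, ← Finset.sum_div, sum_norm_xproj_sq,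
    sum_inner_xproj_sq, norm_xproj]
  field_simp

end cone

section solutions

variable {N : ℕ}

lemma pd_eq_gradient (u : Euc N → ℝ) (i : Fin N) (z : Euc N) : pd u i z = gradient u z i := by
  rw [pd, ← inner_gradient, EuclideanSpace.inner_single_right]
  simp

lemma pd2_eq_D2 {u : Euc N → ℝ} {z : Euc N} (hu : ContDiffAt ℝ 2 u z) (i j : Fin N) :
    pd2 u i j z = D2 u z (EuclideanSpace.single i 1) (EuclideanSpace.single j 1) := by
  have h := (hasFDerivAt_fderiv hu).clm_apply
    (hasFDerivAt_const (EuclideanSpace.single j (1:ℝ) : Euc N) z)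
  unfold pd2
  simp only [pd]
  rw [h.fderiv]
  simp

lemma gradSq_eq (u : Euc N → ℝ) (z : Euc N) : gradSq u z = ‖gradient u z‖ ^ 2 := by
  rw [gradSq, norm_sq_eq_sum]
  simp only [pd_eq_gradient]

lemma solE_of_smeM {m : ℕ} {u : Euc N → ℝ} {z : Euc N} (hu : ContDiffAt ℝ 2 u z)
    (h : smeM m u z = 0) : SolE ((m : ℝ) - 1) u z := by
  have hp : 0 < 1 + ‖gradient u z‖ ^ 2 := by positivity
  unfold smeM at h
  simp only [gradSq_eq, pd_eq_gradient, pd2_eq_D2 hu] at h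
  have h1 : ∑ i, ∑ j, (gradient u z i * gradient u z j / (1 + ‖gradient u z‖ ^ 2))
      * D2 u z (EuclideanSpace.single i 1) (EuclideanSpace.single j 1)
      = D2 u z (gradient u z) (gradient u z) / (1 + ‖gradient u z‖ ^ 2) := by
    rw [apply_eq_sum (D2 u z) (gradient u z) (gradient u z), Finset.sum_div]
    refine Finset.sum_congr rfl fun i _ => ?_
    rw [Finset.sum_div]
    refine Finset.sum_congr rfl fun j _ => ?_
    ring
  rw [h1] at h
  have h2 : ((m : ℝ) - 1) / u z = ∑ i, D2 u z (EuclideanSpace.single i 1) (EuclideanSpace.single i 1)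
      - D2 u z (gradient u z) (gradient u z) / (1 + ‖gradient u z‖ ^ 2) := by linarith
  rw [SolE, opE, h2]
  field_simp

/-- Comparison at a point where a test function touches a solution from below. -/
lemma SolE.touching {κ : ℝ} {u v : Euc N → ℝ} {z : Euc N} (hu : ContDiffAt ℝ 2 u z)
    (hv : ContDiffAt ℝ 2 v z) (hs : SolE κ u z) (hmin : IsLocalMin (fun y => u y - v y) z)
    (heq : u z = v z) :
    opE (gradient v z) (fun ξ => D2 v z ξ ξ) ≤ (1 + ‖gradient v z‖ ^ 2) * (κ / v z) := by
  have h1 : fderiv ℝ u z = fderiv ℝ v z := by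
    have h2 := hmin.fderiv_eq_zero
    have h3 := ((hu.differentiableAt (by simp)).hasFDerivAt.sub
      (hv.differentiableAt (by simp)).hasFDerivAt).fderiv
    exact sub_eq_zero.1 (h3.symm.trans h2)
  have h2 : gradient u z = gradient v z := by rw [gradient, gradient, h1]
  have h3 := opE_mono (D2 v z) (D2 u z) (gradient u z) fun ξ => by
    have := hmin.D2_nonneg (hu.sub hv) ξ
    rw [D2_sub hu hv] at this
    have h4 : 0 ≤ D2 u z ξ ξ - D2 v z ξ ξ := this
    linarith
  rw [SolE] at hs
  rw [hs, h2, heq] at h3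
  exact h3

end solutions

section barrier

variable {n ℓ : ℕ}

lemma hasFDerivAt_bump (c z : Euc (n + ℓ)) (a t : ℝ) (k : ℕ) :
    HasFDerivAt (fun y => t * (a - ‖y - c‖ ^ 2) ^ (k + 2))
      ((-(2 * t * (k + 2) * (a - ‖z - c‖ ^ 2) ^ (k + 1))) • innerSL ℝ (z - c)) z := by
  have h1 := (hasDerivAt_pow (k + 2) (a - ‖z - c‖ ^ 2)).comp_hasFDerivAt z
    ((hasFDerivAt_normsq c z).const_sub a) |>.const_mul t
  refine h1.congr_fderiv ?_
  ext ξ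
  simp only [smul_apply, neg_apply, smul_eq_mul]
  push_cast
  ring

lemma contDiff_bump (c : Euc (n + ℓ)) (a t : ℝ) (k : ℕ) :
    ContDiff ℝ 2 (fun y => t * (a - ‖y - c‖ ^ 2) ^ (k + 2)) :=
  contDiff_const.mul ((contDiff_const.sub (contDiff_normsq c)).pow _)

lemma D2_bump (c z ξ : Euc (n + ℓ)) (a t : ℝ) (k : ℕ) :
    D2 (fun y => t * (a - ‖y - c‖ ^ 2) ^ (k + 2)) z ξ ξ
      = 4 * t * (k + 2) * (k + 1) * (a - ‖z - c‖ ^ 2) ^ k * (inner ℝ (z - c) ξ * inner ℝ (z - c) ξ)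
        - 2 * t * (k + 2) * (a - ‖z - c‖ ^ 2) ^ (k + 1) * ‖ξ‖ ^ 2 := by
  have hg : ∀ s : ℝ, HasDerivAt (fun s : ℝ => t * (a - s) ^ (k + 2))
      ((fun s : ℝ => -t * (k + 2) * (a - s) ^ (k + 1)) s) s := by
    intro s
    have := (((hasDerivAt_id s).const_sub a).pow (k + 2)).const_mul t
    refine this.congr_deriv ?_
    simp only [id, show k + 2 - 1 = k + 1 from rfl]
    push_cast
    ring
  have hg' : HasDerivAt (fun s : ℝ => -t * (k + 2) * (a - s) ^ (k + 1))
      (t * (k + 2) * (k + 1) * (a - ‖z - c‖ ^ 2) ^ k) (‖z - c‖ ^ 2) := by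
    have := (((hasDerivAt_id (‖z - c‖ ^ 2)).const_sub a).pow (k + 1)).const_mul (-t * (k + 2))
    refine this.congr_deriv ?_
    simp only [id, show k + 1 - 1 = k from rfl]
    push_cast
    ring
  have h1 := D2_comp_self (contDiff_normsq c).contDiffAt (z := z) (Eventually.of_forall hg) hg' ξ
  rw [h1, D2_normsq, fderiv_normsq]
  ring

/-- The inequality that must hold where `α|x| + t (a - |z-c|²)^(k+2)` touches a solution from
below, off the axis. -/
lemma SolE.bump_touching {κ α a t : ℝ} {u : Euc (n + ℓ) → ℝ} {z c : Euc (n + ℓ)} {k : ℕ}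
    (hα : 0 < α) (hακ : α ^ 2 * (n - 1) = κ) (hz : 0 < xnorm n ℓ z) (ht : 0 < t)
    (ha : 0 < a - ‖z - c‖ ^ 2)
    (hu : ContDiffAt ℝ 2 u z) (hs : SolE κ u z)
    (hmin : IsLocalMin (fun y => u y - (coneFn n ℓ α y + t * (a - ‖y - c‖ ^ 2) ^ (k + 2))) z)
    (heq : u z = coneFn n ℓ α z + t * (a - ‖z - c‖ ^ 2) ^ (k + 2)) :
    ∃ q : Euc (n + ℓ), ‖q‖ ≤ α + 2 * t * (k + 2) * (a - ‖z - c‖ ^ 2) ^ (k + 1) * ‖z - c‖ ∧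
      (1 + ‖q‖ ^ 2) * (κ * (a - ‖z - c‖ ^ 2) ^ 2
          / ((k + 2) * coneFn n ℓ α z * (coneFn n ℓ α z + t * (a - ‖z - c‖ ^ 2) ^ (k + 2))))
        + 4 * (k + 1) * ‖z - c‖ ^ 2 - 2 * (n + ℓ : ℕ) * (a - ‖z - c‖ ^ 2) * (1 + ‖q‖ ^ 2)
        - 4 * t * (k + 2) * (a - ‖z - c‖ ^ 2) ^ (k + 2) * D2 (coneFn n ℓ α) z (z - c) (z - c)
        ≤ 0 := by
  set Y := a - ‖z - c‖ ^ 2 with hY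
  have hψ := contDiffAt_coneFn α hz (k := 2)
  have hφ := (contDiff_bump c a t k).contDiffAt (x := z)
  have hψ0 : 0 < coneFn n ℓ α z := mul_pos hα hz
  have h1 := hs.touching hu (hψ.add hφ) hmin heq
  have hgr : gradient (fun y => coneFn n ℓ α y + t * (a - ‖y - c‖ ^ 2) ^ (k + 2)) z
      = gradient (coneFn n ℓ α) z + (-(2 * t * (k + 2) * Y ^ (k + 1))) • (z - c) := by
    refine ext_inner_right ℝ fun ξ => ?_
    have h2 : HasFDerivAt (fun y => coneFn n ℓ α y + t * (a - ‖y - c‖ ^ 2) ^ (k + 2)) _ z :=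
      (hψ.differentiableAt (by simp)).hasFDerivAt.add (hasFDerivAt_bump c z a t k)
    rw [inner_gradient, h2.fderiv, inner_add_left, inner_gradient,
      real_inner_smul_left]
    rfl
  have hD : D2 (fun y => coneFn n ℓ α y + t * (a - ‖y - c‖ ^ 2) ^ (k + 2)) z
      = D2 (coneFn n ℓ α) z + D2 (fun y => t * (a - ‖y - c‖ ^ 2) ^ (k + 2)) z := D2_add hψ hφ
  rw [hgr, hD] at h1
  set q := gradient (coneFn n ℓ α) z + (-(2 * t * (k + 2) * Y ^ (k + 1))) • (z - c) with hq
  refine ⟨q, ?_, ?_⟩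
  · refine (norm_add_le _ _).trans ?_
    rw [norm_gradient, norm_smul, norm_neg, Real.norm_of_nonneg (by positivity)]
    have := norm_fderiv_coneFn_le hα.le hz
    linarith
  have h3 : opE q (fun ξ => (D2 (coneFn n ℓ α) z
      + D2 (fun y => t * (a - ‖y - c‖ ^ 2) ^ (k + 2)) z) ξ ξ)
      = opE q (fun ξ => D2 (coneFn n ℓ α) z ξ ξ)
        + opE q (fun ξ => D2 (fun y => t * (a - ‖y - c‖ ^ 2) ^ (k + 2)) z ξ ξ) := by
    rw [← opE_add]; rfl
  rw [h3] at h1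
  simp only [D2_bump] at h1
  rw [opE_sub, opE_const_mul, opE_const_mul, opE_inner_mul, opE_norm_sq, hq, opE_coneFn α hz,
    ← hq, ← hY, map_smul, map_smul, smul_apply] at h1
  have h4 := symE_self_ge q (z - c)
  have h5 : α * (n - 1) / xnorm n ℓ z = κ / coneFn n ℓ α z := by
    rw [← hακ, coneFn]; field_simp
  rw [h5] at h1
  set S := D2 (coneFn n ℓ α) z (z - c) (z - c) with hS
  set P := coneFn n ℓ α z with hP
  simp only [smul_eq_mul] at h1
  have hv : 0 < P + t * Y ^ (k + 2) := by positivity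
  have h6 : (1 + ‖q‖ ^ 2) * (κ / P) - (1 + ‖q‖ ^ 2) * (κ / (P + t * Y ^ (k + 2)))
      = t * (k + 2) * Y ^ k
        * ((1 + ‖q‖ ^ 2) * (κ * Y ^ 2 / ((k + 2) * P * (P + t * Y ^ (k + 2))))) := by
    field_simp
    ring
  have hpos : 0 < t * (k + 2) * Y ^ k := by positivity
  have h7 : 4 * t * (k + 2) * (k + 1) * Y ^ k * ‖z - c‖ ^ 2
      ≤ 4 * t * (k + 2) * (k + 1) * Y ^ k * symE q (z - c) (z - c) := by gcongr
  have h8 : 2 * t * (k + 2) * Y ^ (k + 1) * (((n + ℓ : ℕ) : ℝ) * (1 + ‖q‖ ^ 2) - ‖q‖ ^ 2)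
      ≤ 2 * t * (k + 2) * Y ^ (k + 1) * ((n + ℓ : ℕ) * (1 + ‖q‖ ^ 2)) := by
    gcongr; linarith [sq_nonneg ‖q‖]
  refine le_of_mul_le_mul_left ?_ hpos
  rw [mul_zero]
  have h9 : t * (k + 2) * Y ^ k * ((1 + ‖q‖ ^ 2) * (κ * Y ^ 2 / ((k + 2) * P * (P + t * Y ^ (k + 2))))
      + 4 * (k + 1) * ‖z - c‖ ^ 2 - 2 * (n + ℓ : ℕ) * Y * (1 + ‖q‖ ^ 2)
      - 4 * t * (k + 2) * Y ^ (k + 2) * S)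
      = t * (k + 2) * Y ^ k
        * ((1 + ‖q‖ ^ 2) * (κ * Y ^ 2 / ((k + 2) * P * (P + t * Y ^ (k + 2)))))
        + 4 * t * (k + 2) * (k + 1) * Y ^ k * ‖z - c‖ ^ 2
        - 2 * t * (k + 2) * Y ^ (k + 1) * ((n + ℓ : ℕ) * (1 + ‖q‖ ^ 2))
        - (2 * t * (k + 2) * Y ^ (k + 1)) ^ 2 * S := by ring
  rw [h9, ← h6]
  have h10 : -(2 * t * (k + 2) * Y ^ (k + 1)) * (-(2 * t * (k + 2) * Y ^ (k + 1)) * S)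
      = (2 * t * (k + 2) * Y ^ (k + 1)) ^ 2 * S := by ring
  rw [h10] at h1
  linarith

end barrier

section comparison

lemma exists_touching {X : Type*} [TopologicalSpace X] {K : Set X} (hK : IsCompact K)
    {w φ : X → ℝ} (hw : ContinuousOn w K) (hφ : ContinuousOn φ K) (hw0 : ∀ z ∈ K, 0 < w z)
    {T : ℝ} (hT : 0 < T) :
    (∀ z ∈ K, T * φ z ≤ w z) ∨
      ∃ z1 ∈ K, ∃ t, 0 < t ∧ t < T ∧ 0 < φ z1 ∧ w z1 = t * φ z1 ∧ ∀ z ∈ K, t * φ z ≤ w z := by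
  by_contra! h
  obtain ⟨⟨z, hz, hlt⟩, h2⟩ := h
  obtain ⟨z1, hz1, hmax⟩ := hK.exists_isMaxOn ⟨z, hz⟩
    (hφ.div hw fun y hy => (hw0 y hy).ne')
  have hm : ∀ y ∈ K, φ y / w y ≤ φ z1 / w z1 := hmax
  have h1 : 1 / T < φ z / w z := by
    rw [div_lt_div_iff₀ hT (hw0 z hz)]; linarith
  have h3 : 1 / T < φ z1 / w z1 := h1.trans_le (hm z hz)
  have hφ1 : 0 < φ z1 := by
    by_contra! hcon
    have := div_nonpos_of_nonpos_of_nonneg hcon (hw0 z1 hz1).le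
    have : 0 < 1 / T := by positivity
    linarith
  have hw1 := hw0 z1 hz1
  obtain ⟨y, hy, hlt'⟩ := h2 z1 hz1 (w z1 / φ z1) (by positivity)
    (by
      rw [div_lt_div_iff₀ hT hw1] at h3
      rw [div_lt_iff₀ hφ1]; linarith) hφ1 (by field_simp)
  have h4 := hm y hy
  rw [div_le_div_iff₀ (hw0 y hy) hw1] at h4
  rw [div_mul_eq_mul_div, lt_div_iff₀ hφ1] at hlt'
  linarith

variable {n m ℓ : ℕ}

lemma alpha0_pos (hn : 3 ≤ n) (hm : 2 ≤ m) : 0 < alpha0 n m := by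
  have h1 : (3:ℝ) ≤ n := by exact_mod_cast hn
  have h2 : (2:ℝ) ≤ m := by exact_mod_cast hm
  exact Real.sqrt_pos.2 (div_pos (by linarith) (by linarith))

lemma alpha0_sq_mul (hn : 3 ≤ n) (hm : 2 ≤ m) : alpha0 n m ^ 2 * ((n:ℝ) - 1) = (m:ℝ) - 1 := by
  have h1 : (3:ℝ) ≤ n := by exact_mod_cast hn
  have h2 : (2:ℝ) ≤ m := by exact_mod_cast hm
  have h3 : (0:ℝ) < (n:ℝ) - 1 := by linarith
  rw [alpha0, Real.sq_sqrt (div_nonneg (by linarith) h3.le)]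
  field_simp

lemma coneFn_nonneg {α : ℝ} (hα : 0 ≤ α) (z : Euc (n + ℓ)) : 0 ≤ coneFn n ℓ α z :=
  mul_nonneg hα (xnorm_nonneg z)

section memS

variable {u : Euc (n + ℓ) → ℝ} {z : Euc (n + ℓ)}

lemma memS.contDiffAt (h : memS n m ℓ u) (hz : z ∈ Metric.ball 0 1) : ContDiffAt ℝ 2 u z :=
  h.1.contDiffAt (Metric.isOpen_ball.mem_nhds hz)

lemma memS.solE (h : memS n m ℓ u) (hz : z ∈ Metric.ball 0 1) : SolE ((m:ℝ) - 1) u z :=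
  solE_of_smeM (h.contDiffAt hz) (h.2.1 z hz)

lemma memS.sub_pos (h : memS n m ℓ u) (hz : z ∈ Metric.ball 0 1) :
    0 < u z - coneFn n ℓ (alpha0 n m) z := h.2.2 z hz

lemma memS.pos (h : memS n m ℓ u) (hz : z ∈ Metric.ball 0 1) : 0 < u z := by
  have h1 := h.sub_pos hz
  have h0 : 0 ≤ alpha0 n m := Real.sqrt_nonneg _
  have h2 := coneFn_nonneg h0 z
  linarith

end memS

lemma continuous_xnorm : Continuous (xnorm n ℓ) := by
  have : xnorm n ℓ = fun z => ‖xproj n ℓ z‖ := by funext z; exact (norm_xproj z).symm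
  rw [this]; exact (xproj n ℓ).continuous.norm

lemma continuous_coneFn (α : ℝ) : Continuous (coneFn n ℓ α) := continuous_xnorm.const_mul α

lemma memS.continuousOn_sub {u : Euc (n + ℓ) → ℝ} (h : memS n m ℓ u) :
    ContinuousOn (fun z => u z - coneFn n ℓ (alpha0 n m) z) (Metric.ball 0 1) :=
  h.1.continuousOn.sub (continuous_coneFn _).continuousOn

lemma isLocalMin_of_touching {K : Set (Euc (n + ℓ))} {u ψ φ : Euc (n + ℓ) → ℝ} {z1 : Euc (n + ℓ)}
    {t : ℝ} (hK : K ∈ 𝓝 z1) (heq : u z1 - ψ z1 = t * φ z1)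
    (hle : ∀ z ∈ K, t * φ z ≤ u z - ψ z) :
    IsLocalMin (fun y => u y - (ψ y + t * φ y)) z1 := by
  filter_upwards [hK] with y hy
  have := hle y hy
  linarith

lemma hopf (hn : 3 ≤ n) (hm : 2 ≤ m) {c : Euc (n + ℓ)} {R ρ δ : ℝ} (hR : 0 < R) (hR1 : R ≤ 1)
    (hball : Metric.closedBall c R ⊆ Metric.ball 0 1)
    (hx : ∀ z ∈ Metric.closedBall c R, 0 < xnorm n ℓ z) (hρ : 0 < ρ) (hδ : 0 < δ) :
    ∃ T : ℝ, 0 < T ∧ ∃ k : ℕ, ∀ u, memS n m ℓ u →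
      (∀ z ∈ Metric.ball c ρ, z ∈ Metric.closedBall c R → δ ≤ u z - coneFn n ℓ (alpha0 n m) z) →
      ∀ z ∈ Metric.closedBall c R,
        T * (R ^ 2 - ‖z - c‖ ^ 2) ^ (k + 2) ≤ u z - coneFn n ℓ (alpha0 n m) z := by
  set α := alpha0 n m with hα
  have hα0 : 0 < α := alpha0_pos hn hm
  have hακ := alpha0_sq_mul hn hm
  have hκ0 : (0:ℝ) ≤ (m:ℝ) - 1 := by rw [← hακ]; have : (3:ℝ) ≤ n := by exact_mod_cast hn
                                     exact mul_nonneg (sq_nonneg _) (by linarith)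
  have hc : c ∈ Metric.closedBall c R := Metric.mem_closedBall_self hR.le
  obtain ⟨z2, hz2, hmin⟩ := (isCompact_closedBall c R).exists_isMinOn ⟨c, hc⟩
    continuous_xnorm.continuousOn
  have hc0 := hx z2 hz2
  set c0 := xnorm n ℓ z2
  have hmin' : ∀ z ∈ Metric.closedBall c R, c0 ≤ xnorm n ℓ z := hmin
  obtain ⟨k, hk⟩ := exists_nat_gt
    ((2 * (n + ℓ : ℕ) * (1 + (α + 2) ^ 2) + 4 * (α / c0)) / (4 * ρ ^ 2))
  rw [div_lt_iff₀ (by positivity)] at hk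
  refine ⟨min δ (1 / (k + 2)), by positivity, k, fun u hu hw => ?_⟩
  rcases exists_touching (isCompact_closedBall c R) (hu.continuousOn_sub.mono hball)
    (φ := fun z => (R ^ 2 - ‖z - c‖ ^ 2) ^ (k + 2)) (by fun_prop)
    (fun z hz => hu.sub_pos (hball hz)) (T := min δ (1 / (k + 2))) (by positivity) with h | h
  · exact h
  exfalso
  obtain ⟨z1, hz1, t, ht, htT, hφ, heq, hle⟩ := h
  have hs : ‖z1 - c‖ ≤ R := by rwa [mem_closedBall_iff_norm] at hz1
  have hs0 := norm_nonneg (z1 - c)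
  have hY0 : 0 ≤ R ^ 2 - ‖z1 - c‖ ^ 2 := by
    have : ‖z1 - c‖ ^ 2 ≤ R ^ 2 := by gcongr
    linarith
  have hY : 0 < R ^ 2 - ‖z1 - c‖ ^ 2 := by
    refine hY0.lt_of_ne fun h => ?_
    simp only [← h] at hφ
    simp at hφ
  have hY1 : R ^ 2 - ‖z1 - c‖ ^ 2 ≤ 1 := by
    have : R ^ 2 ≤ 1 := pow_le_one₀ hR.le hR1
    linarith [sq_nonneg ‖z1 - c‖]
  have htk : t * (k + 2) ≤ 1 := by
    have := htT.le.trans (min_le_right _ _)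
    rwa [le_div_iff₀ (by positivity)] at this
  have hsR : ‖z1 - c‖ < R := by
    by_contra! h
    have : R ^ 2 ≤ ‖z1 - c‖ ^ 2 := by gcongr
    linarith
  have hsρ : ρ ≤ ‖z1 - c‖ := by
    by_contra! h
    have h1 := hw z1 (mem_ball_iff_norm.2 h) hz1
    rw [heq] at h1
    have h2 : (R ^ 2 - ‖z1 - c‖ ^ 2) ^ (k + 2) ≤ 1 := pow_le_one₀ hY0 hY1
    have h3 : t * (R ^ 2 - ‖z1 - c‖ ^ 2) ^ (k + 2) ≤ t := mul_le_of_le_one_right ht.le h2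
    have h4 := htT.trans_le (min_le_left _ _)
    linarith
  have hnh : Metric.closedBall c R ∈ 𝓝 z1 :=
    Filter.mem_of_superset (Metric.isOpen_ball.mem_nhds (mem_ball_iff_norm.2 hsR))
      Metric.ball_subset_closedBall
  obtain ⟨q, hq, hineq⟩ := (hu.solE (hball hz1)).bump_touching (c := c) (k := k) (a := R ^ 2)
    hα0 hακ (hx z1 hz1) ht hY (hu.contDiffAt (hball hz1))
    (isLocalMin_of_touching (φ := fun z => (R ^ 2 - ‖z - c‖ ^ 2) ^ (k + 2)) hnh heq hle)
    (by linarith)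
  have hS := D2_coneFn_le hα0.le (hx z1 hz1) (z1 - c)
  have hψ0 : 0 < coneFn n ℓ α z1 := mul_pos hα0 (hx z1 hz1)
  set Y := R ^ 2 - ‖z1 - c‖ ^ 2 with hYd
  set s := ‖z1 - c‖ with hsd
  set S := D2 (coneFn n ℓ α) z1 (z1 - c) (z1 - c) with hSd
  have hs1 : s ≤ 1 := hs.trans hR1
  have hq2 : ‖q‖ ≤ α + 2 := by
    refine hq.trans ?_
    have h1 : Y ^ (k + 1) * s ≤ 1 := mul_le_one₀ (pow_le_one₀ hY0 hY1) hs0 hs1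
    have h2 : t * (k + 2) * (Y ^ (k + 1) * s) ≤ 1 := mul_le_one₀ htk (by positivity) h1
    linarith
  have hA : 0 ≤ (1 + ‖q‖ ^ 2) * (((m:ℝ) - 1) * Y ^ 2
      / ((k + 2) * coneFn n ℓ α z1 * (coneFn n ℓ α z1 + t * Y ^ (k + 2)))) := by positivity
  have hB : 2 * (n + ℓ : ℕ) * Y * (1 + ‖q‖ ^ 2) ≤ 2 * (n + ℓ : ℕ) * 1 * (1 + (α + 2) ^ 2) := by
    gcongr
  have hS2 : S ≤ α / c0 := by
    refine hS.trans ?_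
    calc α / xnorm n ℓ z1 * s ^ 2 ≤ α / c0 * 1 := by
          gcongr
          · exact hmin' z1 hz1
          · exact pow_le_one₀ hs0 hs1
      _ = _ := mul_one _
  have hC : t * (k + 2) * Y ^ (k + 2) * S ≤ α / c0 := by
    have h1 : t * (k + 2) * Y ^ (k + 2) ≤ 1 :=
      mul_le_one₀ htk (by positivity) (pow_le_one₀ hY0 hY1)
    have h0 : 0 ≤ t * (k + 2) * Y ^ (k + 2) := by positivity
    calc _ ≤ t * (k + 2) * Y ^ (k + 2) * (α / c0) := by gcongr
      _ ≤ 1 * (α / c0) := by gcongr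
      _ = _ := one_mul _
  have hD : 4 * ((k:ℝ) + 1) * ρ ^ 2 ≤ 4 * (k + 1) * s ^ 2 := by gcongr
  have hρ2 : 0 < ρ ^ 2 := by positivity
  linarith

end comparison

section axis

variable {n m ℓ : ℕ}

lemma not_isLocalMin_sub_coneFn_of_xnorm_eq_zero {α : ℝ} (hα : 0 < α) (hn : 1 ≤ n)
    {f : Euc (n + ℓ) → ℝ} {z : Euc (n + ℓ)} (hf : DifferentiableAt ℝ f z)
    (hz : xnorm n ℓ z = 0) : ¬ IsLocalMin (fun y => f y - coneFn n ℓ α y) z := by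
  intro h
  set i0 : Fin n := ⟨0, hn⟩
  set L : Euc (n + ℓ) →L[ℝ] ℝ := EuclideanSpace.proj (Fin.castAdd ℓ i0) with hL
  have hLx : ∀ y, |L y| ≤ xnorm n ℓ y := fun y => by
    rw [← norm_xproj, ← Real.norm_eq_abs]
    exact PiLp.norm_apply_le (xproj n ℓ y) i0
  have hLz : L z = 0 := by
    have := hLx z
    rw [hz] at this
    exact abs_nonpos_iff.1 this
  have h1 : IsLocalMin f z := by
    filter_upwards [h] with y hy
    have := coneFn_nonneg hα.le y
    simp only [coneFn, hz] at hy this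
    linarith
  have h2 : IsLocalMin (fun y => f y - α * L y) z := by
    filter_upwards [h] with y hy
    have := mul_le_mul_of_nonneg_left ((le_abs_self _).trans (hLx y)) hα.le
    simp only [coneFn, hz] at hy
    simp only [hLz]
    linarith
  have e1 := h1.fderiv_eq_zero
  have h3 : HasFDerivAt (fun y => f y - α * L y) (fderiv ℝ f z - α • L) z :=
    hf.hasFDerivAt.sub (L.hasFDerivAt.const_mul α)
  have e2 := h2.hasFDerivAt_eq_zero h3
  have e3 := congrArg (fun A : Euc (n + ℓ) →L[ℝ] ℝ =>
    A (EuclideanSpace.single (Fin.castAdd ℓ i0) 1)) e2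
  rw [e1] at e3
  have e4 : L (EuclideanSpace.single (Fin.castAdd ℓ i0) 1) = 1 := by simp [hL]
  have e5 : (0:ℝ) - α * L (EuclideanSpace.single (Fin.castAdd ℓ i0) 1) = 0 := e3
  rw [e4] at e5
  linarith

lemma axis_contra {κ α N y0 δ1 Y s q ψ t : ℝ} (hα : 0 < α) (hN : 1 ≤ N) (hκ : 0 < κ)
    (ht : 0 < t) (ht1 : t ≤ 1) (hY : 0 < Y) (hYs : Y = 1 / 4 - s ^ 2) (hs : 0 < s) (hs1 : s ≤ 1 / 2)
    (hq0 : 0 ≤ q) (hq : q ≤ α + 2 * t * 2 * Y * s) (hψ : 0 < ψ) (hψ1 : ψ ≤ α * δ1)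
    (hδ1 : δ1 ≤ 1 / 2) (hy8 : y0 ≤ 1 / 8) (hyN : y0 * (8 * N * (1 + (α + 2) ^ 2)) ≤ 1)
    (hδ : δ1 * (4 * N * α * (α + 1)) ≤ κ * y0)
    (hle : (1 + q ^ 2) * (κ * Y ^ 2 / (2 * ψ * (ψ + t * Y ^ 2))) + 4 * s ^ 2
      - 2 * N * Y * (1 + q ^ 2) ≤ 0) : False := by
  have hY1 : Y ≤ 1 / 4 := by linarith [sq_nonneg s]
  have hP : 0 < 1 + q ^ 2 := by positivity
  have htY : t * Y ^ 2 ≤ 1 := mul_le_one₀ ht1 (by positivity) (pow_le_one₀ hY.le (by linarith))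
  have hq2 : q ≤ α + 2 := by
    have h1 : t * Y ≤ 1 := mul_le_one₀ ht1 hY.le (by linarith)
    have h2 : t * Y * s ≤ 1 * (1 / 2) := by gcongr
    linarith
  have hPQ : 1 + q ^ 2 ≤ 1 + (α + 2) ^ 2 := by gcongr
  rcases lt_or_ge Y y0 with h | h
  · have hA : 0 ≤ (1 + q ^ 2) * (κ * Y ^ 2 / (2 * ψ * (ψ + t * Y ^ 2))) := by positivity
    have h1 : Y * (8 * N * (1 + q ^ 2)) ≤ y0 * (8 * N * (1 + (α + 2) ^ 2)) := by
      have := hY.trans h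
      gcongr
    linarith
  · have h1 : ψ * (ψ + t * Y ^ 2) ≤ α * δ1 * (α + 1) := by
      have : ψ + t * Y ^ 2 ≤ α + 1 := by
        have : α * δ1 ≤ α * 1 := by gcongr; linarith
        linarith
      have h0 := hψ.le.trans hψ1
      gcongr
    have h2 : 2 * N * Y ≤ κ * Y ^ 2 / (2 * ψ * (ψ + t * Y ^ 2)) := by
      rw [le_div_iff₀ (by positivity)]
      have h3 : 4 * N * Y * (ψ * (ψ + t * Y ^ 2)) ≤ 4 * N * Y * (α * δ1 * (α + 1)) := by gcongr
      have h4 : Y * (δ1 * (4 * N * α * (α + 1))) ≤ Y * (κ * y0) := by gcongr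
      have h5 : Y * (κ * y0) ≤ Y * (κ * Y) := by gcongr
      linarith
    have h6 : (1 + q ^ 2) * (2 * N * Y) ≤
      (1 + q ^ 2) * (κ * Y ^ 2 / (2 * ψ * (ψ + t * Y ^ 2))) := by gcongr
    have h7 : 0 < s ^ 2 := by positivity
    linarith

lemma axis_barrier (hn : 3 ≤ n) (hm : 2 ≤ m) :
    ∃ δ1 ∈ Ioc (0:ℝ) (1 / 2), ∀ δ2 > 0, ∃ η > 0, ∀ u, memS n m ℓ u →
      (∀ z, ‖z‖ ≤ 1 / 2 → xnorm n ℓ z = δ1 → δ2 ≤ u z - coneFn n ℓ (alpha0 n m) z) →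
      η ≤ u 0 := by
  set α := alpha0 n m with hα
  have hα0 : 0 < α := alpha0_pos hn hm
  have hακ := alpha0_sq_mul hn hm
  have hn3 : (3:ℝ) ≤ n := by exact_mod_cast hn
  have hκ0 : (0:ℝ) < (m:ℝ) - 1 := by
    rw [← hακ]; exact mul_pos (pow_pos hα0 2) (by linarith)
  have hN : (1:ℝ) ≤ ((n + ℓ : ℕ) : ℝ) := by exact_mod_cast (by omega : 1 ≤ n + ℓ)
  set N : ℝ := ((n + ℓ : ℕ) : ℝ) with hNd
  have hN0 : 0 < N := by linarith
  set κ : ℝ := (m:ℝ) - 1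
  set y0 : ℝ := min (1 / 8) (1 / (8 * N * (1 + (α + 2) ^ 2))) with hy0
  have hy0p : 0 < y0 := by positivity
  have hy8 : y0 ≤ 1 / 8 := min_le_left _ _
  have hyN : y0 * (8 * N * (1 + (α + 2) ^ 2)) ≤ 1 := by
    rw [← le_div_iff₀ (by positivity)]; exact min_le_right _ _
  set δ1 : ℝ := min (1 / 2) (κ * y0 / (4 * N * α * (α + 1))) with hδ1
  have hδ1p : 0 < δ1 := by positivity
  have hδ12 : δ1 ≤ 1 / 2 := min_le_left _ _
  have hδN : δ1 * (4 * N * α * (α + 1)) ≤ κ * y0 := by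
    rw [← le_div_iff₀ (by positivity)]; exact min_le_right _ _
  refine ⟨δ1, ⟨hδ1p, hδ12⟩, fun δ2 hδ2 => ⟨min 1 δ2 / 16, by positivity, fun u hu hw => ?_⟩⟩
  set K : Set (Euc (n + ℓ)) := Metric.closedBall 0 (1 / 2) ∩ {z | xnorm n ℓ z ≤ δ1} with hK
  have hKc : IsCompact K := (isCompact_closedBall _ _).inter_right
    (isClosed_le continuous_xnorm continuous_const)
  have hKb : K ⊆ Metric.ball 0 1 := fun z hz =>
    Metric.closedBall_subset_ball (by norm_num) hz.1
  rcases exists_touching hKc (hu.continuousOn_sub.mono hKb)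
    (φ := fun z => (1 / 4 - ‖z - 0‖ ^ 2) ^ (0 + 2)) (by fun_prop)
    (fun z hz => hu.sub_pos (hKb hz)) (T := min 1 δ2) (by positivity) with h | h
  · have h0 : (0 : Euc (n + ℓ)) ∈ K := by
      refine ⟨by simp, ?_⟩
      change xnorm n ℓ 0 ≤ δ1
      rw [← norm_xproj, map_zero, norm_zero]; exact hδ1p.le
    have h1 := h 0 h0
    have h2 : coneFn n ℓ α 0 = 0 := by
      rw [coneFn, ← norm_xproj, map_zero, norm_zero, mul_zero]
    rw [h2] at h1
    simp only [sub_zero, norm_zero] at h1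
    norm_num at h1
    linarith
  exfalso
  obtain ⟨z1, hz1, t, ht, htT, hφ, heq, hle⟩ := h
  have hs : ‖z1‖ ≤ 1 / 2 := mem_closedBall_zero_iff.1 hz1.1
  have hs0 := norm_nonneg z1
  have hY0 : 0 ≤ 1 / 4 - ‖z1 - 0‖ ^ 2 := by
    rw [sub_zero]
    have : ‖z1‖ ^ 2 ≤ (1 / 2) ^ 2 := by gcongr
    linarith
  have hY : 0 < 1 / 4 - ‖z1 - 0‖ ^ 2 := by
    refine hY0.lt_of_ne fun h => ?_
    simp only [← h] at hφ
    simp at hφ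
  have hsR : ‖z1‖ < 1 / 2 := by
    rw [sub_zero] at hY
    by_contra! h
    have : (1 / 2) ^ 2 ≤ ‖z1‖ ^ 2 := by gcongr
    linarith
  have ht1 : t ≤ 1 := htT.le.trans (min_le_left _ _)
  have hxδ : xnorm n ℓ z1 < δ1 := by
    refine lt_of_le_of_ne hz1.2 fun h => ?_
    have h1 := hw z1 hs h
    rw [heq] at h1
    have h2 : (1 / 4 - ‖z1 - 0‖ ^ 2) ^ (0 + 2) ≤ 1 :=
      pow_le_one₀ hY0 (by linarith [sq_nonneg ‖z1 - 0‖])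
    have h3 := mul_le_of_le_one_right ht.le h2
    have h4 := htT.trans_le (min_le_right _ _)
    linarith
  have hb1 : z1 ∈ Metric.ball (0 : Euc (n + ℓ)) 1 := hKb hz1
  have hnh : K ∈ 𝓝 z1 := by
    refine Filter.inter_mem ?_ ?_
    · exact Metric.closedBall_mem_nhds_of_mem (mem_ball_zero_iff.2 hsR)
    · filter_upwards [(isOpen_lt continuous_xnorm continuous_const).mem_nhds hxδ] with y hy
      exact le_of_lt hy
  have hmin := isLocalMin_of_touching (φ := fun z => (1 / 4 - ‖z - 0‖ ^ 2) ^ (0 + 2)) hnh heq hle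
  have hx0 : 0 < xnorm n ℓ z1 := by
    refine (xnorm_nonneg z1).lt_of_ne fun h => ?_
    refine not_isLocalMin_sub_coneFn_of_xnorm_eq_zero hα0 (by omega)
      (f := fun y => u y - t * (1 / 4 - ‖y - 0‖ ^ 2) ^ (0 + 2)) (z := z1) ?_ h.symm ?_
    · refine ((hu.contDiffAt hb1).differentiableAt (by norm_num)).sub ?_
      exact (contDiff_bump 0 (1 / 4) t 0).differentiable (by norm_num) z1
    · filter_upwards [hmin] with y hy
      linarith
  obtain ⟨q, hq, hineq⟩ := (hu.solE hb1).bump_touching (c := 0) (k := 0) (a := 1 / 4)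
    hα0 hακ hx0 ht hY (hu.contDiffAt hb1) hmin (by linarith)
  simp only [sub_zero, Nat.cast_zero, zero_add, D2_coneFn_self α hx0, mul_zero, pow_one] at hq hineq
  rw [sub_zero] at hY
  have hzp : 0 < ‖z1‖ := hx0.trans_le (by rw [← norm_xproj]; exact norm_xproj_le z1)
  refine axis_contra (N := N) (y0 := y0) (ψ := coneFn n ℓ α z1) hα0 hN hκ0 ht ht1 hY rfl hzp hs
    (norm_nonneg q) hq (mul_pos hα0 hx0) (mul_le_mul_of_nonneg_left hxδ.le hα0.le) hδ12 hy8 hyN hδN ?_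
  linarith

end axis

section propagation

variable {n m ℓ : ℕ}

lemma xproj_surjective : Function.Surjective (xproj n ℓ) := fun a =>
  ⟨_, xproj_adjoint a⟩

lemma xnorm_smul {c : ℝ} (hc : 0 ≤ c) (z : Euc (n + ℓ)) :
    xnorm n ℓ (c • z) = c * xnorm n ℓ z := by
  rw [← norm_xproj, ← norm_xproj, map_smul, norm_smul, Real.norm_of_nonneg hc]

/-- The open unit ball with the axis `x = 0` removed. -/
def puncturedBall (n ℓ : ℕ) : Set (Euc (n + ℓ)) := Metric.ball 0 1 ∩ {z | 0 < xnorm n ℓ z}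

lemma isOpen_puncturedBall : IsOpen (puncturedBall n ℓ) :=
  Metric.isOpen_ball.inter (isOpen_lt continuous_const continuous_xnorm)

lemma isPreconnected_puncturedBall (hn : 2 ≤ n) : IsPreconnected (puncturedBall n ℓ) := by
  have h1 : IsPreconnected {z : Euc (n + ℓ) | 0 < xnorm n ℓ z} := by
    have hr : 1 < Module.rank ℝ (Euc (n + ℓ) ⧸ (xproj n ℓ : Euc (n + ℓ) →ₗ[ℝ] Euc n).ker) := by
      have e := (xproj n ℓ : Euc (n + ℓ) →ₗ[ℝ] Euc n).quotKerEquivOfSurjective xproj_surjective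
      rw [e.rank_eq, ← Module.finrank_eq_rank]
      have : 1 < Module.finrank ℝ (Euc n) := by simp; omega
      exact_mod_cast this
    convert (isConnected_compl_of_one_lt_codim hr).isPreconnected using 1
    ext z
    rw [mem_compl_iff, SetLike.mem_coe, LinearMap.mem_ker, mem_ofPred_eq, ← norm_xproj,
      norm_pos_iff]
    rfl
  have h2 := h1.image OpenPartialHomeomorph.univUnitBall
    (OpenPartialHomeomorph.univUnitBall.continuousOn.mono (subset_univ _))
  convert h2 using 1
  ext z
  constructor
  · rintro ⟨hz, hx⟩
    refine ⟨OpenPartialHomeomorph.univUnitBall.symm z, ?_,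
      OpenPartialHomeomorph.univUnitBall.right_inv hz⟩
    have h : 0 < 1 - ‖z‖ ^ 2 := by
      have := mem_ball_zero_iff.1 hz
      nlinarith [norm_nonneg z]
    have hx' : 0 < xnorm n ℓ z := hx
    change 0 < xnorm n ℓ ((√(1 - ‖z‖ ^ 2))⁻¹ • z)
    rw [xnorm_smul (by positivity)]
    positivity
  · rintro ⟨y, hy, rfl⟩
    refine ⟨OpenPartialHomeomorph.univUnitBall.map_source (mem_univ y), ?_⟩
    have hy' : 0 < xnorm n ℓ y := hy
    change 0 < xnorm n ℓ ((√(1 + ‖y‖ ^ 2))⁻¹ • y)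
    rw [xnorm_smul (by positivity)]
    positivity

/-- All members of the family `F` of solutions have a common positive lower bound for their height
above the cone near `z`. -/
def LowerBoundNear (m : ℕ) (F : Set (Euc (n + ℓ) → ℝ)) (z : Euc (n + ℓ)) : Prop :=
  ∃ δ > 0, ∃ ρ > 0, ∀ u ∈ F, ∀ y ∈ Metric.ball z ρ, y ∈ Metric.ball (0 : Euc (n + ℓ)) 1 →
    δ ≤ u y - coneFn n ℓ (alpha0 n m) y

lemma LowerBoundNear.step (hn : 3 ≤ n) (hm : 2 ≤ m) {F : Set (Euc (n + ℓ) → ℝ)}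
    (hF : ∀ u ∈ F, memS n m ℓ u) {c z : Euc (n + ℓ)} {R : ℝ} (hR : 0 < R) (hR1 : R ≤ 1)
    (hc : Metric.closedBall c R ⊆ puncturedBall n ℓ) (hz : dist z c < R)
    (h : LowerBoundNear m F c) : LowerBoundNear m F z := by
  obtain ⟨δ, hδ, ρ, hρ, hb⟩ := h
  obtain ⟨T, hT, k, hu⟩ := hopf hn hm (c := c) hR hR1 (fun y hy => (hc hy).1)
    (fun y hy => (hc hy).2) hρ hδ
  have hd0 : 0 ≤ dist z c := dist_nonneg
  set r := (R + dist z c) / 2 with hr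
  have hr1 : r < R := by linarith
  have hr0 : 0 ≤ r := by positivity
  have hpos : 0 < R ^ 2 - r ^ 2 := by
    have : r ^ 2 < R ^ 2 := by gcongr
    linarith
  refine ⟨T * (R ^ 2 - r ^ 2) ^ (k + 2), by positivity, (R - dist z c) / 2, by linarith,
    fun u hu' y hy _ => ?_⟩
  have hyc : ‖y - c‖ ≤ r := by
    rw [← dist_eq_norm]
    have := dist_triangle y z c
    have := Metric.mem_ball.1 hy
    linarith
  refine le_trans ?_ (hu u (hF u hu') (fun w hw hw' => hb u hu' w hw (hc hw').1) y
    (mem_closedBall_iff_norm.2 (hyc.trans hr1.le)))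
  gcongr

lemma LowerBoundNear.propagate (hn : 3 ≤ n) (hm : 2 ≤ m) {F : Set (Euc (n + ℓ) → ℝ)}
    (hF : ∀ u ∈ F, memS n m ℓ u) {c z : Euc (n + ℓ)} (hc : c ∈ puncturedBall n ℓ)
    (hz : z ∈ puncturedBall n ℓ) (h : LowerBoundNear m F c) : LowerBoundNear m F z := by
  refine ((isPreconnected_puncturedBall (by omega)).induction₂
    (fun x y => (LowerBoundNear m F x ↔ LowerBoundNear m F y)) ?_
    (fun _ _ _ _ _ _ h1 h2 => h1.trans h2) (fun _ _ _ _ h => h.symm) hc hz).1 h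
  intro x hx
  obtain ⟨ε, hε, hball⟩ := Metric.isOpen_iff.1 isOpen_puncturedBall x hx
  set R := min 1 (ε / 2) with hR
  have hR0 : 0 < R := by positivity
  have hR1 : R ≤ 1 := min_le_left _ _
  have hRε : R ≤ ε / 2 := min_le_right _ _
  filter_upwards [mem_nhdsWithin_of_mem_nhds (Metric.ball_mem_nhds x (half_pos hR0))] with y hy
  have hy' : dist y x < R / 2 := hy
  constructor
  · exact LowerBoundNear.step hn hm hF hR0 hR1
      (fun w hw => hball (Metric.mem_ball.2 ((Metric.mem_closedBall.1 hw).trans_lt (by linarith))))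
      (by linarith)
  · refine LowerBoundNear.step hn hm hF (half_pos hR0) (by linarith) (fun w hw => hball ?_)
      (by rwa [dist_comm])
    have h1 := dist_triangle w y x
    have h2 : dist w y ≤ R / 2 := hw
    exact Metric.mem_ball.2 (by linarith)

lemma LowerBoundNear.uniform {F : Set (Euc (n + ℓ) → ℝ)} {C : Set (Euc (n + ℓ))}
    (hC : IsCompact C) (hC1 : C ⊆ Metric.ball 0 1) (h : ∀ z ∈ C, LowerBoundNear m F z) :
    ∃ δ > 0, ∀ u ∈ F, ∀ z ∈ C, δ ≤ u z - coneFn n ℓ (alpha0 n m) z := by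
  have key : ∃ δ > 0, ∀ u ∈ F, ∀ z ∈ C, z ∈ Metric.ball (0 : Euc (n + ℓ)) 1 →
      δ ≤ u z - coneFn n ℓ (alpha0 n m) z := by
    refine hC.induction_on (p := fun s => ∃ δ > 0, ∀ u ∈ F, ∀ z ∈ s,
      z ∈ Metric.ball (0 : Euc (n + ℓ)) 1 → δ ≤ u z - coneFn n ℓ (alpha0 n m) z) ?_ ?_ ?_ ?_
    · exact ⟨1, one_pos, fun u _ z hz => absurd hz (notMem_empty z)⟩
    · rintro s t hst ⟨δ, hδ, h⟩
      exact ⟨δ, hδ, fun u hu z hz => h u hu z (hst hz)⟩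
    · rintro s t ⟨δ, hδ, h⟩ ⟨δ', hδ', h'⟩
      refine ⟨min δ δ', lt_min hδ hδ', fun u hu z hz hz1 => ?_⟩
      rcases hz with hz | hz
      · exact (min_le_left _ _).trans (h u hu z hz hz1)
      · exact (min_le_right _ _).trans (h' u hu z hz hz1)
    · intro x hx
      obtain ⟨δ, hδ, ρ, hρ, hb⟩ := h x hx
      exact ⟨_, mem_nhdsWithin_of_mem_nhds (Metric.ball_mem_nhds x hρ), δ, hδ, hb⟩
  obtain ⟨δ, hδ, h⟩ := key
  exact ⟨δ, hδ, fun u hu z hz => h u hu z hz (hC1 hz)⟩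

lemma le_apply_zero_of_le_near (hn : 3 ≤ n) (hm : 2 ≤ m) {C : Set (Euc (n + ℓ))}
    (hC : IsCompact C) (hC1 : C ⊆ puncturedBall n ℓ) {ρ δ : ℝ} (hρ : 0 < ρ) (hδ : 0 < δ) :
    ∃ η > 0, ∀ u, memS n m ℓ u → ∀ z ∈ C,
      (∀ y ∈ Metric.ball z ρ, y ∈ Metric.ball (0 : Euc (n + ℓ)) 1 →
        δ ≤ u y - coneFn n ℓ (alpha0 n m) y) → η ≤ u 0 := by
  obtain ⟨δ1, ⟨hδ1, hδ12⟩, haxis⟩ := axis_barrier (n := n) (m := m) (ℓ := ℓ) hn hm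
  refine hC.induction_on (p := fun s => ∃ η > 0, ∀ u, memS n m ℓ u → ∀ z ∈ s,
      (∀ y ∈ Metric.ball z ρ, y ∈ Metric.ball (0 : Euc (n + ℓ)) 1 →
        δ ≤ u y - coneFn n ℓ (alpha0 n m) y) → η ≤ u 0) ?_ ?_ ?_ ?_
  · exact ⟨1, one_pos, fun u _ z hz => absurd hz (notMem_empty z)⟩
  · rintro s t hst ⟨η, hη, h⟩
    exact ⟨η, hη, fun u hu z hz => h u hu z (hst hz)⟩
  · rintro s t ⟨η, hη, h⟩ ⟨η', hη', h'⟩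
    refine ⟨min η η', lt_min hη hη', fun u hu z hz hz1 => ?_⟩
    rcases hz with hz | hz
    · exact (min_le_left _ _).trans (h u hu z hz hz1)
    · exact (min_le_right _ _).trans (h' u hu z hz hz1)
  · intro x hx
    set F : Set (Euc (n + ℓ) → ℝ) := {u | memS n m ℓ u ∧
      ∀ y ∈ Metric.ball x (ρ / 2), y ∈ Metric.ball (0 : Euc (n + ℓ)) 1 →
        δ ≤ u y - coneFn n ℓ (alpha0 n m) y} with hF
    have hFS : ∀ u ∈ F, memS n m ℓ u := fun u hu => hu.1
    have h0 : LowerBoundNear m F x := ⟨δ, hδ, ρ / 2, half_pos hρ, fun u hu => hu.2⟩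
    set S : Set (Euc (n + ℓ)) := Metric.closedBall 0 (1 / 2) ∩ {z | xnorm n ℓ z = δ1}
    have hS : IsCompact S := (isCompact_closedBall _ _).inter_right
      (isClosed_eq continuous_xnorm continuous_const)
    have hSb : S ⊆ puncturedBall n ℓ := by
      rintro z ⟨hz1, hz2⟩
      refine ⟨Metric.closedBall_subset_ball (by norm_num) hz1, ?_⟩
      have : xnorm n ℓ z = δ1 := hz2
      change 0 < xnorm n ℓ z
      rwa [this]
    obtain ⟨δ2, hδ2, hu2⟩ := LowerBoundNear.uniform hS (fun z hz => (hSb hz).1)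
      (fun z hz => h0.propagate hn hm hFS (hC1 hx) (hSb hz))
    obtain ⟨η, hη, hη'⟩ := haxis δ2 hδ2
    refine ⟨Metric.ball x (ρ / 2), mem_nhdsWithin_of_mem_nhds
      (Metric.ball_mem_nhds x (half_pos hρ)), η, hη, fun u hu z hz hb => ?_⟩
    have huF : u ∈ F := by
      refine ⟨hu, fun y hy hy1 => hb y ?_ hy1⟩
      have h1 := dist_triangle y x z
      have h2 : dist z x < ρ / 2 := hz
      have h3 : dist y x < ρ / 2 := hy
      rw [dist_comm x z] at h1
      exact Metric.mem_ball.2 (by linarith)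
    exact hη' u hu fun y hy hyx => hu2 u huF y ⟨mem_closedBall_zero_iff.2 hy, hyx⟩

end propagation

section bounds

lemma exists_norm_le_and_lipschitz {E F : Type*} [NormedAddCommGroup E] [NormedSpace ℝ E]
    [NormedAddCommGroup F] [NormedSpace ℝ F] {S : Set E} (hS : IsCompact S) {f : E → F}
    (hf : ∀ z ∈ S, ContDiffAt ℝ 1 f z) :
    ∃ C : ℝ, 0 ≤ C ∧ (∀ z ∈ S, ‖f z‖ ≤ C) ∧ ∀ z r, Metric.closedBall z r ⊆ S →
      ∀ x ∈ Metric.closedBall z r, ∀ y ∈ Metric.closedBall z r, ‖f y - f x‖ ≤ C * ‖y - x‖ := by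
  obtain ⟨C1, h1⟩ := hS.exists_bound_of_continuousOn
    (fun z hz => (hf z hz).continuousAt.continuousWithinAt)
  obtain ⟨C2, h2⟩ := hS.exists_bound_of_continuousOn (f := fderiv ℝ f)
    (fun z hz => ((hf z hz).fderiv_right (m := 0) (by norm_num)).continuousAt.continuousWithinAt)
  refine ⟨max 0 (max C1 C2), le_max_left _ _,
    fun z hz => (h1 z hz).trans ((le_max_left _ _).trans (le_max_right _ _)), ?_⟩
  intro z r hzr x hx y hy
  exact (convex_closedBall z r).norm_image_sub_le_of_norm_fderiv_le
    (fun w hw => (hf w (hzr hw)).differentiableAt (by norm_num))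
    (fun w hw => (h2 w (hzr hw)).trans ((le_max_right _ _).trans (le_max_right _ _))) hx hy

lemma le_apply_of_norm_fderiv_le {E : Type*} [NormedAddCommGroup E] [NormedSpace ℝ E] {w : E → ℝ}
    {z : E} {ρ ε M : ℝ} (hρ : 0 < ρ) (hM : 0 ≤ M)
    (hw : ∀ y ∈ Metric.ball z ρ, DifferentiableAt ℝ w y)
    (hwM : ∀ y ∈ Metric.ball z ρ, w y ≤ ε → ‖fderiv ℝ w y‖ ≤ M) (hz : ε ≤ w z) :
    ∀ y ∈ Metric.ball z ρ, ε - (M + 1) * ρ ≤ w y := by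
  intro y hy
  have hyz : ‖y - z‖ < ρ := mem_ball_iff_norm.1 hy
  have hseg : ∀ t ∈ Icc (0:ℝ) 1, z + t • (y - z) ∈ Metric.ball z ρ := fun t ht => by
    rw [mem_ball_iff_norm, add_sub_cancel_left, norm_smul, Real.norm_of_nonneg ht.1]
    exact (mul_le_of_le_one_left (norm_nonneg _) ht.2).trans_lt hyz
  have hd : ∀ t ∈ Icc (0:ℝ) 1, HasDerivAt (fun t : ℝ => -w (z + t • (y - z)))
      (-(fderiv ℝ w (z + t • (y - z)) (y - z))) t := fun t ht => by
    have h1 : HasDerivAt (fun t : ℝ => z + t • (y - z)) (y - z) t := by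
      simpa using ((hasDerivAt_id t).smul_const (y - z)).const_add z
    exact ((hw _ (hseg t ht)).hasFDerivAt.comp_hasDerivAt t h1).neg
  have hB : ∀ t : ℝ, HasDerivAt (fun t : ℝ => -ε + ((M + 1) * ρ) * t) ((M + 1) * ρ) t := fun t => by
    simpa using ((hasDerivAt_id t).const_mul ((M + 1) * ρ)).const_add (-ε)
  have h := image_le_of_deriv_right_lt_deriv_boundary' (a := 0) (b := 1)
    (fun t ht => (hd t ht).continuousAt.continuousWithinAt)
    (fun t ht => (hd t (Ico_subset_Icc_self ht)).hasDerivWithinAt)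
    (B := fun t => -ε + ((M + 1) * ρ) * t) (by simpa using hz)
    (fun t _ => (hB t).continuousAt.continuousWithinAt)
    (fun t _ => (hB t).hasDerivWithinAt) ?_ (right_mem_Icc.2 zero_le_one)
  · simp only [one_smul, mul_one, add_sub_cancel] at h
    linarith
  · intro t ht heq
    have ht' := Ico_subset_Icc_self ht
    have h0 : 0 ≤ (M + 1) * ρ * t := mul_nonneg (by positivity) ht'.1
    have h1 := hwM _ (hseg t ht') (by linarith)
    have h2 := (fderiv ℝ w (z + t • (y - z))).le_of_opNorm_le h1 (y - z)
    rw [Real.norm_eq_abs] at h2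
    have h3 := neg_le_abs (fderiv ℝ w (z + t • (y - z)) (y - z))
    have h4 : M * ‖y - z‖ ≤ M * ρ := by gcongr
    linarith

variable {n m ℓ : ℕ}

/-- The part of the closed ball of radius `θ` where `|x| ≥ c`. -/
def annulus (n ℓ : ℕ) (c θ : ℝ) : Set (Euc (n + ℓ)) := Metric.closedBall 0 θ ∩ {z | c ≤ xnorm n ℓ z}

lemma isCompact_annulus (c θ : ℝ) : IsCompact (annulus n ℓ c θ) :=
  (isCompact_closedBall _ _).inter_right (isClosed_le continuous_const continuous_xnorm)

lemma annulus_subset {c θ : ℝ} (hc : 0 < c) (hθ : θ < 1) :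
    annulus n ℓ c θ ⊆ puncturedBall n ℓ := fun _ hz =>
  ⟨Metric.closedBall_subset_ball hθ hz.1, hc.trans_le hz.2⟩

lemma annulus_mono {c c' θ θ' : ℝ} (hc : c' ≤ c) (hθ : θ ≤ θ') :
    annulus n ℓ c θ ⊆ annulus n ℓ c' θ' := fun _ hz =>
  ⟨Metric.closedBall_subset_closedBall hθ hz.1, hc.trans hz.2⟩

lemma closedBall_subset_annulus {c θ r : ℝ} {z : Euc (n + ℓ)} (hz : z ∈ annulus n ℓ c θ) :
    Metric.closedBall z r ⊆ annulus n ℓ (c - r) (θ + r) := by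
  intro y hy
  have hz1 : ‖z‖ ≤ θ := mem_closedBall_zero_iff.1 hz.1
  have hz2 : c ≤ xnorm n ℓ z := hz.2
  have hy1 : ‖y - z‖ ≤ r := mem_closedBall_iff_norm.1 hy
  refine ⟨mem_closedBall_zero_iff.2 ?_, ?_⟩
  · have := norm_le_insert' y z
    linarith
  · change c - r ≤ xnorm n ℓ y
    have h1 := norm_xproj_le (y - z)
    rw [map_sub] at h1
    have h2 := norm_sub_norm_le (xproj n ℓ z) (xproj n ℓ y)
    rw [norm_sub_rev, norm_xproj, norm_xproj] at h2
    linarith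

lemma memS.div_le (hn : 3 ≤ n) (hm : 2 ≤ m) {u : Euc (n + ℓ) → ℝ} (hu : memS n m ℓ u)
    {c θ : ℝ} (hc : 0 < c) (hθ : θ < 1) {z : Euc (n + ℓ)} (hz : z ∈ annulus n ℓ c θ) :
    ((m:ℝ) - 1) / u z ≤ ((m:ℝ) - 1) / (alpha0 n m * c) + ((m:ℝ) - 1) / (alpha0 n m * c) ^ 2 ∧
    ((m:ℝ) - 1) / u z ^ 2
      ≤ ((m:ℝ) - 1) / (alpha0 n m * c) + ((m:ℝ) - 1) / (alpha0 n m * c) ^ 2 := by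
  have hm2 : (2:ℝ) ≤ m := by exact_mod_cast hm
  have hκ : (0:ℝ) ≤ (m:ℝ) - 1 := by linarith
  have hα := alpha0_pos hn hm
  have hαc : 0 < alpha0 n m * c := mul_pos hα hc
  have h1 := hu.sub_pos ((annulus_subset hc hθ hz).1)
  have h2 : alpha0 n m * c ≤ coneFn n ℓ (alpha0 n m) z := mul_le_mul_of_nonneg_left hz.2 hα.le
  have h3 : alpha0 n m * c ≤ u z := by linarith
  constructor
  · refine le_trans ?_ (le_add_of_nonneg_right (by positivity))
    gcongr
  · refine le_trans ?_ (le_add_of_nonneg_left (by positivity))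
    gcongr

lemma fderiv_sub_coneFn {u : Euc (n + ℓ) → ℝ} {z : Euc (n + ℓ)} (α : ℝ) (hu : ContDiffAt ℝ 2 u z)
    (hz : 0 < xnorm n ℓ z) :
    fderiv ℝ (fun y => u y - coneFn n ℓ α y) z = fderiv ℝ u z - fderiv ℝ (coneFn n ℓ α) z :=
  fderiv_fun_sub (hu.differentiableAt (by norm_num))
    ((contDiffAt_coneFn (k := 1) α hz).differentiableAt (by norm_num))

lemma exists_gradient_bound (hn : 3 ≤ n) (hm : 2 ≤ m) {c θ : ℝ} (hc : 0 < c) (hθ : θ < 1) :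
    ∃ M > 0, ∀ u, memS n m ℓ u → ∀ z ∈ annulus n ℓ c θ,
      u z - coneFn n ℓ (alpha0 n m) z ≤ 1 → ‖gradient u z‖ ≤ M := by
  have hm2 : (2:ℝ) ≤ m := by exact_mod_cast hm
  have hκ : (0:ℝ) ≤ (m:ℝ) - 1 := by linarith
  have hα := alpha0_pos hn hm
  set r := min (c / 2) ((1 - θ) / 2) with hr
  have hθ' : 0 < 1 - θ := by linarith
  have hr0 : 0 < r := by positivity
  have hrc : r ≤ c / 2 := min_le_left _ _
  have hrθ : r ≤ (1 - θ) / 2 := min_le_right _ _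
  have hc2 : 0 < c / 2 := by positivity
  have hθ2 : (1 + θ) / 2 < 1 := by linarith
  obtain ⟨M, hM, h⟩ := gradient_bound (n + ℓ) hκ (H := alpha0 n m + 1) (by linarith) hr0
    (C := ((m:ℝ) - 1) / (alpha0 n m * (c / 2)) + ((m:ℝ) - 1) / (alpha0 n m * (c / 2)) ^ 2)
    (by positivity)
  refine ⟨M, hM, fun u hu z hz hw => ?_⟩
  have hsub : Metric.closedBall z r ⊆ annulus n ℓ (c / 2) ((1 + θ) / 2) :=
    (closedBall_subset_annulus hz).trans (annulus_mono (by linarith) (by linarith))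
  have hb : ∀ y ∈ Metric.closedBall z r, y ∈ Metric.ball (0 : Euc (n + ℓ)) 1 :=
    fun y hy => (annulus_subset hc2 hθ2 (hsub hy)).1
  refine h u z (fun y hy => hu.contDiffAt (hb y hy)) (fun y hy => hu.pos (hb y hy))
    (fun y hy => hu.solE (hb y hy)) (fun y hy => (hu.div_le hn hm hc2 hθ2 (hsub hy)).1)
    (fun y hy => (hu.div_le hn hm hc2 hθ2 (hsub hy)).2) ?_
  have h1 : ‖z‖ ≤ θ := mem_closedBall_zero_iff.1 hz.1
  have h2 : xnorm n ℓ z ≤ 1 := by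
    rw [← norm_xproj]; exact (norm_xproj_le z).trans (h1.trans hθ.le)
  have h3 : coneFn n ℓ (alpha0 n m) z ≤ alpha0 n m * 1 := mul_le_mul_of_nonneg_left h2 hα.le
  linarith

lemma exists_sub_coneFn_lt (hn : 3 ≤ n) (hm : 2 ≤ m) {c θ ε : ℝ} (hc : 0 < c) (hθ : θ < 1)
    (hε : 0 < ε) (hε1 : ε ≤ 1) :
    ∃ η > 0, ∀ u, memS n m ℓ u → u 0 < η → ∀ z ∈ annulus n ℓ c θ,
      u z - coneFn n ℓ (alpha0 n m) z < ε := by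
  have hα := alpha0_pos hn hm
  have hθ' : 0 < 1 - θ := by linarith
  have hc2 : 0 < c / 2 := by positivity
  have hθ2 : (1 + θ) / 2 < 1 := by linarith
  obtain ⟨M, hM, hgrad⟩ := exists_gradient_bound (n := n) (m := m) (ℓ := ℓ) hn hm hc2 hθ2
  set r := min (c / 2) (min ((1 - θ) / 2) (ε / (2 * (M + alpha0 n m + 1)))) with hr
  have hr0 : 0 < r := by positivity
  have hrc : r ≤ c / 2 := min_le_left _ _
  have hrθ : r ≤ (1 - θ) / 2 := (min_le_right _ _).trans (min_le_left _ _)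
  have hrε : r * (2 * (M + alpha0 n m + 1)) ≤ ε := by
    rw [← le_div_iff₀ (by positivity)]
    exact (min_le_right _ _).trans (min_le_right _ _)
  obtain ⟨η, hη, h⟩ := le_apply_zero_of_le_near hn hm (isCompact_annulus (n := n) (ℓ := ℓ) c θ)
    (annulus_subset hc hθ) hr0 (half_pos hε)
  refine ⟨η, hη, fun u hu hu0 z hz => ?_⟩
  by_contra! hcon
  refine (h u hu z hz fun y hy _ => ?_).not_gt hu0
  have hsub : Metric.ball z r ⊆ annulus n ℓ (c / 2) ((1 + θ) / 2) :=
    Metric.ball_subset_closedBall.trans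
      ((closedBall_subset_annulus hz).trans (annulus_mono (by linarith) (by linarith)))
  have hb := fun y hy => annulus_subset hc2 hθ2 (hsub (a := y) hy)
  have h1 := le_apply_of_norm_fderiv_le (w := fun y => u y - coneFn n ℓ (alpha0 n m) y) (ε := ε)
    (M := M + alpha0 n m) hr0 (by positivity)
    (fun y hy => ((hu.contDiffAt (hb y hy).1).sub
      (contDiffAt_coneFn _ (hb y hy).2)).differentiableAt (by norm_num)) ?_ hcon y hy
  · linarith
  · intro y hy hle
    rw [fderiv_sub_coneFn _ (hu.contDiffAt (hb y hy).1) (hb y hy).2]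
    refine (norm_sub_le _ _).trans ?_
    rw [← norm_gradient]
    exact add_le_add (hgrad u hu y (hsub hy) (hle.trans hε1))
      (norm_fderiv_coneFn_le hα.le (hb y hy).2)

end bounds

section assembly

variable {n m ℓ : ℕ}

lemma exists_norm_gradient_sub_le (hn : 3 ≤ n) (hm : 2 ≤ m) {c θ τ : ℝ} (hc : 0 < c) (hθ : θ < 1)
    (hτ : 0 < τ) :
    ∃ η > 0, ∀ u, memS n m ℓ u → u 0 < η → ∀ z ∈ annulus n ℓ c θ,
      ‖gradient u z - gradient (coneFn n ℓ (alpha0 n m)) z‖ ≤ τ := by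
  have hα := alpha0_pos hn hm
  have hm2 : (2:ℝ) ≤ m := by exact_mod_cast hm
  have hκ : (0:ℝ) ≤ (m:ℝ) - 1 := by linarith
  have hθ' : 0 < 1 - θ := by linarith
  have hc2 : 0 < c / 2 := by positivity
  have hθ2 : (1 + θ) / 2 < 1 := by linarith
  obtain ⟨M, hM, hgrad⟩ := exists_gradient_bound (n := n) (m := m) (ℓ := ℓ) hn hm hc2 hθ2
  obtain ⟨Cψ, hCψ0, hCψ, -⟩ := exists_norm_le_and_lipschitz
    (isCompact_annulus (n := n) (ℓ := ℓ) (c / 2) ((1 + θ) / 2))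
    (f := D2 (coneFn n ℓ (alpha0 n m)))
    (fun z hz => ((contDiffAt_coneFn (k := 3) _ (annulus_subset hc2 hθ2 hz).2).fderiv_right
      (m := 2) (by norm_num)).fderiv_right (m := 1) (by norm_num))
  set C := ((m:ℝ) - 1) / (alpha0 n m * (c / 2)) + ((m:ℝ) - 1) / (alpha0 n m * (c / 2)) ^ 2 with hC
  have hC0 : 0 ≤ C := by positivity
  set r := min (c / 2) ((1 - θ) / 2) with hr
  have hr0 : 0 < r := by positivity
  have hrc : r ≤ c / 2 := min_le_left _ _
  have hrθ : r ≤ (1 - θ) / 2 := min_le_right _ _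
  obtain ⟨ε, hε, h⟩ := gradient_small (N := n + ℓ) (by omega) hτ (Λ := M + alpha0 n m)
    (C := (1 + (M + alpha0 n m) ^ 2) * C) (by positivity) (by positivity) hCψ0 hr0
  obtain ⟨η, hη, hw⟩ := exists_sub_coneFn_lt (n := n) (m := m) (ℓ := ℓ) hn hm hc2 hθ2
    (lt_min one_pos hε) (min_le_left _ _)
  refine ⟨η, hη, fun u hu hu0 z hz => ?_⟩
  have hsub : Metric.closedBall z r ⊆ annulus n ℓ (c / 2) ((1 + θ) / 2) :=
    (closedBall_subset_annulus hz).trans (annulus_mono (by linarith) (by linarith))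
  have hb := fun y hy => annulus_subset hc2 hθ2 (hsub (a := y) hy)
  have hgr : ∀ y ∈ Metric.closedBall z r, ‖gradient u y‖ ≤ M + alpha0 n m := fun y hy =>
    (hgrad u hu y (hsub hy) ((hw u hu hu0 y (hsub hy)).le.trans (min_le_left _ _))).trans
      (by linarith)
  refine h u (coneFn n ℓ (alpha0 n m)) z (fun y hy => hu.contDiffAt (hb y hy).1)
    (fun y hy => contDiffAt_coneFn _ (hb y hy).2) hgr ?_ (fun y hy => hCψ y (hsub hy)) ?_ ?_
  · rw [norm_gradient]
    have := norm_fderiv_coneFn_le hα.le (hb z (Metric.mem_closedBall_self hr0.le)).2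
    linarith
  · intro y hy
    have h1 : opE (gradient u y) (fun ξ => D2 u y ξ ξ) = _ := hu.solE (hb y hy).1
    have h2 := (hu.div_le hn hm hc2 hθ2 (hsub hy)).1
    have h3 := hu.pos (hb y hy).1
    have h4 := hgr y hy
    rw [h1, abs_of_nonneg (by positivity)]
    gcongr
  · intro y hy
    rw [abs_of_pos (hu.sub_pos (hb y hy).1)]
    exact (hw u hu hu0 y (hsub hy)).le.trans (min_le_right _ _)

lemma exists_norm_D2_sub_le (hn : 3 ≤ n) (hm : 2 ≤ m) {c θ τ : ℝ} (hc : 0 < c) (hθ : θ < 1)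
    (hτ : 0 < τ) :
    ∃ η > 0, ∀ u, memS n m ℓ u → u 0 < η → ∀ z ∈ annulus n ℓ c θ,
      ‖D2 u z - D2 (coneFn n ℓ (alpha0 n m)) z‖ ≤ τ := by
  have hα := alpha0_pos hn hm
  have hm2 : (2:ℝ) ≤ m := by exact_mod_cast hm
  have hκ : (0:ℝ) ≤ (m:ℝ) - 1 := by linarith
  have hθ' : 0 < 1 - θ := by linarith
  have hc2 : 0 < c / 2 := by positivity
  have hθ2 : (1 + θ) / 2 < 1 := by linarith
  obtain ⟨M, hM, hgrad⟩ := exists_gradient_bound (n := n) (m := m) (ℓ := ℓ) hn hm hc2 hθ2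
  obtain ⟨Cψ, hCψ0, hCψ, hLip⟩ := exists_norm_le_and_lipschitz
    (isCompact_annulus (n := n) (ℓ := ℓ) (c / 2) ((1 + θ) / 2))
    (f := D2 (coneFn n ℓ (alpha0 n m)))
    (fun z hz => ((contDiffAt_coneFn (k := 3) _ (annulus_subset hc2 hθ2 hz).2).fderiv_right
      (m := 2) (by norm_num)).fderiv_right (m := 1) (by norm_num))
  set C := ((m:ℝ) - 1) / (alpha0 n m * (c / 2)) + ((m:ℝ) - 1) / (alpha0 n m * (c / 2)) ^ 2 with hC
  have hC0 : 0 ≤ C := by positivity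
  set r := min (c / 2) ((1 - θ) / 2) with hr
  have hr0 : 0 < r := by positivity
  have hrc : r ≤ c / 2 := min_le_left _ _
  have hrθ : r ≤ (1 - θ) / 2 := min_le_right _ _
  obtain ⟨ε, hε, h⟩ := hess_small (N := n + ℓ) (by omega) hκ hτ hM.le hC0 hCψ0 hCψ0 hr0
  obtain ⟨η, hη, hw⟩ := exists_sub_coneFn_lt (n := n) (m := m) (ℓ := ℓ) hn hm hc2 hθ2
    one_pos le_rfl
  obtain ⟨η', hη', hd⟩ := exists_norm_gradient_sub_le (n := n) (m := m) (ℓ := ℓ) hn hm hc2 hθ2 hε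
  refine ⟨min η η', lt_min hη hη', fun u hu hu0 z hz => ?_⟩
  have hsub : Metric.closedBall z r ⊆ annulus n ℓ (c / 2) ((1 + θ) / 2) :=
    (closedBall_subset_annulus hz).trans (annulus_mono (by linarith) (by linarith))
  have hb := fun y hy => annulus_subset hc2 hθ2 (hsub (a := y) hy)
  exact h u (coneFn n ℓ (alpha0 n m)) z (fun y hy => hu.contDiffAt (hb y hy).1)
    (fun y hy => contDiffAt_coneFn _ (hb y hy).2) (fun y hy => hu.pos (hb y hy).1)
    (fun y hy => hu.solE (hb y hy).1)
    (fun y hy => hgrad u hu y (hsub hy)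
      (hw u hu (hu0.trans_le (min_le_left _ _)) y (hsub hy)).le)
    (fun y hy => (hu.div_le hn hm hc2 hθ2 (hsub hy)).1)
    (fun y hy => (hu.div_le hn hm hc2 hθ2 (hsub hy)).2)
    (fun y hy => hCψ y (hsub hy)) (hLip z r hsub)
    (fun y hy => hd u hu (hu0.trans_le (min_le_right _ _)) y (hsub hy))

section scaling

variable {E : Type*} [NormedAddCommGroup E] [NormedSpace ℝ E]

lemma fderiv_scale {s : ℝ} (hs : s ≠ 0) (f : E → ℝ) :
    fderiv ℝ (fun y => s⁻¹ * f (s • y)) = fun y => fderiv ℝ f (s • y) := by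
  funext y
  have h1 : fderiv ℝ (fun y => s⁻¹ • f (s • y)) y = s⁻¹ • fderiv ℝ (fun y => f (s • y)) y :=
    congrFun (fderiv_const_smul_field (f := fun y => f (s • y)) s⁻¹) y
  have h2 : fderiv ℝ (fun y => f (s • y)) y = s • fderiv ℝ f (s • y) := fderiv_comp_smul s
  change fderiv ℝ (fun y => s⁻¹ • f (s • y)) y = _
  rw [h1, h2, smul_smul, inv_mul_cancel₀ hs, one_smul]

lemma D2_scale {s : ℝ} (hs : s ≠ 0) (f : E → ℝ) (z : E) :
    D2 (fun y => s⁻¹ * f (s • y)) z = s • D2 f (s • z) := by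
  rw [D2, fderiv_scale hs]
  exact fderiv_comp_smul (f := fderiv ℝ f) s

lemma norm_smul_of_pos {s : ℝ} (hs : 0 < s) (x : E) : ‖s • x‖ = s * ‖x‖ := by
  rw [norm_smul, Real.norm_of_nonneg hs.le]

lemma norm_iteratedFDeriv_two_eq (f : E → ℝ) (z : E) : ‖iteratedFDeriv ℝ 2 f z‖ = ‖D2 f z‖ := by
  rw [← norm_iteratedFDeriv_fderiv, norm_iteratedFDeriv_one]; rfl

end scaling

lemma smeM_scale {N : ℕ} {s : ℝ} (hs : s ≠ 0) (u : Euc N → ℝ) (z : Euc N) :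
    smeM m (fun y => s⁻¹ * u (s • y)) z = s * smeM m u (s • z) := by
  have h1 : ∀ i y, pd (fun y => s⁻¹ * u (s • y)) i y = pd u i (s • y) := fun i y => by
    rw [pd, fderiv_scale hs]; rfl
  have h2 : ∀ i j, pd2 (fun y => s⁻¹ * u (s • y)) i j z = s * pd2 u i j (s • z) := fun i j => by
    have h3 : fderiv ℝ (fun y => pd u j (s • y)) z = s • fderiv ℝ (fun y => pd u j y) (s • z) :=
      fderiv_comp_smul (f := fun y => pd u j y) s
    simp only [pd2, h1, h3]
    rfl
  simp only [smeM, gradSq, h1, h2]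
  rw [mul_sub, mul_sub, Finset.mul_sum, Finset.mul_sum]
  congr 1
  · congr 1
    refine Finset.sum_congr rfl fun i _ => ?_
    rw [Finset.mul_sum]
    exact Finset.sum_congr rfl fun j _ => by ring
  · field_simp

lemma memS.scale {u : Euc (n + ℓ) → ℝ} (hu : memS n m ℓ u) {s : ℝ} (hs : 0 < s) (hs1 : s ≤ 1) :
    memS n m ℓ (fun y => s⁻¹ * u (s • y)) := by
  have hmap : ∀ z ∈ Metric.ball (0 : Euc (n + ℓ)) 1, s • z ∈ Metric.ball (0 : Euc (n + ℓ)) 1 := by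
    intro z hz
    rw [mem_ball_zero_iff] at hz ⊢
    rw [norm_smul, Real.norm_of_nonneg hs.le]
    exact (mul_le_of_le_one_left (norm_nonneg z) hs1).trans_lt hz
  refine ⟨contDiffOn_const.mul (hu.1.comp (contDiff_const_smul s).contDiffOn hmap),
    fun z hz => ?_, fun z hz => ?_⟩
  · rw [smeM_scale hs.ne', hu.2.1 _ (hmap z hz), mul_zero]
  · have h := hu.2.2 _ (hmap z hz)
    rw [xnorm_smul hs.le] at h
    have h2 : s⁻¹ * u (s • z) - alpha0 n m * xnorm n ℓ z
      = s⁻¹ * (u (s • z) - alpha0 n m * (s * xnorm n ℓ z)) := by field_simp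
    rw [h2]
    positivity

lemma quarter_mul_lt_xnorm {κ₀ θ : ℝ} (hκ0 : 0 < κ₀) (hκ : κ₀ ≤ 1 / 2) (hθ : 1 / 2 ≤ θ)
    {ζ : Euc (n + ℓ)} (hζ : ‖ζ‖ = θ) (h : κ₀ * ynorm n ℓ ζ < xnorm n ℓ ζ) :
    κ₀ / 4 ≤ xnorm n ℓ ζ := by
  by_contra! hc
  have h1 := norm_sq_eq_xnorm_add_ynorm ζ
  have hx := xnorm_nonneg ζ
  have hy : 0 ≤ ynorm n ℓ ζ := Real.sqrt_nonneg _
  have hy1 : ynorm n ℓ ζ < 1 / 4 := by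
    by_contra! hy2
    have : κ₀ * (1 / 4) ≤ κ₀ * ynorm n ℓ ζ := by gcongr
    linarith
  have hx1 : xnorm n ℓ ζ ^ 2 ≤ (1 / 8) ^ 2 := by gcongr; linarith
  have hy2 : ynorm n ℓ ζ ^ 2 ≤ (1 / 4) ^ 2 := by gcongr
  have h3 : (1 / 2) ^ 2 ≤ θ ^ 2 := by gcongr
  rw [hζ] at h1
  linarith

lemma ynorm_smul {c : ℝ} (hc : 0 ≤ c) (z : Euc (n + ℓ)) :
    ynorm n ℓ (c • z) = c * ynorm n ℓ z := by
  simp only [ynorm, PiLp.smul_apply, smul_eq_mul, mul_pow]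
  rw [← Finset.mul_sum, Real.sqrt_mul (sq_nonneg c), Real.sqrt_sq hc]

end assembly

/-- Lemma `loc-bds-sme`. For each `κ₀ ∈ (0,1/2]` and `θ ∈ [1/2,1)`
there are `p > 1` and `η ∈ (0,1/2]` such that for every `u ∈ 𝒮` with `u(0,0) < η`,
at every point of the closed ball `B_θ` with `|x| > p·u(0,0)` and `|x| > κ₀|y|`,
`|x|⁻¹(u−α₀|x|) + |D(u−α₀|x|)| + |x||D²(u−α₀|x|)| ≤ κ₀`. -/
theorem sme_local_bounds
    (n m ℓ : ℕ) (hn : 3 ≤ n) (hm : 2 ≤ m) (hl : 1 ≤ ℓ) (hnm : 8 ≤ n + m)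
    (κ₀ : ℝ) (hκ₀ : κ₀ ∈ Ioc (0:ℝ) (1/2)) (θ : ℝ) (hθ : θ ∈ Ico (1/2 : ℝ) 1) :
    ∃ p : ℝ, 1 < p ∧ ∃ η ∈ Ioc (0:ℝ) (1/2),
      ∀ u : Euc (n + ℓ) → ℝ, memS n m ℓ u → u 0 < η →
        ∀ z ∈ Metric.closedBall (0 : Euc (n + ℓ)) θ,
          p * u 0 < xnorm n ℓ z → κ₀ * ynorm n ℓ z < xnorm n ℓ z →
            (xnorm n ℓ z)⁻¹ * (u z - alpha0 n m * xnorm n ℓ z)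
              + ‖fderiv ℝ (fun w => u w - alpha0 n m * xnorm n ℓ w) z‖
              + xnorm n ℓ z *
                  ‖iteratedFDeriv ℝ 2 (fun w => u w - alpha0 n m * xnorm n ℓ w) z‖
              ≤ κ₀ := by
  obtain ⟨hκ0, hκ1⟩ := hκ₀
  obtain ⟨hθ1, hθ2⟩ := hθ
  have hc : 0 < κ₀ / 4 := by positivity
  have hτ : 0 < κ₀ ^ 2 / 12 := by positivity
  have hκsq : κ₀ ^ 2 ≤ κ₀ := by rw [sq]; exact mul_le_of_le_one_left hκ0.le (by linarith)
  obtain ⟨η1, hη1, h1⟩ := exists_sub_coneFn_lt (n := n) (m := m) (ℓ := ℓ) hn hm hc hθ2 hτ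
    (by linarith)
  obtain ⟨η2, hη2, h2⟩ := exists_norm_gradient_sub_le (n := n) (m := m) (ℓ := ℓ) hn hm hc hθ2 hτ
  obtain ⟨η3, hη3, h3⟩ := exists_norm_D2_sub_le (n := n) (m := m) (ℓ := ℓ) hn hm hc hθ2 hτ
  set η0 := min η1 (min η2 η3) with hη0
  have hη0p : 0 < η0 := by positivity
  refine ⟨max 2 (1 / η0), lt_max_of_lt_left one_lt_two, 1 / 2, ⟨by norm_num, le_rfl⟩, ?_⟩
  intro u hu _ z hz hp hxy
  have hu0 : 0 < u 0 := hu.pos (by simp)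
  have hx0 : 0 < xnorm n ℓ z := lt_trans (by positivity) hp
  have hxz : xnorm n ℓ z ≤ ‖z‖ := by rw [← norm_xproj]; exact norm_xproj_le z
  have hzθ : ‖z‖ ≤ θ := mem_closedBall_zero_iff.1 hz
  have hθ0 : 0 < θ := by linarith
  set s := ‖z‖ / θ with hs
  have hs0 : 0 < s := div_pos (hx0.trans_le hxz) hθ0
  have hs1 : s ≤ 1 := (div_le_one hθ0).2 hzθ
  set ζ := s⁻¹ • z with hζ
  have hsζ : s • ζ = z := by rw [hζ, smul_smul, mul_inv_cancel₀ hs0.ne', one_smul]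
  have hζn : ‖ζ‖ = θ := by
    rw [hζ, norm_smul, Real.norm_of_nonneg (by positivity), hs]
    have := (hx0.trans_le hxz).ne'
    field_simp
  have hxs : xnorm n ℓ z = s * xnorm n ℓ ζ := by rw [← xnorm_smul hs0.le, hsζ]
  have hys : ynorm n ℓ z = s * ynorm n ℓ ζ := by rw [← ynorm_smul hs0.le, hsζ]
  have hxζ : κ₀ / 4 ≤ xnorm n ℓ ζ := by
    refine quarter_mul_lt_xnorm hκ0 hκ1 hθ1 hζn ?_
    rw [hxs, hys] at hxy
    exact lt_of_mul_lt_mul_left (by linarith) hs0.le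
  have hζa : ζ ∈ annulus n ℓ (κ₀ / 4) θ := ⟨mem_closedBall_zero_iff.2 hζn.le, hxζ⟩
  have hζp := annulus_subset hc hθ2 hζa
  have hxζ0 : 0 < xnorm n ℓ ζ := hζp.2
  have hv := hu.scale hs0 hs1
  set v : Euc (n + ℓ) → ℝ := fun y => s⁻¹ * u (s • y) with hvd
  have hv0 : v 0 < η0 := by
    have e1 : v 0 = s⁻¹ * u 0 := by simp [hvd]
    rw [e1, hs, inv_div, div_mul_eq_mul_div, div_lt_iff₀ (hx0.trans_le hxz)]
    have e2 : 1 / η0 * u 0 < ‖z‖ :=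
      lt_of_le_of_lt (mul_le_mul_of_nonneg_right (le_max_right _ _) hu0.le) (hp.trans_le hxz)
    have e3 : u 0 < η0 * ‖z‖ := by
      rw [one_div, inv_mul_lt_iff₀ hη0p] at e2; exact e2
    exact lt_of_le_of_lt (mul_le_of_le_one_left hu0.le hθ2.le) e3
  have hA := h1 v hv (hv0.trans_le (min_le_left _ _)) ζ hζa
  have hB := h2 v hv (hv0.trans_le ((min_le_right _ _).trans (min_le_left _ _))) ζ hζa
  have hC := h3 v hv (hv0.trans_le ((min_le_right _ _).trans (min_le_right _ _))) ζ hζa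
  have hvζ := hv.contDiffAt hζp.1
  have hψζ := contDiffAt_coneFn (k := 2) (alpha0 n m) hζp.2
  set W : Euc (n + ℓ) → ℝ := fun w => u w - alpha0 n m * xnorm n ℓ w with hW
  have hWv : (fun y => v y - coneFn n ℓ (alpha0 n m) y) = fun y => s⁻¹ * W (s • y) := by
    funext y
    simp only [hvd, hW, coneFn, xnorm_smul hs0.le]
    field_simp
  have hT1 : (xnorm n ℓ z)⁻¹ * W z ≤ κ₀ / 3 := by
    have e1 : s⁻¹ * W (s • ζ) < κ₀ ^ 2 / 12 := by
      have := congrFun hWv ζ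
      exact this ▸ hA
    rw [hsζ, inv_mul_lt_iff₀ hs0] at e1
    rw [inv_mul_le_iff₀ hx0, hxs]
    have e2 : s * (κ₀ / 4) * (κ₀ / 3) ≤ s * xnorm n ℓ ζ * (κ₀ / 3) := by gcongr
    linarith
  have hT2 : ‖fderiv ℝ W z‖ ≤ κ₀ / 3 := by
    have e1 : fderiv ℝ W z = fderiv ℝ v ζ - fderiv ℝ (coneFn n ℓ (alpha0 n m)) ζ := by
      rw [← fderiv_sub_coneFn _ hvζ hζp.2, hWv, fderiv_scale hs0.ne']
      exact (congrArg (fderiv ℝ W) hsζ).symm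
    rw [e1]
    have e2 : ‖fderiv ℝ v ζ - fderiv ℝ (coneFn n ℓ (alpha0 n m)) ζ‖ ≤ κ₀ ^ 2 / 12 := by
      rw [gradient, gradient, ← map_sub, LinearIsometryEquiv.norm_map] at hB
      exact hB
    linarith
  have hT3 : xnorm n ℓ z * ‖iteratedFDeriv ℝ 2 W z‖ ≤ κ₀ / 3 := by
    rw [norm_iteratedFDeriv_two_eq]
    have e1 : s • D2 W z = D2 v ζ - D2 (coneFn n ℓ (alpha0 n m)) ζ := by
      rw [← D2_sub hvζ hψζ, hWv, D2_scale hs0.ne', hsζ]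
    have e2 : s * ‖D2 W z‖ ≤ κ₀ ^ 2 / 12 := by
      rw [← e1] at hC
      have e3 := norm_smul_of_pos (E := Euc (n + ℓ) →L[ℝ] Euc (n + ℓ) →L[ℝ] ℝ) hs0 (D2 W z)
      exact e3 ▸ hC
    have e4 : xnorm n ℓ ζ ≤ 1 := by
      rw [← norm_xproj]; exact (norm_xproj_le ζ).trans (by linarith)
    have e5 : xnorm n ℓ ζ * (s * ‖D2 W z‖) ≤ 1 * (κ₀ ^ 2 / 12) :=
      mul_le_mul e4 e2 (by positivity) zero_le_one
    rw [hxs]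
    linarith
  linarith
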